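/- Let q be a prime power, and let P ⊆ ℝ² be an integral convex polygon properly contained in □_{q−1} with I(P) > 0. Suppose q ≥ (4·I(P) + 3)². Let ℓ be the largest positive integer such that there exists an integral convex polygon P′ ⊆ P admitting a Minkowski sum decomposition P′ = P₁ + P₂ + ⋯ + P_ℓ in which every P_i is a nontrivial integral convex polygon. Then there exist an integral convex polygon P′ ⊆ P and nontrivial integral convex polygons P₁, …, P_ℓ with P′ = P₁ + ⋯ + P_ℓ (each P_i translated by a lattice vector so that P_i ∩ ℤ² ⊆ {0,…,q−2}²) such that d(C_P(𝔽_q)) ≥ Σ_{i=1}^ℓ d(C_{P_i}(𝔽_q)) − (ℓ−1)(q−1)². -/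

import Mathlib

open Pointwise

/-- Embed a lattice point of `ℤ²` into `ℝ²`. -/
def toR2 (m : ℤ × ℤ) : ℝ × ℝ := ((m.1 : ℝ), (m.2 : ℝ))

/-- An integral convex polygon: the convex hull of a finite nonempty set of lattice points. -/
def IsIntPolygon (P : Set (ℝ × ℝ)) : Prop :=
  ∃ V : Finset (ℤ × ℤ), V.Nonempty ∧ P = convexHull ℝ (toR2 '' ↑V)

/-- The lattice points of a subset of `ℝ²`. -/
def latticePts (P : Set (ℝ × ℝ)) : Set (ℤ × ℤ) := {m | toR2 m ∈ P}

/-- `I(P)`: the number of lattice points in the interior of `P`. -/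
noncomputable def intPts (P : Set (ℝ × ℝ)) : ℕ := (latticePts (interior P)).ncard

/-- `#(P)`: the number of lattice points of `P`. -/
noncomputable def numPts (P : Set (ℝ × ℝ)) : ℕ := (latticePts P).ncard

/-- The lattice points of the square `□_{q-1} = [0, q-2] × [0, q-2]`. -/
def box (q : ℕ) : Set (ℤ × ℤ) :=
  {m | 0 ≤ m.1 ∧ m.1 ≤ (q : ℤ) - 2 ∧ 0 ≤ m.2 ∧ m.2 ≤ (q : ℤ) - 2}

/-- The evaluation vector of the monomial `x^{m₁} y^{m₂}` at all points of the torus `(F*)²`. -/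
def evalVec (F : Type) [Field F] (m : ℤ × ℤ) : Fˣ × Fˣ → F :=
  fun p => ((p.1 ^ m.1 * p.2 ^ m.2 : Fˣ) : F)

/-- The toric code associated to a set `S ⊆ ℤ²` of exponent vectors: the span of the
evaluation vectors of the corresponding monomials. -/
noncomputable def toricCode (F : Type) [Field F] (S : Set (ℤ × ℤ)) :
    Submodule F (Fˣ × Fˣ → F) :=
  Submodule.span F (evalVec F '' S)

/-- Hamming weight of a word indexed by the torus `(F*)²`. -/
noncomputable def wt {F : Type} [Field F] (c : Fˣ × Fˣ → F) : ℕ :=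
  {p | c p ≠ 0}.ncard

/-- Minimum distance of a linear code: minimum Hamming weight of a nonzero codeword. -/
noncomputable def minDist (F : Type) [Field F] (C : Submodule F (Fˣ × Fˣ → F)) : ℕ :=
  sInf {w | ∃ c ∈ C, c ≠ 0 ∧ wt c = w}

/-- The support of a bivariate polynomial, as a set of lattice points. -/
def suppZ {K : Type} [CommSemiring K] (f : MvPolynomial (Fin 2) K) : Set (ℤ × ℤ) :=
  (fun d : Fin 2 →₀ ℕ => ((d 0 : ℤ), (d 1 : ℤ))) '' ↑f.support

/-- The Newton polygon of a bivariate polynomial. -/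
noncomputable def NP {K : Type} [CommSemiring K] (f : MvPolynomial (Fin 2) K) :
    Set (ℝ × ℝ) :=
  convexHull ℝ (toR2 '' suppZ f)

/-- Evaluate a bivariate polynomial at a point of the torus `(F*)²`. -/
noncomputable def evalT {F : Type} [Field F] (f : MvPolynomial (Fin 2) F) (p : Fˣ × Fˣ) : F :=
  MvPolynomial.eval ![(p.1 : F), (p.2 : F)] f

/-- The number of points of the torus `(F*)²` at which `f` vanishes. -/
noncomputable def nzeros {F : Type} [Field F] (f : MvPolynomial (Fin 2) F) : ℕ :=
  {p : Fˣ × Fˣ | evalT f p = 0}.ncard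

/-- `P` contains a subpolygon decomposing as a Minkowski sum of `n` nontrivial
integral convex polygons. -/
def HasDecomp (P : Set (ℝ × ℝ)) (n : ℕ) : Prop :=
  ∃ Q : Fin n → Set (ℝ × ℝ),
    (∀ i, IsIntPolygon (Q i) ∧ (Q i).Nontrivial) ∧ (∑ i, Q i) ⊆ P

section

open Polynomial

/-- The convex hull of a finite set of lattice points. -/
noncomputable def hullZ (V : Finset (ℤ × ℤ)) : Set (ℝ × ℝ) := convexHull ℝ (toR2 '' (V : Set (ℤ × ℤ)))

/-- `V` lies in the strip of heights `0, …, w`, touching both boundary lines. -/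
structure IsStrip (V : Finset (ℤ × ℤ)) (w : ℕ) : Prop where
  pos : 0 < w
  ge : ∀ v ∈ V, 0 ≤ v.2
  le : ∀ v ∈ V, v.2 ≤ w
  bot : ∃ v ∈ V, v.2 = 0
  top : ∃ v ∈ V, v.2 = w

lemma hullZ_convex (V : Finset (ℤ × ℤ)) : Convex ℝ (hullZ V) := convex_convexHull _ _

lemma hullZ_compact (V : Finset (ℤ × ℤ)) : IsCompact (hullZ V) :=
  (V.finite_toSet.image _).isCompact_convexHull (𝕜 := ℝ)

lemma mem_hullZ {V : Finset (ℤ × ℤ)} {v : ℤ × ℤ} (h : v ∈ V) : toR2 v ∈ hullZ V :=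
  subset_convexHull _ _ ⟨v, h, rfl⟩

lemma hullZ_subset {V : Finset (ℤ × ℤ)} {C : Set (ℝ × ℝ)} (hC : Convex ℝ C)
    (h : ∀ v ∈ V, toR2 v ∈ C) : hullZ V ⊆ C :=
  convexHull_min (by rintro _ ⟨v, hv, rfl⟩; exact h v hv) hC

lemma convex_halfplane (a b c : ℝ) : Convex ℝ {p : ℝ × ℝ | a * p.1 + b * p.2 ≤ c} := by
  intro x hx y hy s t hs ht hst
  simp only [Set.mem_ofPred_eq, Prod.fst_add, Prod.snd_add, Prod.smul_fst, Prod.smul_snd,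
    smul_eq_mul] at *
  have h1 := mul_le_mul_of_nonneg_left hx hs
  have h2 := mul_le_mul_of_nonneg_left hy ht
  have : c = s * c + t * c := by rw [← add_mul, hst, one_mul]
  nlinarith

lemma hullZ_halfplane {V : Finset (ℤ × ℤ)} {a b c : ℝ}
    (h : ∀ v ∈ V, a * (v.1 : ℝ) + b * (v.2 : ℝ) ≤ c) {p : ℝ × ℝ} (hp : p ∈ hullZ V) :
    a * p.1 + b * p.2 ≤ c :=
  hullZ_subset (convex_halfplane a b c) (fun v hv => h v hv) hp

lemma IsStrip.nonneg {V : Finset (ℤ × ℤ)} {w : ℕ} (hV : IsStrip V w) {p : ℝ × ℝ}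
    (hp : p ∈ hullZ V) : 0 ≤ p.2 := by
  have := hullZ_halfplane (V := V) (a := 0) (b := -1) (c := 0) (fun v hv => by
    have : (0 : ℝ) ≤ v.2 := by exact_mod_cast hV.ge v hv
    linarith) hp
  linarith

lemma IsStrip.le_top {V : Finset (ℤ × ℤ)} {w : ℕ} (hV : IsStrip V w) {p : ℝ × ℝ}
    (hp : p ∈ hullZ V) : p.2 ≤ w := by
  have := hullZ_halfplane (V := V) (a := 0) (b := 1) (c := w) (fun v hv => by
    have : (v.2 : ℝ) ≤ w := by exact_mod_cast hV.le v hv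
    linarith) hp
  linarith

/-- The point at height `y` on the line through two points of a convex set. -/
lemma crossing_mem {C : Set (ℝ × ℝ)} (hC : Convex ℝ C) {a b : ℝ × ℝ} (ha : a ∈ C) (hb : b ∈ C)
    {y : ℝ} (h1 : a.2 ≤ y) (h2 : y ≤ b.2) (h : a.2 < b.2) :
    (((b.2 - y) * a.1 + (y - a.2) * b.1) / (b.2 - a.2), y) ∈ C := by
  have hd : 0 < b.2 - a.2 := by linarith
  have := hC ha hb (a := (b.2 - y) / (b.2 - a.2)) (b := (y - a.2) / (b.2 - a.2))
    (div_nonneg (by linarith) hd.le) (div_nonneg (by linarith) hd.le)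
    (by field_simp; ring)
  convert this using 1
  ext
  · simp; field_simp
  · simp; field_simp; ring

/-- The right end of the horizontal row at height `y`. -/
noncomputable def rowR (V : Finset (ℤ × ℤ)) (y : ℝ) : ℝ := sSup {x | (x, y) ∈ hullZ V}

/-- The left end of the horizontal row at height `y`. -/
noncomputable def rowL (V : Finset (ℤ × ℤ)) (y : ℝ) : ℝ := sInf {x | (x, y) ∈ hullZ V}

lemma row_compact (V : Finset (ℤ × ℤ)) (y : ℝ) : IsCompact {x | (x, y) ∈ hullZ V} := by
  have : {x | (x, y) ∈ hullZ V} = Prod.fst '' (hullZ V ∩ {p | p.2 = y}) := by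
    ext x; simp
  rw [this]
  exact ((hullZ_compact V).inter_right (isClosed_eq continuous_snd continuous_const)).image
    continuous_fst

lemma le_rowR {V : Finset (ℤ × ℤ)} {x y : ℝ} (h : (x, y) ∈ hullZ V) : x ≤ rowR V y :=
  le_csSup (row_compact V y).bddAbove h

lemma rowL_le {V : Finset (ℤ × ℤ)} {x y : ℝ} (h : (x, y) ∈ hullZ V) : rowL V y ≤ x :=
  csInf_le (row_compact V y).bddBelow h

lemma IsStrip.row_nonempty {V : Finset (ℤ × ℤ)} {w : ℕ} (hV : IsStrip V w) {y : ℝ} (h0 : 0 ≤ y)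
    (h1 : y ≤ w) : {x | (x, y) ∈ hullZ V}.Nonempty := by
  obtain ⟨a, ha, ha0⟩ := hV.bot
  obtain ⟨b, hb, hb0⟩ := hV.top
  have hw : (0 : ℝ) < w := by exact_mod_cast hV.pos
  exact ⟨_, crossing_mem (hullZ_convex V) (mem_hullZ ha) (mem_hullZ hb) (y := y)
    (by simp [toR2, ha0, h0]) (by simp [toR2, hb0, h1]) (by simp [toR2, ha0, hb0, hV.pos])⟩

lemma IsStrip.rowR_mem {V : Finset (ℤ × ℤ)} {w : ℕ} (hV : IsStrip V w) {y : ℝ} (h0 : 0 ≤ y)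
    (h1 : y ≤ w) : (rowR V y, y) ∈ hullZ V :=
  (row_compact V y).sSup_mem (hV.row_nonempty h0 h1)

lemma IsStrip.rowL_mem {V : Finset (ℤ × ℤ)} {w : ℕ} (hV : IsStrip V w) {y : ℝ} (h0 : 0 ≤ y)
    (h1 : y ≤ w) : (rowL V y, y) ∈ hullZ V :=
  (row_compact V y).sInf_mem (hV.row_nonempty h0 h1)

lemma IsStrip.rowL_le_rowR {V : Finset (ℤ × ℤ)} {w : ℕ} (hV : IsStrip V w) {y : ℝ} (h0 : 0 ≤ y)
    (h1 : y ≤ w) : rowL V y ≤ rowR V y := rowL_le (hV.rowR_mem h0 h1)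

lemma IsStrip.mem_iff {V : Finset (ℤ × ℤ)} {w : ℕ} (hV : IsStrip V w) {x y : ℝ} (h0 : 0 ≤ y)
    (h1 : y ≤ w) : (x, y) ∈ hullZ V ↔ rowL V y ≤ x ∧ x ≤ rowR V y := by
  refine ⟨fun h => ⟨rowL_le h, le_rowR h⟩, fun ⟨h2, h3⟩ => ?_⟩
  have hseg := (hullZ_convex V).segment_subset (hV.rowL_mem h0 h1) (hV.rowR_mem h0 h1)
  apply hseg
  rw [← Prod.image_mk_segment_left]
  exact ⟨x, by rw [segment_eq_Icc (h2.trans h3)]; exact ⟨h2, h3⟩, rfl⟩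

/-- A point of the hull at height at least `i` lies on a segment from a point of the hull at
height at most `i` to a point in the hull of the vertices strictly above `i`. -/
lemma IsStrip.split {V : Finset (ℤ × ℤ)} {w : ℕ} (hV : IsStrip V w) (i : ℤ) (hi0 : 0 ≤ i)
    (hiw : i < w) {p : ℝ × ℝ} (hp : p ∈ hullZ V) :
    ∃ a ∈ hullZ V, ∃ b ∈ hullZ (V.filter (fun v => i < v.2)),
      a.2 ≤ i ∧ (i + 1 : ℝ) ≤ b.2 ∧ p ∈ segment ℝ a b := by
  classical
  set A := V.filter (fun v => ¬ i < v.2)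
  set B := V.filter (fun v => i < v.2)
  have hAB : V = A ∪ B := by
    ext v; simp only [A, B, Finset.mem_union, Finset.mem_filter]; tauto
  have hA : (toR2 '' (A : Set (ℤ × ℤ))).Nonempty := by
    obtain ⟨a, ha, ha0⟩ := hV.bot
    exact ⟨_, a, by simp [A, ha]; omega, rfl⟩
  have hB : (toR2 '' (B : Set (ℤ × ℤ))).Nonempty := by
    obtain ⟨a, ha, ha0⟩ := hV.top
    exact ⟨_, a, by simp [B, ha]; omega, rfl⟩
  have hp' : p ∈ convexHull ℝ (toR2 '' (A : Set (ℤ × ℤ)) ∪ toR2 '' (B : Set (ℤ × ℤ))) := by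
    rw [← Set.image_union, ← Finset.coe_union, ← hAB]; exact hp
  rw [convexHull_union hA hB, mem_convexJoin] at hp'
  obtain ⟨a, ha, b, hb, hab⟩ := hp'
  refine ⟨a, convexHull_mono (Set.image_mono (Finset.coe_subset.2 (Finset.filter_subset _ _))) ha, b, hb, ?_, ?_, hab⟩
  · have := hullZ_halfplane (V := A) (a := 0) (b := 1) (c := i) (fun v hv => by
      have : v.2 ≤ i := not_lt.1 (Finset.mem_filter.1 hv).2
      have : (v.2 : ℝ) ≤ i := by exact_mod_cast this
      linarith) ha
    linarith
  · have := hullZ_halfplane (V := B) (a := 0) (b := -1) (c := -(i + 1)) (fun v hv => by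
      have : i + 1 ≤ v.2 := (Finset.mem_filter.1 hv).2
      have : (i + 1 : ℝ) ≤ v.2 := by exact_mod_cast this
      linarith) hb
    linarith

lemma segment_coords {a b p : ℝ × ℝ} (h : p ∈ segment ℝ a b) :
    ∃ t : ℝ, 0 ≤ t ∧ t ≤ 1 ∧ p.1 = (1 - t) * a.1 + t * b.1 ∧ p.2 = (1 - t) * a.2 + t * b.2 := by
  obtain ⟨s, t, hs, ht, hst, rfl⟩ := h
  refine ⟨t, ht, by linarith, ?_, ?_⟩ <;> simp [← hst]

/-- The hull is the union of the trapezoids between consecutive integer rows. -/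
lemma IsStrip.interp {V : Finset (ℤ × ℤ)} {w : ℕ} (hV : IsStrip V w) (i : ℤ) (hi0 : 0 ≤ i)
    (hiw : i < w) {x t : ℝ} (ht0 : 0 ≤ t) (ht1 : t ≤ 1) (hp : (x, (i : ℝ) + t) ∈ hullZ V) :
    x ≤ (1 - t) * rowR V i + t * rowR V (i + 1) ∧
      (1 - t) * rowL V i + t * rowL V (i + 1) ≤ x := by
  obtain ⟨a, ha, b, hb, ha2, hb2, hab⟩ := hV.split i hi0 hiw hp
  have hb' : b ∈ hullZ V := convexHull_mono (Set.image_mono (Finset.coe_subset.2 (Finset.filter_subset _ _))) hb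
  obtain ⟨s, hs0, hs1, h1, h2⟩ := segment_coords hab
  have hd : 0 < b.2 - a.2 := by linarith
  have c0 := crossing_mem (hullZ_convex V) ha hb' (y := i) ha2 (by linarith) (by linarith)
  have c1 := crossing_mem (hullZ_convex V) ha hb' (y := i + 1) (by linarith) (by linarith)
    (by linarith)
  have hx : x = (1 - t) * (((b.2 - i) * a.1 + (i - a.2) * b.1) / (b.2 - a.2)) +
      t * (((b.2 - (i + 1)) * a.1 + ((i : ℝ) + 1 - a.2) * b.1) / (b.2 - a.2)) := by
    have hs : s = (i + t - a.2) / (b.2 - a.2) := by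
      field_simp; simp only at h2; linarith
    simp only at h1
    rw [h1, hs]; field_simp; ring
  have r0 := le_rowR c0
  have r1 := le_rowR c1
  have l0 := rowL_le c0
  have l1 := rowL_le c1
  have ht' : 0 ≤ 1 - t := by linarith
  constructor
  · rw [hx]; gcongr
  · conv_rhs => rw [hx]
    gcongr

lemma IsStrip.exists_rowR_zero {V : Finset (ℤ × ℤ)} {w : ℕ} (hV : IsStrip V w) :
    ∃ v ∈ V, v.2 = 0 ∧ rowR V 0 = v.1 := by
  classical
  have hne : (V.filter (fun v => v.2 = 0)).Nonempty := by
    obtain ⟨v, hv, h⟩ := hV.bot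
    exact ⟨v, by simp [hv, h]⟩
  obtain ⟨v, hv, hmax⟩ := Finset.exists_max_image _ (fun v : ℤ × ℤ => v.1) hne
  rw [Finset.mem_filter] at hv
  refine ⟨v, hv.1, hv.2, le_antisymm ?_ ?_⟩
  · have hw : (0 : ℝ) ≤ w := by positivity
    have h := hullZ_halfplane (V := V) (a := 1) (b := -∑ u ∈ V, |(u.1 : ℝ) - v.1|) (c := v.1)
      (fun u hu => ?_) (hV.rowR_mem le_rfl hw)
    · simpa using h
    · have h0 := hV.ge u hu
      rcases h0.eq_or_lt with h0 | h0
      · have : (u.1 : ℝ) ≤ v.1 := by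
          exact_mod_cast hmax u (Finset.mem_filter.2 ⟨hu, h0.symm⟩)
        simp [← h0, this]
      · have h1 : (1 : ℝ) ≤ u.2 := by exact_mod_cast h0
        have h2 : |(u.1 : ℝ) - v.1| ≤ ∑ u ∈ V, |(u.1 : ℝ) - v.1| :=
          Finset.single_le_sum (f := fun u : ℤ × ℤ => |(u.1 : ℝ) - v.1|)
            (fun i _ => abs_nonneg _) hu
        have h3 := le_abs_self ((u.1 : ℝ) - v.1)
        have h4 := abs_nonneg ((u.1 : ℝ) - v.1)
        nlinarith
  · apply le_rowR
    have := mem_hullZ hv.1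
    simpa [toR2, hv.2] using this

/-- Starting from a row with integral right end, the right boundary follows an edge up to another
row with integral right end. -/
lemma IsStrip.exists_next {V : Finset (ℤ × ℤ)} {w : ℕ} (hV : IsStrip V w) (m r : ℤ) (h0 : 0 ≤ m)
    (hw : m < w) (hr : rowR V m = r) :
    ∃ v ∈ V, m < v.2 ∧ ∃ s : ℝ, ∀ i : ℤ, m ≤ i → i ≤ v.2 →
      rowR V i = r + s * (i - m) ∧ (r : ℝ) + s * (v.2 - m) = v.1 := by
  classical
  have hne : (V.filter (fun v => m < v.2)).Nonempty := by
    obtain ⟨v, hv, h⟩ := hV.top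
    exact ⟨v, by simp [hv, h, hw]⟩
  obtain ⟨v, hv, hmax⟩ := Finset.exists_max_image _
    (fun v : ℤ × ℤ => ((v.1 : ℝ) - r) / (v.2 - m)) hne
  rw [Finset.mem_filter] at hv
  have hvm : (0 : ℝ) < v.2 - m := by
    have : (m : ℝ) < v.2 := by exact_mod_cast hv.2
    linarith
  have hmw : (m : ℝ) ≤ w := by exact_mod_cast hw.le
  have hm0 : (0 : ℝ) ≤ m := by exact_mod_cast h0
  refine ⟨v, hv.1, hv.2, ((v.1 : ℝ) - r) / (v.2 - m), fun i hi hiv => ?_⟩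
  set s := ((v.1 : ℝ) - r) / (v.2 - m) with hs
  have hsv : (r : ℝ) + s * (v.2 - m) = v.1 := by rw [hs]; field_simp; ring
  refine ⟨?_, hsv⟩
  have him : (m : ℝ) ≤ i := by exact_mod_cast hi
  have hiv' : (i : ℝ) ≤ v.2 := by exact_mod_cast hiv
  have hvw : (v.2 : ℝ) ≤ w := by exact_mod_cast hV.le v hv.1
  have hi0 : (0 : ℝ) ≤ i := by linarith
  have hiw : (i : ℝ) ≤ w := by linarith
  apply le_antisymm
  · obtain ⟨a, ha, b, hb, ha2, hb2, hab⟩ := hV.split m h0 hw (hV.rowR_mem hi0 hiw)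
    have hb' : b ∈ hullZ V :=
      convexHull_mono (Set.image_mono (Finset.coe_subset.2 (Finset.filter_subset _ _))) hb
    have hbf := hullZ_halfplane (a := 1) (b := -s) (c := r - s * m) (fun u hu => by
      have h := hmax u hu
      have hum : (0 : ℝ) < u.2 - m := by
        have : (m : ℝ) < u.2 := by exact_mod_cast (Finset.mem_filter.1 hu).2
        linarith
      rw [div_le_iff₀ hum] at h
      linarith) hb
    have hc := le_rowR (crossing_mem (hullZ_convex V) ha hb' (y := m) ha2 (by linarith)
      (by linarith))
    rw [hr] at hc
    have hd : 0 < b.2 - a.2 := by linarith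
    rw [div_le_iff₀ hd] at hc
    obtain ⟨t, ht0, ht1, h1, h2⟩ := segment_coords hab
    simp only at h1 h2
    -- the height of the point is `i = a.2 + t * (b.2 - a.2)`
    have h3 : (i - a.2) = t * (b.2 - a.2) := by rw [h2]; ring
    have key : (b.2 - a.2) * (rowR V i - (r + s * (i - m))) ≤ 0 := by
      have e1 : (b.2 - a.2) * rowR V i = (b.2 - i) * a.1 + (i - a.2) * b.1 := by
        rw [h1]
        have : (b.2 - i) = (1 - t) * (b.2 - a.2) := by linear_combination -h3
        rw [this, h3]; ring
      have hbi : (b.2 - i) = (1 - t) * (b.2 - a.2) := by linear_combination -h3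
      have hbi0 : 0 ≤ b.2 - i := by rw [hbi]; exact mul_nonneg (by linarith) hd.le
      -- multiply by `b.2 - m > 0`
      have hbm : 0 < b.2 - m := by linarith
      have e2 : (b.2 - m) * ((b.2 - a.2) * (rowR V i - (r + s * (i - m)))) =
          (b.2 - i) * ((b.2 - m) * a.1 + (m - a.2) * b.1 - r * (b.2 - a.2)) +
          (i - m) * (b.2 - a.2) * (b.1 - s * b.2 - (r - s * m)) := by
        rw [mul_sub, e1]; ring
      have e3 : (b.2 - m) * ((b.2 - a.2) * (rowR V i - (r + s * (i - m)))) ≤ 0 := by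
        rw [e2]
        have t1 : (b.2 - i) * ((b.2 - m) * a.1 + (m - a.2) * b.1 - r * (b.2 - a.2)) ≤ 0 :=
          mul_nonpos_of_nonneg_of_nonpos hbi0 (by linarith)
        have t2 : (i - m) * (b.2 - a.2) * (b.1 - s * b.2 - (r - s * m)) ≤ 0 :=
          mul_nonpos_of_nonneg_of_nonpos (mul_nonneg (by linarith) hd.le) (by linarith)
        linarith
      by_contra hcon
      push Not at hcon
      have := mul_pos hbm hcon
      linarith
    by_contra hcon
    push Not at hcon
    have := mul_pos hd (sub_pos.2 hcon)
    linarith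
  · have hc := le_rowR (crossing_mem (hullZ_convex V) (hV.rowR_mem hm0 hmw) (mem_hullZ hv.1)
      (y := i) him hiv' (by simp only [toR2]; linarith))
    refine le_trans (le_of_eq ?_) hc
    rw [hr]
    simp only [toR2]
    rw [← hsv]
    field_simp
    ring

/-- The defect of a real number from being the mean of its integer neighbours. -/
noncomputable def rdefect (x : ℝ) : ℝ := ⌊x⌋ + ⌈x⌉ - 2 * x

lemma rdefect_int (n : ℤ) : rdefect n = 0 := by simp [rdefect]; ring

lemma rdefect_sub (n : ℤ) (x : ℝ) : rdefect (n - x) = -rdefect x := by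
  simp only [rdefect]
  have h1 : ⌊(n : ℝ) - x⌋ = n - ⌈x⌉ := by
    rw [sub_eq_add_neg, Int.floor_intCast_add, Int.floor_neg]; ring
  have h2 : ⌈(n : ℝ) - x⌉ = n - ⌊x⌋ := by
    rw [sub_eq_add_neg, Int.ceil_intCast_add, Int.ceil_neg]; ring
  rw [h1, h2]; push_cast; ring

lemma sum_rdefect_linear (m m' r r' : ℤ) (R : ℤ → ℝ)
    (h : ∀ i, m ≤ i → i ≤ m' → R i + R (m + m' - i) = r + r') :
    ∑ i ∈ Finset.Ioo m m', rdefect (R i) = 0 := by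
  have h1 : ∑ i ∈ Finset.Ioo m m', rdefect (R i) =
      ∑ i ∈ Finset.Ioo m m', rdefect (R (m + m' - i)) := by
    refine Finset.sum_nbij' (fun i => m + m' - i) (fun i => m + m' - i) ?_ ?_ ?_ ?_ ?_
    · intro i hi; simp only [Finset.mem_Ioo] at *; omega
    · intro i hi; simp only [Finset.mem_Ioo] at *; omega
    · intro i _; ring
    · intro i _; ring
    · intro i _; congr 2; ring
  have h2 : ∑ i ∈ Finset.Ioo m m', rdefect (R (m + m' - i)) =
      ∑ i ∈ Finset.Ioo m m', -rdefect (R i) := by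
    refine Finset.sum_congr rfl fun i hi => ?_
    rw [Finset.mem_Ioo] at hi
    rw [← rdefect_sub (r + r')]
    congr 1
    have := h i hi.1.le hi.2.le
    push_cast; linarith
  rw [Finset.sum_neg_distrib] at h2
  linarith

lemma IsStrip.sum_rdefect_aux {V : Finset (ℤ × ℤ)} {w : ℕ} (hV : IsStrip V w) (k : ℕ) :
    ∀ m r : ℤ, 0 ≤ m → m ≤ w → w - m ≤ k → rowR V m = r →
      ∑ i ∈ Finset.Icc m w, rdefect (rowR V i) = 0 ∧ ∃ n : ℤ, rowR V w = n := by
  induction k with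
  | zero =>
    intro m r h0 hw hk hr
    have : m = w := by push_cast at hk; omega
    subst this
    rw [Finset.Icc_self, Finset.sum_singleton, hr, rdefect_int]
    exact ⟨rfl, r, by simpa using hr⟩
  | succ k ih =>
    intro m r h0 hw hk hr
    rcases hw.eq_or_lt with hw' | hw'
    · subst hw'
      rw [Finset.Icc_self, Finset.sum_singleton, hr, rdefect_int]
      exact ⟨rfl, r, by simpa using hr⟩
    obtain ⟨v, hv, hmv, s, hs⟩ := hV.exists_next m r h0 hw' hr
    have hvw := hV.le v hv
    have hv1 : rowR V v.2 = v.1 := by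
      obtain ⟨a, b⟩ := hs v.2 hmv.le le_rfl
      rw [a, b]
    obtain ⟨h1, hn⟩ := ih v.2 v.1 (by omega) hvw (by push_cast at hk ⊢; omega) hv1
    have h2 : Finset.Icc m (w : ℤ) = insert m (Finset.Ioo m v.2 ∪ Finset.Icc v.2 w) := by
      ext i; simp only [Finset.mem_insert, Finset.mem_union, Finset.mem_Icc, Finset.mem_Ioo]; omega
    refine ⟨?_, hn⟩
    rw [h2, Finset.sum_insert, Finset.sum_union, h1, hr, rdefect_int]
    · rw [sum_rdefect_linear m v.2 r v.1]
      · simp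
      · intro i hi1 hi2
        obtain ⟨a, b⟩ := hs i hi1 hi2
        obtain ⟨c, _⟩ := hs (m + v.2 - i) (by omega) (by omega)
        rw [a, c, ← b]
        push_cast
        ring
    · rw [Finset.disjoint_left]; intro i; simp only [Finset.mem_Icc, Finset.mem_Ioo]; omega
    · simp only [Finset.mem_union, Finset.mem_Icc, Finset.mem_Ioo]; omega

lemma IsStrip.sum_rdefect {V : Finset (ℤ × ℤ)} {w : ℕ} (hV : IsStrip V w) :
    ∑ i ∈ Finset.Icc (0 : ℤ) w, rdefect (rowR V i) = 0 := by
  obtain ⟨v, hv, h0, h⟩ := hV.exists_rowR_zero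
  exact (hV.sum_rdefect_aux w 0 v.1 le_rfl (by omega) (by omega) (by simpa using h)).1

lemma IsStrip.rowR_top_int {V : Finset (ℤ × ℤ)} {w : ℕ} (hV : IsStrip V w) :
    ∃ n : ℤ, rowR V w = n := by
  obtain ⟨v, hv, h0, h⟩ := hV.exists_rowR_zero
  exact (hV.sum_rdefect_aux w 0 v.1 le_rfl (by omega) (by omega) (by simpa using h)).2

/-- Reflection of a set of lattice points in the vertical axis. -/
def reflectZ (V : Finset (ℤ × ℤ)) : Finset (ℤ × ℤ) := V.image (fun v => (-v.1, v.2))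

lemma mem_hullZ_reflect {V : Finset (ℤ × ℤ)} {x y : ℝ} (h : (x, y) ∈ hullZ V) :
    (-x, y) ∈ hullZ (reflectZ V) := by
  have : hullZ V ⊆ {p | (-p.1, p.2) ∈ hullZ (reflectZ V)} := by
    refine hullZ_subset ?_ ?_
    · intro p hp q hq s t hs ht hst
      have := hullZ_convex (reflectZ V) hp hq hs ht hst
      have e : s • (-p.1, p.2) + t • (-q.1, q.2) = (-(s • p + t • q).1, (s • p + t • q).2) := by
        ext <;> simp; ring
      rw [e] at this
      exact this
    · intro v hv
      have : toR2 (-v.1, v.2) ∈ hullZ (reflectZ V) :=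
        mem_hullZ (Finset.mem_image.2 ⟨v, hv, rfl⟩)
      simpa [toR2] using this
  exact this h

lemma reflectZ_reflectZ (V : Finset (ℤ × ℤ)) : reflectZ (reflectZ V) = V := by
  simp [reflectZ, Finset.image_image, Function.comp_def]

lemma IsStrip.reflect {V : Finset (ℤ × ℤ)} {w : ℕ} (hV : IsStrip V w) :
    IsStrip (reflectZ V) w where
  pos := hV.pos
  ge := by
    intro v hv
    obtain ⟨u, hu, rfl⟩ := Finset.mem_image.1 hv
    exact hV.ge u hu
  le := by
    intro v hv
    obtain ⟨u, hu, rfl⟩ := Finset.mem_image.1 hv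
    exact hV.le u hu
  bot := by
    obtain ⟨u, hu, h⟩ := hV.bot
    exact ⟨_, Finset.mem_image.2 ⟨u, hu, rfl⟩, h⟩
  top := by
    obtain ⟨u, hu, h⟩ := hV.top
    exact ⟨_, Finset.mem_image.2 ⟨u, hu, rfl⟩, h⟩

lemma rowR_reflect (V : Finset (ℤ × ℤ)) (y : ℝ) : rowR (reflectZ V) y = -rowL V y := by
  rw [rowR, rowL, Real.sInf_def, neg_neg]
  congr 1
  ext x
  constructor
  · intro h
    have := mem_hullZ_reflect h
    rw [reflectZ_reflectZ] at this
    exact this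
  · intro h
    have := mem_hullZ_reflect (x := -x) h
    rwa [neg_neg] at this

lemma IsStrip.sum_rdefect_left {V : Finset (ℤ × ℤ)} {w : ℕ} (hV : IsStrip V w) :
    ∑ i ∈ Finset.Icc (0 : ℤ) w, rdefect (rowL V i) = 0 := by
  have h := hV.reflect.sum_rdefect
  simp only [rowR_reflect] at h
  have h2 : ∀ x : ℝ, rdefect (-x) = -rdefect x := fun x => by simpa using rdefect_sub 0 x
  simp only [h2, Finset.sum_neg_distrib] at h
  linarith

lemma IsStrip.rowL_zero_int {V : Finset (ℤ × ℤ)} {w : ℕ} (hV : IsStrip V w) :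
    ∃ n : ℤ, rowL V 0 = n := by
  obtain ⟨v, hv, h0, h⟩ := hV.reflect.exists_rowR_zero
  rw [rowR_reflect] at h
  exact ⟨-v.1, by push_cast; linarith⟩

lemma IsStrip.rowL_top_int {V : Finset (ℤ × ℤ)} {w : ℕ} (hV : IsStrip V w) :
    ∃ n : ℤ, rowL V w = n := by
  obtain ⟨n, h⟩ := hV.reflect.rowR_top_int
  rw [rowR_reflect] at h
  exact ⟨-n, by push_cast; linarith⟩

/-- The lattice points of `j • hull + [0, k] × {0}`, row by row. -/
noncomputable def stripS (V : Finset (ℤ × ℤ)) (w j k : ℕ) : Finset (ℤ × ℤ) :=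
  (Finset.Icc (0 : ℤ) (j * w)).biUnion fun m =>
    (Finset.Icc ⌈(j : ℝ) * rowL V (m / j)⌉ (⌊(j : ℝ) * rowR V (m / j)⌋ + k)).image fun x => (x, m)

lemma mem_stripS {V : Finset (ℤ × ℤ)} {w j k : ℕ} {v : ℤ × ℤ} :
    v ∈ stripS V w j k ↔ 0 ≤ v.2 ∧ v.2 ≤ j * w ∧ (j : ℝ) * rowL V (v.2 / j) ≤ v.1 ∧
      (v.1 : ℝ) ≤ (j : ℝ) * rowR V (v.2 / j) + k := by
  simp only [stripS, Finset.mem_biUnion, Finset.mem_Icc, Finset.mem_image, Int.ceil_le]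
  constructor
  · rintro ⟨m, hm, x, hx, rfl⟩
    refine ⟨hm.1, hm.2, hx.1, ?_⟩
    have h1 : x - k ≤ ⌊(j : ℝ) * rowR V (m / j)⌋ := by linarith [hx.2]
    rw [Int.le_floor] at h1
    push_cast at h1
    simp only
    linarith
  · rintro ⟨h1, h2, h3, h4⟩
    refine ⟨v.2, ⟨h1, h2⟩, v.1, ⟨h3, ?_⟩, rfl⟩
    have : v.1 - k ≤ ⌊(j : ℝ) * rowR V (v.2 / j)⌋ := by
      rw [Int.le_floor]; push_cast; linarith
    linarith

lemma IsStrip.height_div {w j : ℕ} {m : ℤ} (h0 : 0 ≤ m) (h1 : m ≤ j * w) :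
    (0 : ℝ) ≤ (m : ℝ) / j ∧ (m : ℝ) / j ≤ w := by
  have h0' : (0 : ℝ) ≤ m := by exact_mod_cast h0
  have h1' : (m : ℝ) ≤ j * w := by exact_mod_cast h1
  refine ⟨by positivity, ?_⟩
  rcases Nat.eq_zero_or_pos j with rfl | hj
  · simp
  · have : (0 : ℝ) < j := by exact_mod_cast hj
    rw [div_le_iff₀ this]; linarith

lemma IsStrip.card_stripS {V : Finset (ℤ × ℤ)} {w : ℕ} (hV : IsStrip V w) (j k : ℕ) :
    ((stripS V w j k).card : ℤ) = ∑ m ∈ Finset.Icc (0 : ℤ) (j * w),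
      (⌊(j : ℝ) * rowR V (m / j)⌋ + 1 - ⌈(j : ℝ) * rowL V (m / j)⌉ + k) := by
  rw [stripS, Finset.card_biUnion]
  · push_cast
    refine Finset.sum_congr rfl fun m hm => ?_
    rw [Finset.mem_Icc] at hm
    obtain ⟨h0, h1⟩ := IsStrip.height_div hm.1 hm.2
    rw [Finset.card_image_of_injective _ (fun a b h => (Prod.mk.inj h).1), Int.card_Icc]
    have hLR := hV.rowL_le_rowR h0 h1
    have : ⌈(j : ℝ) * rowL V (m / j)⌉ ≤ ⌊(j : ℝ) * rowR V (m / j)⌋ + 1 := by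
      rw [Int.ceil_le]; push_cast
      have := Int.lt_floor_add_one ((j : ℝ) * rowR V (m / j))
      have : (j : ℝ) * rowL V (m / j) ≤ (j : ℝ) * rowR V (m / j) := by gcongr
      linarith
    rw [Int.toNat_of_nonneg (by linarith)]
    ring
  · intro a _ b _ hab
    rw [Function.onFun, Finset.disjoint_left]
    simp only [Finset.mem_image, not_exists, not_and]
    rintro _ ⟨x, _, rfl⟩ y _ h
    exact hab (Prod.mk.inj h).2.symm

lemma IsStrip.card_stripS_add {V : Finset (ℤ × ℤ)} {w : ℕ} (hV : IsStrip V w) (j k : ℕ) :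
    (stripS V w j k).card = (stripS V w j 0).card + k * (j * w + 1) := by
  zify
  rw [hV.card_stripS, hV.card_stripS]
  simp only [Finset.sum_add_distrib, Finset.sum_const, Int.card_Icc]
  have : (((j : ℤ) * w + 1 - 0).toNat : ℤ) = j * w + 1 := by
    have h0 : (0 : ℤ) ≤ j * w := by positivity
    rw [Int.toNat_of_nonneg (by omega)]; ring
  simp only [nsmul_eq_mul, this]
  push_cast; ring

lemma IsStrip.stripS_one {V : Finset (ℤ × ℤ)} {w : ℕ} (hV : IsStrip V w) :
    latticePts (hullZ V) = (stripS V w 1 0 : Set (ℤ × ℤ)) := by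
  ext v
  rw [Finset.mem_coe, mem_stripS]
  simp only [latticePts, Set.mem_ofPred_eq, toR2, Nat.cast_one, one_mul, div_one, CharP.cast_eq_zero,
    add_zero]
  constructor
  · intro h
    have h1 := hV.nonneg h
    have h2 := hV.le_top h
    simp only at h1 h2
    exact ⟨by exact_mod_cast h1, by exact_mod_cast h2, (hV.mem_iff h1 h2).1 h⟩
  · rintro ⟨h1, h2, h3⟩
    exact (hV.mem_iff (by exact_mod_cast h1) (by exact_mod_cast h2)).2 h3

lemma IsStrip.add_mem_stripS {V : Finset (ℤ × ℤ)} {w : ℕ} (hV : IsStrip V w) {j k j' k' : ℕ}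
    {u v : ℤ × ℤ} (hu : u ∈ stripS V w j k) (hv : v ∈ stripS V w j' k') :
    u + v ∈ stripS V w (j + j') (k + k') := by
  rw [mem_stripS] at *
  obtain ⟨u0, u1, u2, u3⟩ := hu
  obtain ⟨v0, v1, v2, v3⟩ := hv
  rcases Nat.eq_zero_or_pos j with rfl | hj
  · have : u.2 = 0 := le_antisymm (by simpa using u1) u0
    simp only [Prod.snd_add, this, zero_add, Prod.fst_add]
    simp only [CharP.cast_eq_zero, zero_mul, zero_add] at u2 u3
    push_cast
    refine ⟨v0, by simpa using v1, by linarith, by linarith⟩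
  rcases Nat.eq_zero_or_pos j' with rfl | hj'
  · have : v.2 = 0 := le_antisymm (by simpa using v1) v0
    simp only [Prod.snd_add, this, add_zero, Prod.fst_add]
    simp only [CharP.cast_eq_zero, zero_mul, zero_add] at v2 v3
    push_cast
    refine ⟨u0, by simpa using u1, by linarith, by linarith⟩
  obtain ⟨hu0, hu1⟩ := IsStrip.height_div u0 u1
  obtain ⟨hv0, hv1⟩ := IsStrip.height_div v0 v1
  have hj0 : (0 : ℝ) < j := by exact_mod_cast hj
  have hj0' : (0 : ℝ) < j' := by exact_mod_cast hj'
  have key : ∀ x y : ℝ, (x, (u.2 : ℝ) / j) ∈ hullZ V → (y, (v.2 : ℝ) / j') ∈ hullZ V →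
      ((j * x + j' * y) / (j + j'), ((u.2 + v.2 : ℤ) : ℝ) / ((j + j' : ℕ) : ℝ)) ∈ hullZ V := by
    intro x y hx hy
    have := hullZ_convex V hx hy (a := j / (j + j')) (b := j' / (j + j')) (by positivity)
      (by positivity) (by field_simp)
    convert this using 1
    ext
    · simp; field_simp
    · simp; field_simp
  refine ⟨add_nonneg u0 v0, ?_, ?_, ?_⟩
  · simp only [Prod.snd_add]; push_cast; nlinarith
  · have := rowL_le (key _ _ (hV.rowL_mem hu0 hu1) (hV.rowL_mem hv0 hv1))
    rw [le_div_iff₀ (by positivity)] at this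
    simp only [Prod.snd_add, Prod.fst_add]
    push_cast at *
    nlinarith
  · have := le_rowR (key _ _ (hV.rowR_mem hu0 hu1) (hV.rowR_mem hv0 hv1))
    rw [div_le_iff₀ (by positivity)] at this
    simp only [Prod.snd_add, Prod.fst_add]
    push_cast at *
    nlinarith

lemma mem_interior_of_quadrilateral {C : Set (ℝ × ℝ)} (hC : Convex ℝ C) {a b : ℝ × ℝ}
    (ha : a ∈ C) (hb : b ∈ C) {l r x m : ℝ} (hl : (l, m) ∈ C) (hr : (r, m) ∈ C)
    (ham : a.2 < m) (hmb : m < b.2) (hlx : l < x) (hxr : x < r) : (x, m) ∈ interior C := by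
  rw [mem_interior]
  refine ⟨{p | (a.2 < p.2 ∧ p.2 < b.2) ∧
    ((b.2 - p.2) * l + (p.2 - m) * b.1 < p.1 * (b.2 - m) ∧
      p.1 * (b.2 - m) < (b.2 - p.2) * r + (p.2 - m) * b.1) ∧
    ((p.2 - a.2) * l + (m - p.2) * a.1 < p.1 * (m - a.2) ∧
      p.1 * (m - a.2) < (p.2 - a.2) * r + (m - p.2) * a.1)}, ?_, ?_, ?_⟩
  · rintro ⟨p1, p2⟩ ⟨⟨h1, h2⟩, ⟨h3, h4⟩, h5, h6⟩
    simp only at *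
    have seg : ∀ s t : ℝ, s ≤ p1 → p1 ≤ t → (s, p2) ∈ C → (t, p2) ∈ C → (p1, p2) ∈ C := by
      intro s t hs ht hsC htC
      apply hC.segment_subset hsC htC
      rw [← Prod.image_mk_segment_left]
      exact ⟨p1, by rw [segment_eq_Icc (hs.trans ht)]; exact ⟨hs, ht⟩, rfl⟩
    rcases le_total m p2 with h | h
    · refine seg _ _ ?_ ?_ (crossing_mem hC hl hb (y := p2) h h2.le hmb)
        (crossing_mem hC hr hb (y := p2) h h2.le hmb)
      · rw [div_le_iff₀ (by simp only; linarith)]; exact h3.le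
      · rw [le_div_iff₀ (by simp only; linarith)]; exact h4.le
    · refine seg _ _ ?_ ?_ (crossing_mem hC ha hl (y := p2) h1.le h ham)
        (crossing_mem hC ha hr (y := p2) h1.le h ham)
      · rw [div_le_iff₀ (by simp only; linarith)]; simp only; linarith
      · rw [le_div_iff₀ (by simp only; linarith)]; simp only; linarith
  · simp only [Set.ofPred_and]
    refine IsOpen.inter (IsOpen.inter ?_ ?_) (IsOpen.inter (IsOpen.inter ?_ ?_)
      (IsOpen.inter ?_ ?_))
    all_goals exact isOpen_lt (by fun_prop) (by fun_prop)
  · have h1 : 0 < b.2 - m := by linarith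
    have h2 : 0 < m - a.2 := by linarith
    refine ⟨⟨ham, hmb⟩, ⟨?_, ?_⟩, ?_, ?_⟩ <;> simp only [sub_self, zero_mul, add_zero] <;> nlinarith

/-- Twice this number is the normalised area. -/
noncomputable def stripT (V : Finset (ℤ × ℤ)) (w : ℕ) : ℝ :=
  ∑ m ∈ Finset.Icc (0 : ℤ) w, (rowR V m - rowL V m) -
    ((rowR V 0 - rowL V 0) + (rowR V w - rowL V w)) / 2

lemma IsStrip.latticePts_finite {V : Finset (ℤ × ℤ)} {w : ℕ} (hV : IsStrip V w) :
    (latticePts (hullZ V)).Finite := by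
  rw [hV.stripS_one]; exact Finset.finite_toSet _

lemma IsStrip.numPts_eq {V : Finset (ℤ × ℤ)} {w : ℕ} (hV : IsStrip V w) :
    (numPts (hullZ V) : ℤ) = ∑ m ∈ Finset.Icc (0 : ℤ) w, (⌊rowR V m⌋ + 1 - ⌈rowL V m⌉) := by
  rw [numPts, hV.stripS_one, Set.ncard_coe_finset, hV.card_stripS]
  simp

lemma IsStrip.intPts_ge {V : Finset (ℤ × ℤ)} {w : ℕ} (hV : IsStrip V w) :
    ∑ m ∈ Finset.Ioo (0 : ℤ) w, (⌈rowR V m⌉ - ⌊rowL V m⌋ - 1) ≤ (intPts (hullZ V) : ℤ) := by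
  classical
  set G : Finset (ℤ × ℤ) := (Finset.Ioo (0 : ℤ) w).biUnion fun m =>
    (Finset.Ioo ⌊rowL V m⌋ ⌈rowR V m⌉).image fun x => (x, m) with hG
  have hcard : (G.card : ℤ) = ∑ m ∈ Finset.Ioo (0 : ℤ) w,
      ((Finset.Ioo ⌊rowL V m⌋ ⌈rowR V m⌉).card : ℤ) := by
    rw [hG, Finset.card_biUnion]
    · push_cast
      refine Finset.sum_congr rfl fun m hm => ?_
      rw [Finset.card_image_of_injective _ (fun a b h => (Prod.mk.inj h).1)]
    · intro a _ b _ hab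
      rw [Function.onFun, Finset.disjoint_left]
      simp only [Finset.mem_image, not_exists, not_and]
      rintro _ ⟨x, _, rfl⟩ y _ h
      exact hab (Prod.mk.inj h).2.symm
  have hsub : (G : Set (ℤ × ℤ)) ⊆ latticePts (interior (hullZ V)) := by
    intro v hv
    simp only [hG, Finset.mem_coe, Finset.mem_biUnion, Finset.mem_Ioo, Finset.mem_image] at hv
    obtain ⟨m, ⟨hm0, hmw⟩, x, ⟨hx0, hx1⟩, rfl⟩ := hv
    have hm0' : (0 : ℝ) < m := by exact_mod_cast hm0
    have hmw' : (m : ℝ) < w := by exact_mod_cast hmw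
    obtain ⟨a, ha, ha0⟩ := hV.bot
    obtain ⟨b, hb, hb0⟩ := hV.top
    exact mem_interior_of_quadrilateral (hullZ_convex V) (mem_hullZ ha) (mem_hullZ hb)
      (hV.rowL_mem hm0'.le hmw'.le) (hV.rowR_mem hm0'.le hmw'.le)
      (by simp [toR2, ha0, hm0]) (by simpa [toR2, hb0] using hmw')
      (Int.floor_lt.1 hx0) (Int.lt_ceil.1 hx1)
  have h1 : G.card ≤ intPts (hullZ V) := by
    rw [← Set.ncard_coe_finset]
    exact Set.ncard_le_ncard hsub (hV.latticePts_finite.subset fun v (hv : toR2 v ∈ _) =>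
      show toR2 v ∈ _ from interior_subset hv)
  have h2 : (G.card : ℤ) ≤ intPts (hullZ V) := by exact_mod_cast h1
  refine le_trans ?_ h2
  rw [hcard]
  refine Finset.sum_le_sum fun m _ => ?_
  rw [Int.card_Ioo]
  exact Int.self_le_toNat _

lemma sum_Icc_eq_Ioo {M : Type*} [AddCommMonoid M] (w : ℕ) (hw : 0 < w) (g : ℤ → M) :
    ∑ m ∈ Finset.Icc (0 : ℤ) w, g m = g 0 + g w + ∑ m ∈ Finset.Ioo (0 : ℤ) w, g m := by
  have : Finset.Icc (0 : ℤ) w = insert 0 (insert (w : ℤ) (Finset.Ioo (0 : ℤ) w)) := by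
    ext i; simp only [Finset.mem_insert, Finset.mem_Icc, Finset.mem_Ioo]; omega
  rw [this, Finset.sum_insert, Finset.sum_insert, add_assoc]
  · simp
  · simp; omega

lemma IsStrip.pick {V : Finset (ℤ × ℤ)} {w : ℕ} (hV : IsStrip V w) :
    2 * stripT V w + 2 ≤ (numPts (hullZ V) : ℝ) + intPts (hullZ V) := by
  have h1 : (numPts (hullZ V) : ℝ) =
      ∑ m ∈ Finset.Icc (0 : ℤ) w, ((⌊rowR V m⌋ : ℝ) + 1 - ⌈rowL V m⌉) := by
    exact_mod_cast hV.numPts_eq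
  have h2 : ∑ m ∈ Finset.Ioo (0 : ℤ) w, ((⌈rowR V m⌉ : ℝ) - ⌊rowL V m⌋ - 1) ≤
      intPts (hullZ V) := by exact_mod_cast hV.intPts_ge
  have h3 := hV.sum_rdefect
  have h4 := hV.sum_rdefect_left
  -- ends are integral
  obtain ⟨v, _, _, e1⟩ := hV.exists_rowR_zero
  obtain ⟨n2, e2⟩ := hV.rowR_top_int
  obtain ⟨n3, e3⟩ := hV.rowL_zero_int
  obtain ⟨n4, e4⟩ := hV.rowL_top_int
  rw [sum_Icc_eq_Ioo w hV.pos] at h1 h3 h4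
  rw [stripT, sum_Icc_eq_Ioo w hV.pos]
  simp only [rdefect, Finset.sum_add_distrib, Finset.sum_sub_distrib, ← Finset.mul_sum,
    Int.cast_zero, Int.cast_natCast, e1, e2, e3, e4, Int.floor_intCast, Int.ceil_intCast] at *
  linarith

/-- Quadratic growth of the number of lattice points of the dilates. -/
lemma IsStrip.card_stripS_le {V : Finset (ℤ × ℤ)} {w : ℕ} (hV : IsStrip V w) :
    ∃ C : ℝ, 0 ≤ C ∧ ∀ N : ℕ, 0 < N →
      ((stripS V w N 0).card : ℝ) ≤ stripT V w * N ^ 2 + C * N + C := by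
  set ρ : ℤ → ℝ := fun i => rowR V i - rowL V i with hρ
  have hρ0 : ∀ i ∈ Finset.Icc (0 : ℤ) w, 0 ≤ ρ i := by
    intro i hi
    rw [Finset.mem_Icc] at hi
    have := hV.rowL_le_rowR (y := i) (by exact_mod_cast hi.1) (by exact_mod_cast hi.2)
    simp only [hρ]; linarith
  have hnat : ∀ i : ℕ, i ≤ w → 0 ≤ ρ i := fun i hi =>
    hρ0 i (Finset.mem_Icc.2 ⟨by omega, by exact_mod_cast hi⟩)
  have hint : ∀ (n : ℕ) (g : ℤ → ℝ), ∑ m ∈ Finset.Icc (0 : ℤ) n, g m =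
      ∑ m ∈ Finset.range (n + 1), g m := by
    intro n g
    refine (Finset.sum_nbij' (fun m : ℕ => (m : ℤ)) (fun m : ℤ => m.toNat) ?_ ?_ ?_ ?_ ?_).symm
    · intro a ha; simp only [Finset.mem_range, Finset.mem_Icc] at *; omega
    · intro a ha; simp only [Finset.mem_range, Finset.mem_Icc] at *; omega
    · intro a _; simp
    · intro a ha; simp only [Finset.mem_Icc] at ha; simp [ha.1]
    · intro a _; rfl
  set C : ℝ := ∑ i ∈ Finset.range (w + 1), ρ i + w + 1 with hC
  have hC0 : 0 ≤ ∑ i ∈ Finset.range (w + 1), ρ i :=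
    Finset.sum_nonneg fun i hi => hnat i (by simpa [Nat.lt_succ_iff] using hi)
  refine ⟨C, by positivity, fun N hN => ?_⟩
  have hN0 : (0 : ℝ) < N := by exact_mod_cast hN
  -- one row
  have hrow : ∀ i t : ℕ, i < w → t ≤ N →
      (N : ℝ) * rowR V (((N * i + t : ℕ) : ℝ) / N) - N * rowL V (((N * i + t : ℕ) : ℝ) / N) ≤
        (N - t) * ρ i + t * ρ (i + 1) := by
    intro i t hi ht
    have hy : (((N * i + t : ℕ) : ℝ) / N) = ((i : ℤ) : ℝ) + t / N := by
      push_cast; field_simp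
    have ht1 : (t : ℝ) / N ≤ 1 := by rw [div_le_one hN0]; exact_mod_cast ht
    have ht0 : (0 : ℝ) ≤ t / N := by positivity
    have hiw : ((i : ℤ) : ℝ) + 1 ≤ w := by exact_mod_cast hi
    have hi0 : (0 : ℝ) ≤ ((i : ℤ) : ℝ) := by positivity
    rw [hy]
    have a1 := (hV.interp i (by omega) (by exact_mod_cast hi) ht0 ht1
      (hV.rowR_mem (by linarith) (by linarith))).1
    have a2 := (hV.interp i (by omega) (by exact_mod_cast hi) ht0 ht1
      (hV.rowL_mem (by linarith) (by linarith))).2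
    have e : (N - t : ℝ) * ρ i + t * ρ (i + 1) = N * ((1 - t / N) * rowR V (i : ℤ) +
      t / N * rowR V ((i : ℤ) + 1) - ((1 - t / N) * rowL V (i : ℤ) +
      t / N * rowL V ((i : ℤ) + 1))) := by
      simp only [hρ]; push_cast; field_simp; ring
    rw [e, ← mul_sub]
    gcongr
  set b : ℕ → ℝ := fun m => (N : ℝ) * rowR V ((m : ℝ) / N) - N * rowL V ((m : ℝ) / N) + 1 with hb
  have hblock : ∀ i : ℕ, i ≤ w → ∑ m ∈ Finset.range (N * i), b m ≤
      ∑ i' ∈ Finset.range i, (ρ i' * (N * (N + 1) / 2) + ρ (i' + 1) * (N * (N - 1) / 2) + N) := by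
    intro i
    induction i with
    | zero => simp
    | succ i ih =>
      intro hi
      rw [Nat.mul_succ, Finset.sum_range_add, Finset.sum_range_succ]
      refine add_le_add (ih (by omega)) ?_
      have h1 : ∑ t ∈ Finset.range N, b (N * i + t) ≤
          ∑ t ∈ Finset.range N, ((N - t : ℝ) * ρ i + t * ρ (i + 1) + 1) :=
        Finset.sum_le_sum fun t ht => by
          have := hrow i t (by omega) (Finset.mem_range.1 ht).le
          simp only [hb]; linarith
      refine h1.trans (le_of_eq ?_)
      have h2 : ∑ t ∈ Finset.range N, (t : ℝ) = N * (N - 1) / 2 := by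
        have := Finset.sum_range_id_mul_two N
        have h3 : (∑ t ∈ Finset.range N, (t : ℝ)) * 2 = N * (N - 1) := by
          have h4 : ((∑ t ∈ Finset.range N, t : ℕ) : ℝ) * 2 = (N * (N - 1) : ℕ) := by
            exact_mod_cast this
          rw [Nat.cast_mul, Nat.cast_sub (by omega)] at h4
          push_cast at h4
          exact h4
        linarith
      simp only [Finset.sum_add_distrib, ← Finset.sum_mul, Finset.sum_sub_distrib, h2,
        Finset.sum_const, Finset.card_range, nsmul_eq_mul]
      ring
  have hcard : ((stripS V w N 0).card : ℝ) ≤ ∑ m ∈ Finset.range (N * w + 1), b m := by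
    have h1 : ((stripS V w N 0).card : ℝ) = ∑ m ∈ Finset.range (N * w + 1),
        ((⌊(N : ℝ) * rowR V (((m : ℕ) : ℤ) / N)⌋ : ℝ) + 1 -
          ⌈(N : ℝ) * rowL V (((m : ℕ) : ℤ) / N)⌉ + (0 : ℕ)) := by
      rw [← hint (N * w) (fun m => (⌊(N : ℝ) * rowR V (m / N)⌋ : ℝ) + 1 -
          ⌈(N : ℝ) * rowL V (m / N)⌉ + (0 : ℕ))]
      exact_mod_cast hV.card_stripS N 0
    rw [h1]
    refine Finset.sum_le_sum fun m _ => ?_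
    simp only [hb, Int.cast_natCast]
    have := Int.floor_le ((N : ℝ) * rowR V ((m : ℝ) / N))
    have := Int.le_ceil ((N : ℝ) * rowL V ((m : ℝ) / N))
    push_cast
    linarith
  have hlast : b (N * w) = N * ρ w + 1 := by
    have : ((N * w : ℕ) : ℝ) / N = w := by push_cast; field_simp
    simp only [hb, this, hρ, Int.cast_natCast]; ring
  rw [Finset.sum_range_succ, hlast] at hcard
  refine hcard.trans ((add_le_add_left (hblock w le_rfl) _).trans ?_)
  have hT : stripT V w = ∑ i ∈ Finset.range (w + 1), ρ i - (ρ 0 + ρ w) / 2 := by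
    rw [stripT, ← hint w ρ]; simp [hρ]
  have s1 : ∑ i ∈ Finset.range (w + 1), ρ i = ∑ i ∈ Finset.range w, ρ i + ρ w :=
    Finset.sum_range_succ (fun i : ℕ => ρ i) w
  have s2 : ∑ i ∈ Finset.range (w + 1), ρ i = ∑ i ∈ Finset.range w, ρ (i + 1) + ρ 0 := by
    have := Finset.sum_range_succ' (fun i : ℕ => ρ i) w
    simpa using this
  simp only [Finset.sum_add_distrib, ← Finset.sum_mul, Finset.sum_const, Finset.card_range,
    nsmul_eq_mul]
  set A := ∑ i ∈ Finset.range w, ρ i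
  set B := ∑ i ∈ Finset.range w, ρ (i + 1)
  have hB : 0 ≤ B := Finset.sum_nonneg fun i hi => by
    have := hnat (i + 1) (by simpa [Nat.succ_le_iff] using hi)
    simpa using this
  have hA : 0 ≤ A := Finset.sum_nonneg fun i hi => hnat i (Finset.mem_range.1 hi).le
  have hNA := mul_nonneg hN0.le hA
  have hNB := mul_nonneg hN0.le hB
  have hρw := hnat w le_rfl
  have hρz : 0 ≤ ρ 0 := hnat 0 (by omega)
  rw [hT, hC, s1]
  have e2 : B = A + ρ w - ρ 0 := by linarith
  rw [e2] at hNB ⊢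
  have hw0 : (0 : ℝ) ≤ w := by positivity
  nlinarith [mul_nonneg hN0.le hρz, mul_nonneg hN0.le hρw]

/-- Bivariate polynomials, as polynomials in `Y` over `F[X]`. -/
abbrev Biv (F : Type) [Field F] := Polynomial (Polynomial F)

section Supports

variable {F : Type} [Field F]

instance free_submodule_Biv (S : Submodule F (Biv F)) : Module.Free F S :=
  @Module.Free.of_divisionRing F S _ (Submodule.addCommGroup S) (Submodule.module S)

/-- Bivariate polynomials with support in `S`. -/
def VS (F : Type) [Field F] (S : Set (ℤ × ℤ)) : Submodule F (Biv F) where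
  carrier := {h | ∀ m i : ℕ, (h.coeff m).coeff i ≠ 0 → ((i : ℤ), (m : ℤ)) ∈ S}
  add_mem' := by
    intro a b ha hb m i h
    rw [coeff_add, coeff_add] at h
    by_cases h1 : (a.coeff m).coeff i = 0
    · rw [h1, zero_add] at h; exact hb m i h
    · exact ha m i h1
  zero_mem' := by intro m i h; simp at h
  smul_mem' := by
    intro c a ha m i h
    rw [coeff_smul, coeff_smul, smul_eq_mul] at h
    exact ha m i (right_ne_zero_of_mul h)

lemma mem_VS {S : Set (ℤ × ℤ)} {h : Biv F} :
    h ∈ VS F S ↔ ∀ m i : ℕ, (h.coeff m).coeff i ≠ 0 → ((i : ℤ), (m : ℤ)) ∈ S := Iff.rfl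

lemma VS_mono {S T : Set (ℤ × ℤ)} (h : S ⊆ T) : VS F S ≤ VS F T :=
  fun _ ha m i hmi => h (ha m i hmi)

lemma mul_mem_VS {S S' S'' : Set (ℤ × ℤ)} (hS : ∀ u ∈ S, ∀ v ∈ S', u + v ∈ S'') {a b : Biv F}
    (ha : a ∈ VS F S) (hb : b ∈ VS F S') : a * b ∈ VS F S'' := by
  intro m i h
  rw [coeff_mul, finsetSum_coeff] at h
  obtain ⟨⟨m1, m2⟩, hm, h⟩ := Finset.exists_ne_zero_of_sum_ne_zero h
  rw [coeff_mul] at h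
  obtain ⟨⟨i1, i2⟩, hi, h⟩ := Finset.exists_ne_zero_of_sum_ne_zero h
  rw [Finset.HasAntidiagonal.mem_antidiagonal] at hm hi
  have := hS _ (ha m1 i1 (left_ne_zero_of_mul h)) _ (hb m2 i2 (right_ne_zero_of_mul h))
  simpa [← hm, ← hi] using this

/-- The coefficients at the points of a finite set. -/
noncomputable def coeffsAt (F : Type) [Field F] (S : Finset (ℤ × ℤ)) : Biv F →ₗ[F] (S → F) where
  toFun h s := (h.coeff s.1.2.toNat).coeff s.1.1.toNat
  map_add' a b := by ext s; simp
  map_smul' c a := by ext s; simp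

lemma coeffsAt_inj {S : Finset (ℤ × ℤ)} {h : Biv F} (hh : h ∈ VS F (S : Set (ℤ × ℤ)))
    (h0 : coeffsAt F S h = 0) : h = 0 := by
  ext m i
  by_contra hne
  have := hh m i (by simpa using hne)
  have h1 := congrFun h0 ⟨_, this⟩
  simp only [coeffsAt, LinearMap.coe_mk, AddHom.coe_mk, Int.toNat_natCast, Pi.zero_apply] at h1
  exact hne (by simpa using h1)

lemma VS_injective (S : Finset (ℤ × ℤ)) :
    Function.Injective ((coeffsAt F S).comp (VS F (S : Set (ℤ × ℤ))).subtype) := by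
  rw [injective_iff_map_eq_zero]
  intro h h0
  exact Subtype.ext (coeffsAt_inj h.2 h0)

instance finiteDimensional_VS (S : Finset (ℤ × ℤ)) :
    FiniteDimensional F (VS F (S : Set (ℤ × ℤ))) :=
  Module.Finite.of_injective _ (VS_injective S)

/-- The monomial `X^a Y^b`. -/
noncomputable def mono (F : Type) [Field F] (a b : ℕ) : Biv F := monomial b (monomial a 1)

lemma mono_mul (a b c d : ℕ) : mono F a b * mono F c d = mono F (a + c) (b + d) := by
  simp [mono, monomial_mul_monomial]

lemma mono_pow (a b n : ℕ) : mono F a b ^ n = mono F (n * a) (n * b) := by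
  induction n with
  | zero => simp [mono]
  | succ n ih => rw [pow_succ, ih, mono_mul]; congr 1 <;> ring

lemma mono_mem_VS {S : Set (ℤ × ℤ)} {a b : ℕ} (h : ((a : ℤ), (b : ℤ)) ∈ S) :
    mono F a b ∈ VS F S := by
  intro m i hmi
  rw [mono, coeff_monomial] at hmi
  split_ifs at hmi with h1
  · rw [coeff_monomial] at hmi
    split_ifs at hmi with h2
    · rw [← h1, ← h2]; exact h
    · exact absurd rfl hmi
  · simp at hmi

lemma finrank_VS (S : Finset (ℤ × ℤ)) (hS : ∀ v ∈ S, 0 ≤ v.1 ∧ 0 ≤ v.2) :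
    Module.finrank F (VS F (S : Set (ℤ × ℤ))) = S.card := by
  have hsurj : Function.Surjective ((coeffsAt F S).comp (VS F (S : Set (ℤ × ℤ))).subtype) := by
    intro c
    refine ⟨⟨∑ s : S, c s • mono F s.1.1.toNat s.1.2.toNat, ?_⟩, ?_⟩
    · refine Submodule.sum_mem _ fun s _ => Submodule.smul_mem _ _ (mono_mem_VS ?_)
      rw [Int.toNat_of_nonneg (hS _ s.2).1, Int.toNat_of_nonneg (hS _ s.2).2]
      exact s.2
    · rw [LinearMap.comp_apply, Submodule.subtype_apply, map_sum]
      ext t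
      rw [Finset.sum_apply, Finset.sum_eq_single t]
      · simp [coeffsAt, mono]
      · intro s _ hst
        simp only [map_smul, Pi.smul_apply, coeffsAt, LinearMap.coe_mk, AddHom.coe_mk, mono]
        rw [coeff_monomial]
        split_ifs with h1
        · rw [coeff_monomial, if_neg, smul_zero]
          intro h2
          apply hst
          have a1 := hS _ s.2
          have a2 := hS _ t.2
          exact Subtype.ext (Prod.ext (by omega) (by omega))
        · simp
      · simp
  have e := LinearEquiv.ofBijective _ ⟨VS_injective (F := F) S, hsurj⟩
  rw [e.finrank_eq]
  simp

lemma card_add_le_of_independent {f : Biv F} (hf : f ≠ 0) {A B : Finset (ℤ × ℤ)}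
    (hA : ∀ v ∈ A, 0 ≤ v.1 ∧ 0 ≤ v.2) (hB : ∀ v ∈ B, 0 ≤ v.1 ∧ 0 ≤ v.2)
    (hfAB : ∀ h ∈ VS F (A : Set (ℤ × ℤ)), f * h ∈ VS F (B : Set (ℤ × ℤ)))
    {ι : Type*} [Fintype ι] (b : ι → Biv F) (hb : ∀ i, b i ∈ VS F (B : Set (ℤ × ℤ)))
    (hind : ∀ c : ι → F, f ∣ ∑ i, c i • b i → c = 0) : Fintype.card ι + A.card ≤ B.card := by
  classical
  rw [← finrank_VS (F := F) A hA, ← finrank_VS (F := F) B hB]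
  have h1 : Fintype.card ι = Module.finrank F (ι → F) := by simp
  rw [h1, ← Module.finrank_prod]
  let φ : (ι → F) × VS F (A : Set (ℤ × ℤ)) →ₗ[F] VS F (B : Set (ℤ × ℤ)) :=
    { toFun := fun x => ⟨∑ i, x.1 i • b i + f * x.2.1,
        Submodule.add_mem _ (Submodule.sum_mem _ fun i _ => Submodule.smul_mem _ _ (hb i))
          (hfAB _ x.2.2)⟩
      map_add' := by
        intro x y
        ext1
        simp only [Prod.fst_add, Pi.add_apply, add_smul, Finset.sum_add_distrib, Prod.snd_add,
          Submodule.coe_add, mul_add]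
        ring
      map_smul' := by
        intro c x
        ext1
        simp only [Prod.smul_fst, Pi.smul_apply, smul_eq_mul, mul_smul, Prod.smul_snd,
          Submodule.coe_smul, RingHom.id_apply, smul_add, Finset.smul_sum, mul_smul_comm] }
  refine LinearMap.finrank_le_finrank_of_injective (f := φ) ?_
  rw [injective_iff_map_eq_zero]
  rintro ⟨c, h⟩ h0
  have h0' : ∑ i, c i • b i + f * h.1 = 0 := congrArg Subtype.val h0
  have hc : c = 0 := hind c ⟨-h.1, by linear_combination h0'⟩
  subst hc
  simp only [Pi.zero_apply, zero_smul, Finset.sum_const_zero, zero_add] at h0'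
  have : h.1 = 0 := (mul_eq_zero.1 h0').resolve_left hf
  exact Prod.ext rfl (Subtype.ext this)

/-- Expansions in powers of `h` modulo a prime `f` are unique when the digits come from a
space meeting the ideal `(h, f)` trivially. -/
lemma digits_eq_zero {f h : Biv F} (hf : Prime f) (hfh : ¬ f ∣ h) (s : ℕ) :
    ∀ g : ℕ → Biv F, (∀ t, (∃ A B, g t = h * A + f * B) → g t = 0) →
      f ∣ ∑ t ∈ Finset.range s, h ^ t * g t → ∀ t < s, g t = 0 := by
  induction s with
  | zero => intro g _ _ t ht; omega
  | succ s ih =>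
    intro g hg hdvd
    rw [Finset.sum_range_succ'] at hdvd
    have e : ∑ t ∈ Finset.range s, h ^ (t + 1) * g (t + 1) =
        h * ∑ t ∈ Finset.range s, h ^ t * g (t + 1) := by
      rw [Finset.mul_sum]; refine Finset.sum_congr rfl fun t _ => by ring
    rw [e, pow_zero, one_mul] at hdvd
    have h0 : g 0 = 0 := by
      obtain ⟨B, hB⟩ := hdvd
      exact hg 0 ⟨-∑ t ∈ Finset.range s, h ^ t * g (t + 1), B, by linear_combination hB⟩
    rw [h0, add_zero] at hdvd
    have h1 := ih (fun t => g (t + 1)) (fun t => hg (t + 1)) ((hf.dvd_or_dvd hdvd).resolve_left hfh)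
    intro t ht
    rcases t with _ | t
    · exact h0
    · exact h1 t (by omega)

end Supports

lemma not_quadratic_le_linear {a b c : ℝ} (ha : 0 < a) (h : ∀ M : ℕ, a * (M : ℝ) ^ 2 ≤ b * M + c) :
    False := by
  obtain ⟨M, hM⟩ := exists_nat_gt ((|b| + |c| + 1) / a + 1)
  have h1 := h M
  have hM1 : 1 ≤ (M : ℝ) := by
    have : 0 ≤ (|b| + |c| + 1) / a := by positivity
    linarith
  have hM2 : |b| + |c| + 1 < a * M := by
    have : (|b| + |c| + 1) / a < M := by linarith
    rw [div_lt_iff₀ ha] at this; linarith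
  have hb := le_abs_self b
  have hc := le_abs_self c
  have hc0 := abs_nonneg c
  nlinarith

section ZeroCount

variable {F : Type} [Field F]

lemma IsStrip.rowL_nonneg {V : Finset (ℤ × ℤ)} {w : ℕ} (hV : IsStrip V w) (hV0 : ∀ v ∈ V, 0 ≤ v.1)
    {y : ℝ} (h0 : 0 ≤ y) (h1 : y ≤ w) : 0 ≤ rowL V y := by
  have := hullZ_halfplane (V := V) (a := -1) (b := 0) (c := 0) (fun v hv => by
    have : (0 : ℝ) ≤ v.1 := by exact_mod_cast hV0 v hv
    linarith) (hV.rowL_mem h0 h1)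
  simp only at this
  linarith

lemma IsStrip.rowL_le_of_le {V : Finset (ℤ × ℤ)} {w : ℕ} (hV : IsStrip V w) {X : ℝ}
    (hX : ∀ v ∈ V, (v.1 : ℝ) ≤ X) {y : ℝ} (h0 : 0 ≤ y) (h1 : y ≤ w) : rowL V y ≤ X := by
  have := hullZ_halfplane (V := V) (a := 1) (b := 0) (c := X) (fun v hv => by
    have := hX v hv
    linarith) (hV.rowL_mem h0 h1)
  simp only at this
  linarith

lemma IsStrip.nonneg_of_mem_stripS {V : Finset (ℤ × ℤ)} {w : ℕ} (hV : IsStrip V w)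
    (hV0 : ∀ v ∈ V, 0 ≤ v.1) {j k : ℕ} {v : ℤ × ℤ} (hv : v ∈ stripS V w j k) :
    0 ≤ v.1 ∧ 0 ≤ v.2 := by
  rw [mem_stripS] at hv
  obtain ⟨h0, h1, h2, -⟩ := hv
  obtain ⟨h3, h4⟩ := IsStrip.height_div h0 h1
  have h5 := hV.rowL_nonneg hV0 h3 h4
  refine ⟨?_, h0⟩
  have : (0 : ℝ) ≤ v.1 := le_trans (by positivity) h2
  exact_mod_cast this

lemma stripS_mono {V : Finset (ℤ × ℤ)} {w j k k' : ℕ} (h : k ≤ k') :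
    (stripS V w j k : Set (ℤ × ℤ)) ⊆ stripS V w j k' := by
  intro v hv
  rw [Finset.mem_coe, mem_stripS] at *
  have : (k : ℝ) ≤ k' := by exact_mod_cast h
  exact ⟨hv.1, hv.2.1, hv.2.2.1, by linarith [hv.2.2.2]⟩

lemma IsStrip.mul_mem {V : Finset (ℤ × ℤ)} {w : ℕ} (hV : IsStrip V w) {j k j' k' : ℕ}
    {a b : Biv F} (ha : a ∈ VS F (stripS V w j k : Set (ℤ × ℤ)))
    (hb : b ∈ VS F (stripS V w j' k' : Set (ℤ × ℤ))) :
    a * b ∈ VS F (stripS V w (j + j') (k + k') : Set (ℤ × ℤ)) :=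
  mul_mem_VS (fun _ hu _ hv => hV.add_mem_stripS hu hv) ha hb

lemma IsStrip.pow_mem {V : Finset (ℤ × ℤ)} {w : ℕ} (hV : IsStrip V w) {j k : ℕ}
    {a : Biv F} (ha : a ∈ VS F (stripS V w j k : Set (ℤ × ℤ))) (t : ℕ) :
    a ^ t ∈ VS F (stripS V w (t * j) (t * k) : Set (ℤ × ℤ)) := by
  induction t with
  | zero =>
    have : (1 : Biv F) = mono F 0 0 := by simp [mono]
    rw [pow_zero, this]
    refine mono_mem_VS ?_
    rw [Finset.mem_coe, mem_stripS]
    simp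
  | succ t ih =>
    rw [pow_succ, add_mul, add_mul, one_mul, one_mul]
    exact hV.mul_mem ih ha

lemma exists_degree_bound {ι : Type*} [Fintype ι] (a : ι → Biv F) :
    ∃ D : ℕ, ∀ i, ∀ m n : ℕ, ((a i).coeff m).coeff n ≠ 0 → m ≤ D ∧ n ≤ D := by
  have h : ∀ g : Biv F, ∃ D : ℕ, ∀ m n : ℕ, (g.coeff m).coeff n ≠ 0 → m ≤ D ∧ n ≤ D := by
    intro g
    refine ⟨g.natDegree + ∑ m ∈ Finset.range (g.natDegree + 1), (g.coeff m).natDegree, ?_⟩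
    intro m n hmn
    have h1 : m ≤ g.natDegree := le_natDegree_of_ne_zero (fun h => hmn (by simp [h]))
    have h2 : n ≤ (g.coeff m).natDegree := le_natDegree_of_ne_zero hmn
    have h3 := Finset.single_le_sum (f := fun m => (g.coeff m).natDegree) (fun _ _ => Nat.zero_le _)
      (Finset.mem_range.2 (Nat.lt_add_one_of_le h1))
    omega
  choose D hD using fun i => h (a i)
  refine ⟨∑ i, D i, fun i m n hmn => ?_⟩
  have h1 := hD i m n hmn
  have h2 := Finset.single_le_sum (f := D) (fun _ _ => Nat.zero_le _) (Finset.mem_univ i)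
  omega

lemma IsStrip.exists_shift {V : Finset (ℤ × ℤ)} {w : ℕ} (hV : IsStrip V w)
    (hV0 : ∀ v ∈ V, 0 ≤ v.1) {ι : Type*} [Fintype ι] (a : ι → Biv F) :
    ∃ c j k : ℕ, 0 < j ∧ ∀ i, mono F c 0 * a i ∈ VS F (stripS V w j k : Set (ℤ × ℤ)) := by
  obtain ⟨D, hD⟩ := exists_degree_bound a
  obtain ⟨X, hX⟩ : ∃ X : ℕ, ∀ v ∈ V, (v.1 : ℝ) ≤ X := by
    refine ⟨∑ v ∈ V, v.1.toNat, fun v hv => ?_⟩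
    have h2 := Finset.single_le_sum (f := fun v : ℤ × ℤ => v.1.toNat) (fun _ _ => Nat.zero_le _) hv
    have : v.1 ≤ ((∑ v ∈ V, v.1.toNat : ℕ) : ℤ) := by
      have := Int.self_le_toNat v.1
      exact this.trans (by exact_mod_cast h2)
    exact_mod_cast this
  refine ⟨(D + 1) * X, D + 1, (D + 1) * X + D, by omega, fun i => ?_⟩
  refine mul_mem_VS (S := {((((D + 1) * X : ℕ) : ℤ), (0 : ℤ))})
    (S' := {v | 0 ≤ v.1 ∧ v.1 ≤ D ∧ 0 ≤ v.2 ∧ v.2 ≤ D}) ?_ (mono_mem_VS (by simp)) ?_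
  · rintro _ rfl v ⟨h1, h2, h3, h4⟩
    rw [Finset.mem_coe, mem_stripS]
    simp only [Prod.fst_add, Prod.snd_add, zero_add]
    have hw : (1 : ℤ) ≤ w := by exact_mod_cast hV.pos
    have h5 : v.2 ≤ ((D + 1 : ℕ) : ℤ) * w := by push_cast; nlinarith
    obtain ⟨h6, h7⟩ := IsStrip.height_div h3 h5
    have h8 := hV.rowL_nonneg hV0 h6 h7
    have h9 := hV.rowL_le_of_le hX h6 h7
    have h10 := hV.rowL_le_rowR h6 h7
    have h1' : (0 : ℝ) ≤ v.1 := by exact_mod_cast h1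
    have h2' : (v.1 : ℝ) ≤ D := by exact_mod_cast h2
    refine ⟨h3, h5, ?_, ?_⟩
    · push_cast at *
      nlinarith [mul_le_mul_of_nonneg_left h9 (by positivity : (0 : ℝ) ≤ D + 1)]
    · have : 0 ≤ ((D + 1 : ℕ) : ℝ) * rowR V (v.2 / ((D + 1 : ℕ) : ℝ)) := by
        have := h8.trans h10
        positivity
      push_cast at *
      linarith
  · intro m n hmn
    have := hD i m n hmn
    simp only [Set.mem_ofPred_eq]
    omega

lemma IsStrip.card_step {V : Finset (ℤ × ℤ)} {w : ℕ} (hV : IsStrip V w)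
    (hV0 : ∀ v ∈ V, 0 ≤ v.1) {f : Biv F} (hf : Prime f)
    (hfV : f ∈ VS F (stripS V w 1 0 : Set (ℤ × ℤ))) {j k : ℕ} {h : Biv F}
    (hh : h ∈ VS F (stripS V w j k : Set (ℤ × ℤ))) (hfh : ¬ f ∣ h) {ι : Type*} [Fintype ι]
    (a : ι → Biv F) (ha : ∀ c : ι → F, ∀ r s : ℕ,
      (∃ A B, mono F r s * ∑ i, c i • a i = h * A + f * B) → c = 0) {c₀ j₀ k₀ : ℕ}
    (hs : ∀ i, mono F c₀ 0 * a i ∈ VS F (stripS V w j₀ k₀ : Set (ℤ × ℤ))) (M n : ℕ)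
    (hn : j₀ + j * M ≤ n) :
    M * Fintype.card ι + (stripS V w n 0).card ≤
      (stripS V w (n + 1) 0).card + (k₀ + M * k) * w := by
  obtain ⟨v, hv, -⟩ := hV.bot
  have hv1 : v ∈ stripS V w 1 0 := by
    have : v ∈ latticePts (hullZ V) := mem_hullZ hv
    rw [hV.stripS_one] at this; exact this
  have hμ : mono F v.1.toNat v.2.toNat ∈ VS F (stripS V w 1 0 : Set (ℤ × ℤ)) := by
    refine mono_mem_VS ?_
    rw [Int.toNat_of_nonneg (hV0 v hv), Int.toNat_of_nonneg (hV.ge v hv)]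
    exact hv1
  set b : ι × Fin M → Biv F := fun x =>
    h ^ (x.2 : ℕ) * (mono F v.1.toNat v.2.toNat ^ (n + 1 - j₀ - x.2 * j) * (mono F c₀ 0 * a x.1))
    with hb
  have hmem : ∀ x, b x ∈ VS F (stripS V w (n + 1) (k₀ + M * k) : Set (ℤ × ℤ)) := by
    intro x
    have h1 := hV.mul_mem (hV.pow_mem hh x.2) (hV.mul_mem (hV.pow_mem hμ (n + 1 - j₀ - x.2 * j))
      (hs x.1))
    have h2 : (x.2 : ℕ) * j ≤ j * M := by
      rw [mul_comm]; exact Nat.mul_le_mul_left _ x.2.2.le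
    have h3 : (x.2 : ℕ) * k ≤ M * k := Nat.mul_le_mul_right _ x.2.2.le
    have e : (x.2 : ℕ) * j + ((n + 1 - j₀ - x.2 * j) * 1 + j₀) = n + 1 := by omega
    rw [e] at h1
    exact VS_mono (stripS_mono (by omega)) h1
  have hind : ∀ c : ι × Fin M → F, f ∣ ∑ x, c x • b x → c = 0 := by
    intro c hc
    set g : ℕ → Biv F := fun t => if ht : t < M then
      mono F v.1.toNat v.2.toNat ^ (n + 1 - j₀ - t * j) * (mono F c₀ 0 *
        ∑ i, c (i, ⟨t, ht⟩) • a i) else 0 with hg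
    have key : ∀ t (ht : t < M), (∃ A B, g t = h * A + f * B) → (fun i => c (i, ⟨t, ht⟩)) = 0 := by
      rintro t ht ⟨A, B, hAB⟩
      rw [hg] at hAB
      simp only [dif_pos ht] at hAB
      rw [← mul_assoc, mono_pow, mono_mul] at hAB
      exact ha _ _ _ ⟨A, B, hAB⟩
    have hsum : ∑ x, c x • b x = ∑ t ∈ Finset.range M, h ^ t * g t := by
      rw [Fintype.sum_prod_type_right, Finset.sum_range]
      refine Finset.sum_congr rfl fun t _ => ?_
      simp only [hg, dif_pos t.2, hb, Finset.mul_sum, Algebra.mul_smul_comm, Fin.eta]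
    rw [hsum] at hc
    have h0 := digits_eq_zero hf hfh M g (fun t hAB => by
      by_cases ht : t < M
      · have := key t ht hAB
        simp only [hg, dif_pos ht]
        have h2 : ∀ i, c (i, ⟨t, ht⟩) = 0 := fun i => congrFun this i
        simp [h2]
      · simp [hg, ht]) hc
    ext ⟨i, t⟩
    exact congrFun (key t t.2 ⟨0, 0, by rw [h0 t t.2]; simp⟩) i
  have hcard := card_add_le_of_independent hf.ne_zero (A := stripS V w n (k₀ + M * k))
    (B := stripS V w (n + 1) (k₀ + M * k)) (fun _ hu => hV.nonneg_of_mem_stripS hV0 hu)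
    (fun _ hu => hV.nonneg_of_mem_stripS hV0 hu) (fun g hg => by
      have := hV.mul_mem hfV hg
      rwa [add_comm 1 n, zero_add] at this) b hmem hind
  rw [hV.card_stripS_add n, hV.card_stripS_add (n + 1)] at hcard
  rw [Fintype.card_prod, Fintype.card_fin] at hcard
  nlinarith

/-- A function in `VS (stripS j k)` that is nonzero modulo `f` has at most `2 j T + k w` zeros,
stated as a bound on the size of a family independent modulo that function. -/
theorem IsStrip.zero_count {V : Finset (ℤ × ℤ)} {w : ℕ} (hV : IsStrip V w)
    (hV0 : ∀ v ∈ V, 0 ≤ v.1) {f : Biv F} (hf : Prime f)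
    (hfV : f ∈ VS F (stripS V w 1 0 : Set (ℤ × ℤ))) {j k : ℕ} (hj : 0 < j) {h : Biv F}
    (hh : h ∈ VS F (stripS V w j k : Set (ℤ × ℤ))) (hfh : ¬ f ∣ h) {ι : Type*} [Fintype ι]
    (a : ι → Biv F) (ha : ∀ c : ι → F, ∀ r s : ℕ,
      (∃ A B, mono F r s * ∑ i, c i • a i = h * A + f * B) → c = 0) {τ : ℕ}
    (hτ : 2 * stripT V w ≤ τ) : Fintype.card ι ≤ j * τ + k * w := by
  by_contra hcon
  push Not at hcon
  obtain ⟨c₀, j₀, k₀, hj₀, hs⟩ := hV.exists_shift hV0 a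
  set Z := Fintype.card ι
  have step := hV.card_step hV0 hf hfV hh hfh a ha hs
  have block : ∀ M i : ℕ, i * (M * Z) + (stripS V w (j₀ + j * M) 0).card ≤
      (stripS V w (j₀ + j * M + i) 0).card + i * ((k₀ + M * k) * w) := by
    intro M i
    induction i with
    | zero => simp
    | succ i ih =>
      have := step M (j₀ + j * M + i) (by omega)
      rw [← add_assoc]
      nlinarith
  have total : ∀ M : ℕ, (j : ℝ) * Z * (M * (M - 1) / 2) ≤
      ((stripS V w (j₀ + j * M) 0).card : ℝ) + j * w * (k₀ * M + k * (M * (M - 1) / 2)) := by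
    intro M
    induction M with
    | zero => simp
    | succ M ih =>
      have h1 : (j * (M * Z) + (stripS V w (j₀ + j * M) 0).card : ℝ) ≤
        (stripS V w (j₀ + j * M + j) 0).card + j * ((k₀ + M * k) * w) := by
          exact_mod_cast block M j
      rw [show j₀ + j * (M + 1) = j₀ + j * M + j by ring]
      push_cast
      nlinarith
  obtain ⟨C, hC0, hC⟩ := hV.card_stripS_le
  set T := stripT V w
  have hZ : (j * τ + k * w + 1 : ℝ) ≤ Z := by exact_mod_cast hcon
  have hj' : (1 : ℝ) ≤ j := by exact_mod_cast hj
  refine not_quadratic_le_linear (a := (1 / 2 : ℝ))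
    (b := 2 * T * j₀ * j + C * j + j * w * k₀ + j * (Z - k * w) / 2)
    (c := T * j₀ ^ 2 + C * j₀ + C) (by norm_num) fun M => ?_
  have h1 := total M
  have h2 := hC (j₀ + j * M) (by omega)
  push_cast at h2
  have h3 : (j : ℝ) * (j * τ + 1) ≤ j * (Z - k * w) :=
    mul_le_mul_of_nonneg_left (by linarith) (by linarith)
  have h4 : (1 : ℝ) ≤ j * (Z - k * w) - 2 * T * j ^ 2 := by
    have : 2 * T * (j : ℝ) ^ 2 ≤ τ * j ^ 2 := mul_le_mul_of_nonneg_right hτ (by positivity)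
    nlinarith
  have h5 : (1 / 2 : ℝ) * M ^ 2 ≤ (j * (Z - k * w) - 2 * T * j ^ 2) / 2 * M ^ 2 :=
    mul_le_mul_of_nonneg_right (by linarith) (by positivity)
  nlinarith

end ZeroCount

section Branches

variable {F : Type} [Field F]

lemma PowerSeries.eq_zero_of_forall_dvd {a : PowerSeries F}
    (h : ∀ n : ℕ, PowerSeries.X ^ n ∣ a) : a = 0 := by
  ext n
  exact PowerSeries.X_pow_dvd_iff.1 (h (n + 1)) n (Nat.lt_succ_self n)

/-- Hensel's lemma for power series, without monicity. -/
lemma PowerSeries.exists_root (p : Polynomial (PowerSeries F)) (a₀ : PowerSeries F)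
    (h0 : PowerSeries.X ∣ p.eval a₀) (h1 : IsUnit (p.derivative.eval a₀)) :
    ∃ a, p.eval a = 0 ∧ PowerSeries.X ∣ a - a₀ := by
  have unit_of : ∀ b, PowerSeries.X ∣ b - a₀ → IsUnit (p.derivative.eval b) := by
    intro b hb
    have h2 := hb.trans (sub_dvd_eval_sub b a₀ p.derivative)
    rw [PowerSeries.isUnit_iff_constantCoeff] at *
    rw [PowerSeries.X_dvd_iff, map_sub, sub_eq_zero] at h2
    rwa [h2]
  have step : ∀ (n : ℕ) (b : PowerSeries F), PowerSeries.X ∣ b - a₀ →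
      PowerSeries.X ^ (n + 1) ∣ p.eval b → ∃ b', PowerSeries.X ∣ b' - a₀ ∧
        PowerSeries.X ^ (n + 1 + 1) ∣ p.eval b' ∧ PowerSeries.X ^ (n + 1) ∣ b' - b := by
    intro n b hb hpb
    obtain ⟨u, hu⟩ := unit_of b hb
    obtain ⟨c, hc⟩ := exists_mul_sq_add_linear_part_eq_eval_add p b (-(p.eval b * ↑u⁻¹))
    have hd : (PowerSeries.X : PowerSeries F) ^ (n + 1) ∣ -(p.eval b * (↑u⁻¹ : PowerSeries F)) := (hpb.mul_right _).neg_right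
    refine ⟨b + -(p.eval b * ↑u⁻¹), ?_, ?_, ?_⟩
    · have := (dvd_pow_self (PowerSeries.X : PowerSeries F) (Nat.succ_ne_zero n)).trans hd
      convert dvd_add hb this using 1; ring
    · rw [← hu] at hc
      have e : p.eval (b + -(p.eval b * ↑u⁻¹)) = c * (-(p.eval b * ↑u⁻¹)) ^ 2 := by
        have := u.mul_inv
        linear_combination (-1 : PowerSeries F) * hc - p.eval b * this
      rw [e]
      refine Dvd.dvd.mul_left ?_ _
      refine (pow_dvd_pow _ (by omega : n + 1 + 1 ≤ (n + 1) * 2)).trans ?_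
      rw [pow_mul]
      exact pow_dvd_pow_of_dvd hd 2
    · rwa [add_sub_cancel_left]
  choose! g hg1 hg2 hg3 using step
  let c : ℕ → PowerSeries F := fun n => Nat.rec a₀ (fun n b => g n b) n
  have hc : ∀ n, PowerSeries.X ∣ c n - a₀ ∧ PowerSeries.X ^ (n + 1) ∣ p.eval (c n) := by
    intro n
    induction n with
    | zero => simpa [c] using h0
    | succ n ih => exact ⟨hg1 n _ ih.1 ih.2, hg2 n _ ih.1 ih.2⟩
  have hcs : ∀ n, PowerSeries.X ^ (n + 1) ∣ c (n + 1) - c n := fun n =>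
    hg3 n _ (hc n).1 (hc n).2
  have hcoeff : ∀ n k, PowerSeries.coeff n (c (n + k)) = PowerSeries.coeff n (c n) := by
    intro n k
    induction k with
    | zero => rfl
    | succ k ih =>
      have := PowerSeries.X_pow_dvd_iff.1 (hcs (n + k)) n (by omega)
      rw [map_sub, sub_eq_zero, ih] at this
      exact this
  set a : PowerSeries F := PowerSeries.mk fun n => PowerSeries.coeff n (c n) with ha
  have hac : ∀ n, PowerSeries.X ^ (n + 1) ∣ a - c n := by
    intro n
    rw [PowerSeries.X_pow_dvd_iff]
    intro m hm
    obtain ⟨k, rfl⟩ := Nat.exists_eq_add_of_le (Nat.lt_succ_iff.1 hm)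
    rw [map_sub, ha, PowerSeries.coeff_mk, hcoeff, sub_self]
  refine ⟨a, PowerSeries.eq_zero_of_forall_dvd fun n => ?_, ?_⟩
  · have h3 := (hac n).trans (sub_dvd_eval_sub a (c n) p)
    have h4 := dvd_add h3 (hc n).2
    rw [sub_add_cancel] at h4
    exact (pow_dvd_pow _ (Nat.le_succ n)).trans h4
  · simpa [c] using hac 0

/-- Substitution of two power series into a bivariate polynomial. -/
noncomputable def brMap (ξ η : PowerSeries F) : Biv F →ₐ[F] PowerSeries F :=
  Polynomial.eval₂AlgHom (aeval ξ) η (fun _ => Commute.all _ _)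

lemma brMap_eq (ξ η : PowerSeries F) (g : Biv F) :
    brMap ξ η g = g.eval₂ (aeval ξ : Polynomial F →ₐ[F] PowerSeries F).toRingHom η := rfl

@[simp] lemma brMap_Y (ξ η : PowerSeries F) : brMap ξ η X = η := by simp [brMap_eq]

@[simp] lemma brMap_C (ξ η : PowerSeries F) (p : Polynomial F) : brMap ξ η (C p) = aeval ξ p := by
  simp [brMap_eq]

lemma constantCoeff_brMap (ξ η : PowerSeries F) (g : Biv F) :
    PowerSeries.constantCoeff (brMap ξ η g) =
      g.evalEval (PowerSeries.constantCoeff ξ) (PowerSeries.constantCoeff η) := by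
  have : (PowerSeries.constantCoeff (R := F)).comp (brMap ξ η).toRingHom =
      evalEvalRingHom (PowerSeries.constantCoeff ξ) (PowerSeries.constantCoeff η) := by
    refine Polynomial.ringHom_ext' (Polynomial.ringHom_ext ?_ ?_) ?_
    · intro a
      simp
    · simp
    · simp
  exact congrArg (fun φ : Biv F →+* F => φ g) this

lemma evalEval_mono (x y : F) (a b : ℕ) : (mono F a b).evalEval x y = x ^ a * y ^ b := by
  simp [mono, evalEval, eval_monomial]

/-- At a zero of `f` where `∂f/∂y` does not vanish, the curve has a branch parametrised by `x`. -/
lemma exists_branch {f : Biv F} {x y : F} (h0 : f.evalEval x y = 0)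
    (h1 : f.derivative.evalEval x y ≠ 0) :
    ∃ η : PowerSeries F, PowerSeries.constantCoeff η = y ∧
      brMap (PowerSeries.C x + PowerSeries.X) η f = 0 := by
  set ξ : PowerSeries F := PowerSeries.C x + PowerSeries.X with hξ
  have e : ∀ (g : Biv F) η, (g.map (aeval ξ : Polynomial F →ₐ[F] PowerSeries F).toRingHom).eval η =
      brMap ξ η g := by
    intro g η
    rw [brMap_eq, eval_map]
  have hcc : PowerSeries.constantCoeff ξ = x := by simp [hξ]
  obtain ⟨η, hη0, hη1⟩ := PowerSeries.exists_root
    (f.map (aeval ξ : Polynomial F →ₐ[F] PowerSeries F).toRingHom) (PowerSeries.C y)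
    (by rw [e, PowerSeries.X_dvd_iff, constantCoeff_brMap, hcc]; simpa using h0)
    (by
      rw [derivative_map, e, PowerSeries.isUnit_iff_constantCoeff, constantCoeff_brMap, hcc]
      simpa using h1)
  refine ⟨η, ?_, by rw [← e]; exact hη0⟩
  rw [PowerSeries.X_dvd_iff, map_sub, sub_eq_zero] at hη1
  simpa using hη1

/-- A polynomial vanishing at the second point and not at the first. -/
lemma exists_separating {p p' : F × F} (h : p ≠ p') :
    ∃ s : Biv F, s.evalEval p.1 p.2 ≠ 0 ∧ s.evalEval p'.1 p'.2 = 0 := by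
  by_cases h1 : p.1 = p'.1
  · have h2 : p.2 ≠ p'.2 := fun h2 => h (Prod.ext h1 h2)
    exact ⟨X - C (C p'.2), by simpa [sub_eq_zero] using h2, by simp⟩
  · exact ⟨C (X - C p'.1), by rw [evalEval_C]; simpa [sub_eq_zero] using h1, by
    rw [evalEval_C]; simp⟩

lemma coeff_sum_X_pow {m : ℕ} (c : Fin m → F) (h : PowerSeries.X ^ m ∣
    ∑ t, c t • (PowerSeries.X : PowerSeries F) ^ (t : ℕ)) : c = 0 := by
  ext t
  have := PowerSeries.X_pow_dvd_iff.1 h t t.2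
  rw [map_sum, Finset.sum_eq_single t] at this
  · simpa [PowerSeries.coeff_X_pow] using this
  · intro s _ hst
    rw [map_smul, PowerSeries.coeff_X_pow, if_neg (fun h => hst (Fin.ext h.symm)), smul_zero]
  · simp

/-- The total order of vanishing along branches of `f` is bounded. -/
theorem IsStrip.order_count {V : Finset (ℤ × ℤ)} {w : ℕ} (hV : IsStrip V w)
    (hV0 : ∀ v ∈ V, 0 ≤ v.1) {f : Biv F} (hf : Prime f)
    (hfV : f ∈ VS F (stripS V w 1 0 : Set (ℤ × ℤ))) {j k : ℕ} (hj : 0 < j) {h : Biv F}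
    (hh : h ∈ VS F (stripS V w j k : Set (ℤ × ℤ))) (hfh : ¬ f ∣ h) {τ : ℕ}
    (hτ : 2 * stripT V w ≤ τ) {ι : Type*} [Fintype ι] (P : ι → F × F)
    (hP : Function.Injective P) (hP0 : ∀ i, (P i).1 ≠ 0 ∧ (P i).2 ≠ 0) (ξ η : ι → PowerSeries F)
    (hξ : ∀ i, PowerSeries.constantCoeff (ξ i) = (P i).1)
    (hη : ∀ i, PowerSeries.constantCoeff (η i) = (P i).2)
    (hbr : ∀ i, brMap (ξ i) (η i) f = 0) (m : ι → ℕ)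
    (hm : ∀ i, m i ≤ 1 ∨ ξ i = PowerSeries.C (P i).1 + PowerSeries.X)
    (hord : ∀ i, PowerSeries.X ^ m i ∣ brMap (ξ i) (η i) h) :
    ∑ i, m i ≤ j * τ + k * w := by
  classical
  have hcc : ∀ i g, PowerSeries.constantCoeff (brMap (ξ i) (η i) g) =
      g.evalEval (P i).1 (P i).2 := by
    intro i g
    rw [constantCoeff_brMap, hξ, hη]
  have hsep : ∀ i i', ∃ s : Biv F, i' ≠ i → s.evalEval (P i).1 (P i).2 ≠ 0 ∧
      s.evalEval (P i').1 (P i').2 = 0 := by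
    intro i i'
    by_cases h : i' = i
    · exact ⟨0, fun h' => absurd h h'⟩
    · obtain ⟨s, hs⟩ := exists_separating (hP.ne (Ne.symm h))
      exact ⟨s, fun _ => hs⟩
  choose s hs using hsep
  set e : ι → Biv F := fun i => ∏ i' ∈ Finset.univ.erase i, s i i' ^ m i' with he
  have he1 : ∀ i, IsUnit (brMap (ξ i) (η i) (e i)) := by
    intro i
    rw [PowerSeries.isUnit_iff_constantCoeff, hcc, isUnit_iff_ne_zero, he, evalEval_prod,
      Finset.prod_ne_zero_iff]
    intro i' hi'
    rw [evalEval_pow]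
    exact pow_ne_zero _ (hs i i' (Finset.ne_of_mem_erase hi')).1
  have he2 : ∀ i i', i' ≠ i → PowerSeries.X ^ m i' ∣ brMap (ξ i') (η i') (e i) := by
    intro i i' hi
    have h1 : s i i' ^ m i' ∣ e i :=
      Finset.dvd_prod_of_mem (fun i' => s i i' ^ m i') (Finset.mem_erase.2 ⟨hi, Finset.mem_univ _⟩)
    refine dvd_trans ?_ (map_dvd (brMap (ξ i') (η i')) h1)
    rw [map_pow]
    refine pow_dvd_pow_of_dvd ?_ _
    rw [PowerSeries.X_dvd_iff, hcc]
    exact (hs i i' hi).2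
  have key := hV.zero_count hV0 hf hfV hj hh hfh (ι := Σ i, Fin (m i))
    (fun x => e x.1 * C (X - C (P x.1).1) ^ (x.2 : ℕ)) ?_ hτ
  · simpa using key
  intro c r r' ⟨A, B, hAB⟩
  suffices H : ∀ i, (fun t => c ⟨i, t⟩) = 0 by
    ext ⟨i, t⟩
    exact congrFun (H i) t
  intro i
  have h1 := congrArg (brMap (ξ i) (η i)) hAB
  rw [map_mul, map_add, map_mul, map_mul, hbr, zero_mul, add_zero] at h1
  have h2 : PowerSeries.X ^ m i ∣ brMap (ξ i) (η i) (mono F r r') * brMap (ξ i) (η i)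
      (∑ x : Σ i, Fin (m i), c x • (e x.1 * C (X - C (P x.1).1) ^ (x.2 : ℕ))) := by
    rw [h1]; exact (hord i).mul_right _
  have hu : IsUnit (brMap (ξ i) (η i) (mono F r r')) := by
    rw [PowerSeries.isUnit_iff_constantCoeff, hcc, isUnit_iff_ne_zero, evalEval_mono]
    exact mul_ne_zero (pow_ne_zero _ (hP0 i).1) (pow_ne_zero _ (hP0 i).2)
  rw [hu.dvd_mul_left] at h2
  rw [Fintype.sum_sigma, map_sum, ← Finset.add_sum_erase _ _ (Finset.mem_univ i)] at h2
  rw [dvd_add_left (Finset.dvd_sum fun i' hi' => by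
    rw [map_sum]
    refine Finset.dvd_sum fun t _ => ?_
    rw [map_smul, map_mul]
    rw [Algebra.smul_def]
    exact ((he2 i' i (Finset.ne_of_mem_erase hi').symm).mul_right _).mul_left _)] at h2
  simp only [← mul_smul_comm] at h2
  rw [← Finset.mul_sum, map_mul, (he1 i).dvd_mul_left, map_sum] at h2
  simp only [map_smul, map_pow, brMap_C] at h2
  rcases Nat.lt_or_ge (m i) 2 with hlt | hge
  · rcases Nat.eq_zero_or_pos (m i) with h0 | hpos
    · ext t
      exact absurd t.2 (by omega)
    · have h3 : m i = 1 := by omega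
      have h4 : ∀ t : Fin (m i), (t : ℕ) = 0 := fun t => by have := t.2; omega
      refine coeff_sum_X_pow _ ?_
      simpa [h4] using h2
  · have h3 := (hm i).resolve_left (by omega)
    refine coeff_sum_X_pow _ ?_
    have h4 : aeval (ξ i) (X - C (P i).1) = (PowerSeries.X : PowerSeries F) := by
      rw [h3]; simp
    simpa only [h4] using h2

end Branches

lemma exists_linearIndependent_ker {F M W : Type*} [Field F] [AddCommGroup M] [Module F M]
    [AddCommGroup W] [Module F W] [FiniteDimensional F W] (E : Submodule F M)
    [FiniteDimensional F E] (L : M →ₗ[F] W) {N : ℕ}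
    (hN : N + Module.finrank F W ≤ Module.finrank F E) :
    ∃ a : Fin N → M, (∀ i, a i ∈ E) ∧ (∀ i, L (a i) = 0) ∧ LinearIndependent F a := by
  have hrank := LinearMap.finrank_range_add_finrank_ker (L.comp E.subtype)
  have h1 := Submodule.finrank_le (LinearMap.range (L.comp E.subtype))
  obtain ⟨a, ha⟩ := exists_linearIndependent_of_le_finrank
    (show N ≤ Module.finrank F (LinearMap.ker (L.comp E.subtype)) by omega)
  refine ⟨fun i => ((a i : E) : M), fun i => (a i : E).2, fun i => (a i).2, ?_⟩
  exact (ha.map' _ (Submodule.ker_subtype _)).map' _ (Submodule.ker_subtype _)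

section Curve

variable {F : Type} [Field F]

/-- The numerical data of a plane curve `f = 0` used below: `V` is a set of exponents whose hull
contains the support of `f`, lying in the strip of height `w`. -/
structure IsCurve (V : Finset (ℤ × ℤ)) (w τ : ℕ) (f : Biv F) : Prop where
  strip : IsStrip V w
  nonneg : ∀ v ∈ V, 0 ≤ v.1
  prime : Prime f
  mem : f ∈ VS F (stripS V w 1 0 : Set (ℤ × ℤ))
  deg : f.natDegree = w
  top : rowR V w ≤ f.leadingCoeff.natDegree
  area : 2 * stripT V w ≤ τ

/-- A torus zero of `f` at which `∂f/∂y ≠ 0`, with its branch. -/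
structure IsBranch (f : Biv F) (P : F × F) (η : PowerSeries F) : Prop where
  fst : P.1 ≠ 0
  snd : P.2 ≠ 0
  coeff : PowerSeries.constantCoeff η = P.2
  root : brMap (PowerSeries.C P.1 + PowerSeries.X) η f = 0

/-- Restriction to a branch. -/
noncomputable def br (P : F × F) (η : PowerSeries F) : Biv F →ₐ[F] PowerSeries F :=
  brMap (PowerSeries.C P.1 + PowerSeries.X) η

lemma IsBranch.constantCoeff {f : Biv F} {P : F × F} {η : PowerSeries F} (hP : IsBranch f P η)
    (g : Biv F) : PowerSeries.constantCoeff (br P η g) = g.evalEval P.1 P.2 := by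
  rw [br, constantCoeff_brMap, hP.coeff]
  simp

lemma IsBranch.isUnit_mono {f : Biv F} {P : F × F} {η : PowerSeries F} (hP : IsBranch f P η)
    (a b : ℕ) : IsUnit (br P η (mono F a b)) := by
  rw [PowerSeries.isUnit_iff_constantCoeff, hP.constantCoeff, isUnit_iff_ne_zero, evalEval_mono]
  exact mul_ne_zero (pow_ne_zero _ hP.fst) (pow_ne_zero _ hP.snd)

lemma IsBranch.eq_zero_of_dvd {f : Biv F} {P : F × F} {η : PowerSeries F} (hP : IsBranch f P η)
    {g : Biv F} (h : f ∣ g) : br P η g = 0 := by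
  obtain ⟨c, rfl⟩ := h
  rw [map_mul, br, hP.root, zero_mul]

variable {V : Finset (ℤ × ℤ)} {w τ : ℕ} {f : Biv F}

lemma IsCurve.dvd_of_order (hC : IsCurve V w τ f) {P : F × F} {η : PowerSeries F}
    (hP : IsBranch f P η) {j k : ℕ} (hj : 0 < j) {h : Biv F}
    (hh : h ∈ VS F (stripS V w j k : Set (ℤ × ℤ)))
    (hord : PowerSeries.X ^ (j * τ + k * w + 1) ∣ br P η h) : f ∣ h := by
  by_contra hfh
  have := hC.strip.order_count hC.nonneg hC.prime hC.mem hj hh hfh hC.area (ι := Unit)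
    (fun _ => P) (fun _ _ _ => rfl) (fun _ => ⟨hP.fst, hP.snd⟩)
    (fun _ => PowerSeries.C P.1 + PowerSeries.X) (fun _ => η) (by simp) (fun _ => hP.coeff)
    (fun _ => hP.root) (fun _ => j * τ + k * w + 1) (fun _ => Or.inr rfl) (fun _ => hord)
  simp at this

lemma IsCurve.dvd_of_eq_zero (hC : IsCurve V w τ f) {P : F × F} {η : PowerSeries F}
    (hP : IsBranch f P η) {g : Biv F} (h : br P η g = 0) : f ∣ g := by
  obtain ⟨c, j, k, hj, hs⟩ := hC.strip.exists_shift hC.nonneg (fun _ : Unit => g)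
  have h1 := hC.dvd_of_order hP hj (hs ()) (by rw [map_mul, h, mul_zero]; exact dvd_zero _)
  refine (hC.prime.dvd_or_dvd h1).resolve_left fun h2 => ?_
  have := hP.eq_zero_of_dvd h2
  exact (hP.isUnit_mono c 0).ne_zero this

/-- A family of functions with prescribed vanishing, independent modulo `f`. -/
lemma IsCurve.exists_family (hC : IsCurve V w τ f) (P : F × F) (η : PowerSeries F)
    {k o N : ℕ} (hN : N + o + 1 ≤ (stripS V w 1 0).card + k * w) :
    ∃ a : Fin N → Biv F, (∀ i, a i ∈ VS F (stripS V w 1 k : Set (ℤ × ℤ))) ∧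
      (∀ i, PowerSeries.X ^ o ∣ br P η (a i)) ∧ ∀ c : Fin N → F, f ∣ ∑ i, c i • a i → c = 0 := by
  classical
  set E := VS F (stripS V w 1 k : Set (ℤ × ℤ)) with hE
  set d := f.leadingCoeff.natDegree
  let L : Biv F →ₗ[F] (Fin o → F) × (Fin (k + 1) → F) :=
    { toFun := fun h => (fun i => PowerSeries.coeff i (br P η h), fun i => (h.coeff w).coeff (d + i))
      map_add' := by intro a b; ext <;> simp
      map_smul' := by intro c a; ext <;> simp }
  have h2 : Module.finrank F E = (stripS V w 1 0).card + k * (1 * w + 1) := by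
    rw [hE, finrank_VS _ (fun v hv => hC.strip.nonneg_of_mem_stripS hC.nonneg hv),
      hC.strip.card_stripS_add]
  have h3 : N + Module.finrank F ((Fin o → F) × (Fin (k + 1) → F)) ≤ Module.finrank F E := by
    have : k * (1 * w + 1) = k * w + k := by ring
    rw [h2, Module.finrank_prod, Module.finrank_fin_fun, Module.finrank_fin_fun]
    omega
  obtain ⟨a, haE, hker, ha⟩ := exists_linearIndependent_ker E L h3
  refine ⟨a, haE, fun i => ?_, fun c hc => ?_⟩
  · rw [PowerSeries.X_pow_dvd_iff]
    intro m hm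
    exact congrFun (congrArg Prod.fst (hker i)) ⟨m, hm⟩
  · set h : Biv F := ∑ i, c i • a i with hh
    have hmem : h ∈ E := Submodule.sum_mem _ fun i _ => Submodule.smul_mem _ _ (haE i)
    have hL : L h = 0 := by
      rw [hh, map_sum]
      simp only [map_smul, hker, smul_zero, Finset.sum_const_zero]
    have h0 : h = 0 := by
      by_contra hne
      obtain ⟨g, hg⟩ := hc
      have hg0 : g ≠ 0 := fun h => hne (by rw [hg, h, mul_zero])
      have hdeg : h.natDegree ≤ w := by
        rw [natDegree_le_iff_coeff_eq_zero]
        intro m hm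
        ext i
        by_contra hmi
        have h4 := hmem m i (by simpa using hmi)
        rw [Finset.mem_coe, mem_stripS] at h4
        have h5 := h4.2.1
        simp only [Nat.cast_one, one_mul] at h5
        omega
      rw [hg, natDegree_mul hC.prime.ne_zero hg0, hC.deg] at hdeg
      have hgC : g = C (g.coeff 0) := eq_C_of_natDegree_eq_zero (by omega)
      set g0 := g.coeff 0
      have hg00 : g0 ≠ 0 := fun h => hg0 (by rw [hgC, h, C_0])
      have hcw : h.coeff w = f.leadingCoeff * g0 := by
        rw [hg, hgC, coeff_mul_C, leadingCoeff, hC.deg]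
      have hlc : f.leadingCoeff ≠ 0 := leadingCoeff_ne_zero.2 hC.prime.ne_zero
      have hnd : (h.coeff w).natDegree = d + g0.natDegree := by
        rw [hcw, natDegree_mul hlc hg00]
      have hcne : (h.coeff w).coeff (d + g0.natDegree) ≠ 0 := by
        rw [← hnd, coeff_natDegree, leadingCoeff_ne_zero, hcw]
        exact mul_ne_zero hlc hg00
      have h4 := hmem w _ hcne
      rw [Finset.mem_coe, mem_stripS] at h4
      have h5 := h4.2.2.2
      simp only [Nat.cast_one, one_mul, div_one, Int.cast_natCast] at h5
      have h6 : ((d + g0.natDegree : ℕ) : ℝ) ≤ d + k := by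
        have := hC.top
        linarith
      have h7 : d + g0.natDegree ≤ d + k := by exact_mod_cast h6
      exact hcne (congrFun (congrArg Prod.snd hL) ⟨g0.natDegree, by omega⟩)
    exact funext fun i => Fintype.linearIndependent_iff.1 ha c h0 i

end Curve

section Derivation

variable {F : Type} [Field F]

/-- The partial derivative in `x`. -/
noncomputable def dX (h : Biv F) : Biv F := h.sum fun n a => monomial n (derivative a)

@[simp] lemma coeff_dX (h : Biv F) (n : ℕ) : (dX h).coeff n = derivative (h.coeff n) := by
  rw [dX, sum_def, finsetSum_coeff]
  simp only [coeff_monomial]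
  rw [Finset.sum_ite_eq']
  split_ifs with h1
  · rfl
  · rw [notMem_support_iff.1 h1, derivative_zero]

lemma dX_add (a b : Biv F) : dX (a + b) = dX a + dX b := by ext n; simp

lemma dX_smul (c : F) (a : Biv F) : dX (c • a) = c • dX a := by
  ext1 n
  rw [coeff_dX, coeff_smul, coeff_smul, coeff_dX, derivative_smul]

lemma dX_monomial (n : ℕ) (a : Polynomial F) : dX (monomial n a) = monomial n (derivative a) := by
  ext1 m
  rw [coeff_dX, coeff_monomial, coeff_monomial]
  split_ifs <;> simp

lemma derivative_brMap (ξ η : PowerSeries F) (g : Biv F) :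
    PowerSeries.derivative F (brMap ξ η g) =
      brMap ξ η (dX g) * PowerSeries.derivative F ξ +
        brMap ξ η (derivative g) * PowerSeries.derivative F η := by
  induction g using Polynomial.induction_on' with
  | add p q hp hq =>
    rw [map_add, map_add, hp, hq, dX_add, derivative_add, map_add, map_add]
    ring
  | monomial n a =>
    have e : ∀ n (a : Polynomial F), brMap ξ η (monomial n a) = aeval ξ a * η ^ n := by
      intro n a
      rw [← C_mul_X_pow_eq_monomial, map_mul, map_pow, brMap_C, brMap_Y]
    rw [dX_monomial, derivative_monomial, e, e, e, Derivation.leibniz, Derivation.leibniz_pow,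
      Derivation.map_aeval]
    simp only [smul_eq_mul, nsmul_eq_mul, map_mul, map_natCast]
    ring

/-- The derivation `x y (f_y ∂_x - f_x ∂_y)` along the curve `f = 0`. -/
noncomputable def curveD (f : Biv F) : Biv F →ₗ[F] Biv F where
  toFun h := (X * derivative f) * (C X * dX h) - (C X * dX f) * (X * derivative h)
  map_add' a b := by rw [dX_add, derivative_add]; ring
  map_smul' c a := by
    rw [dX_smul, derivative_smul, RingHom.id_apply, smul_sub]
    simp only [Algebra.mul_smul_comm]

lemma curveD_apply (f h : Biv F) : curveD f h =
    (X * derivative f) * (C X * dX h) - (C X * dX f) * (X * derivative h) := rfl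

lemma mul_dX_mem_VS {S : Set (ℤ × ℤ)} {h : Biv F} (hh : h ∈ VS F S) : C X * dX h ∈ VS F S := by
  intro m i hmi
  rw [coeff_C_mul, coeff_dX] at hmi
  refine hh m i fun h0 => hmi ?_
  rcases i with _ | i
  · simp
  · rw [coeff_X_mul, coeff_derivative, h0, zero_mul]

lemma mul_derivative_mem_VS {S : Set (ℤ × ℤ)} {h : Biv F} (hh : h ∈ VS F S) :
    X * derivative h ∈ VS F S := by
  intro m i hmi
  refine hh m i fun h0 => hmi ?_
  rcases m with _ | m
  · simp
  · rw [coeff_X_mul, coeff_derivative]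
    have : ((m : Polynomial F) + 1) = C ((m : F) + 1) := by simp
    rw [this, coeff_mul_C, h0, zero_mul]

variable {V : Finset (ℤ × ℤ)} {w τ : ℕ} {f : Biv F}

lemma IsCurve.curveD_mem (hC : IsCurve V w τ f) {j k : ℕ} {h : Biv F}
    (hh : h ∈ VS F (stripS V w j k : Set (ℤ × ℤ))) :
    curveD f h ∈ VS F (stripS V w (j + 1) k : Set (ℤ × ℤ)) := by
  rw [curveD_apply]
  refine Submodule.sub_mem _ ?_ ?_
  · have := hC.strip.mul_mem (mul_derivative_mem_VS hC.mem) (mul_dX_mem_VS hh)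
    rwa [add_comm 1 j, zero_add] at this
  · have := hC.strip.mul_mem (mul_dX_mem_VS hC.mem) (mul_derivative_mem_VS hh)
    rwa [add_comm 1 j, zero_add] at this

lemma IsCurve.curveD_iterate_mem (hC : IsCurve V w τ f) {j k : ℕ} {h : Biv F}
    (hh : h ∈ VS F (stripS V w j k : Set (ℤ × ℤ))) (l : ℕ) :
    (curveD f)^[l] h ∈ VS F (stripS V w (j + l) k : Set (ℤ × ℤ)) := by
  induction l with
  | zero => exact hh
  | succ l ih => rw [Function.iterate_succ_apply']; exact hC.curveD_mem ih

lemma IsBranch.br_curveD {P : F × F} {η : PowerSeries F} (hP : IsBranch f P η) (h : Biv F) :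
    br P η (curveD f h) =
      br P η (C X * X * derivative f) * PowerSeries.derivative F (br P η h) := by
  have h1 := derivative_brMap (PowerSeries.C P.1 + PowerSeries.X) η h
  have h2 := derivative_brMap (PowerSeries.C P.1 + PowerSeries.X) η f
  rw [hP.root] at h2
  simp only [map_add, map_zero, PowerSeries.derivative_C, PowerSeries.derivative_X, zero_add,
    mul_one] at h1 h2
  rw [curveD_apply]
  simp only [br, map_sub, map_mul] at *
  rw [h1]
  linear_combination (brMap (PowerSeries.C P.1 + PowerSeries.X) η (C X) *
    brMap (PowerSeries.C P.1 + PowerSeries.X) η X *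
    brMap (PowerSeries.C P.1 + PowerSeries.X) η (derivative h)) * h2

lemma PowerSeries.X_pow_dvd_derivative {n : ℕ} {u : PowerSeries F}
    (h : PowerSeries.X ^ n ∣ u) : PowerSeries.X ^ (n - 1) ∣ PowerSeries.derivative F u := by
  rw [PowerSeries.X_pow_dvd_iff] at *
  intro m hm
  rw [PowerSeries.coeff_derivative, h (m + 1) (by omega), zero_mul]

lemma IsBranch.dvd_curveD_iterate {P : F × F} {η : PowerSeries F} (hP : IsBranch f P η)
    {h : Biv F} {o : ℕ} (ho : PowerSeries.X ^ o ∣ br P η h) (l : ℕ) :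
    PowerSeries.X ^ (o - l) ∣ br P η ((curveD f)^[l] h) := by
  induction l with
  | zero => exact ho
  | succ l ih =>
    rw [Function.iterate_succ_apply', hP.br_curveD]
    exact (PowerSeries.X_pow_dvd_derivative ih).mul_left _

/-- A weighted derivation `v d/dt` lowers the order by one in small order. -/
lemma PowerSeries.constantCoeff_iterate_ne_zero {v : PowerSeries F}
    (hv : PowerSeries.constantCoeff v ≠ 0) (r : ℕ) : (∀ s : ℕ, 1 ≤ s → s ≤ r → (s : F) ≠ 0) →
    ∀ u : PowerSeries F, PowerSeries.X ^ r ∣ u → PowerSeries.coeff r u ≠ 0 →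
      PowerSeries.constantCoeff ((fun u => v * PowerSeries.derivative F u)^[r] u) ≠ 0 := by
  induction r with
  | zero => intro _ u _ hu; simpa using hu
  | succ r ih =>
    intro hs u hu hne
    rw [Function.iterate_succ_apply]
    refine ih (fun s h1 h2 => hs s h1 (by omega)) _
      ((PowerSeries.X_pow_dvd_derivative hu).mul_left _) ?_
    obtain ⟨c, hc⟩ := PowerSeries.X_pow_dvd_derivative hu
    have h1 : PowerSeries.coeff r (PowerSeries.derivative F u) ≠ 0 := by
      rw [PowerSeries.coeff_derivative]
      exact mul_ne_zero hne (by exact_mod_cast hs (r + 1) (by omega) le_rfl)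
    rw [hc] at h1 ⊢
    simp only [Nat.add_sub_cancel] at h1 ⊢
    rw [mul_left_comm]
    have e : ∀ g : PowerSeries F, PowerSeries.coeff r (PowerSeries.X ^ r * g) =
        PowerSeries.constantCoeff g := by
      intro g
      have := PowerSeries.coeff_X_pow_mul g r 0
      rw [zero_add] at this
      rw [this, PowerSeries.coeff_zero_eq_constantCoeff]
    rw [e] at h1 ⊢
    rw [map_mul]
    exact mul_ne_zero hv h1

lemma PowerSeries.dvd_of_iterate_eq_zero {v : PowerSeries F}
    (hv : PowerSeries.constantCoeff v ≠ 0) {m : ℕ} (hm : ∀ s : ℕ, 1 ≤ s → s < m → (s : F) ≠ 0)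
    {u : PowerSeries F} (h : ∀ l < m,
      PowerSeries.constantCoeff ((fun u => v * PowerSeries.derivative F u)^[l] u) = 0) :
    PowerSeries.X ^ m ∣ u := by
  have : ∀ r ≤ m, PowerSeries.X ^ r ∣ u := by
    intro r
    induction r with
    | zero => simp
    | succ r ih =>
      intro hr
      have h1 := ih (by omega)
      by_contra hcon
      refine PowerSeries.constantCoeff_iterate_ne_zero hv r
        (fun s hs1 hs2 => hm s hs1 (by omega)) u h1 ?_ (h r (by omega))
      intro h0
      apply hcon
      rw [PowerSeries.X_pow_dvd_iff] at *
      intro s hs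
      rcases Nat.lt_succ_iff_lt_or_eq.1 hs with h2 | rfl
      · exact h1 s h2
      · exact h0
  exact this m le_rfl

end Derivation

section Core

variable {F : Type} [Field F]

lemma PowerSeries.exists_factor_X_pow {ι : Type*} (u : ι → PowerSeries F) (h : ∃ i, u i ≠ 0) :
    ∃ (v : ℕ) (d : ι → PowerSeries F), (∀ i, u i = PowerSeries.X ^ v * d i) ∧
      ∃ i, PowerSeries.constantCoeff (d i) ≠ 0 := by
  classical
  have hex : ∃ v, ∃ i, PowerSeries.coeff v (u i) ≠ 0 := by
    obtain ⟨i, hi⟩ := h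
    by_contra! hcon
    exact hi (PowerSeries.ext fun n => by simpa using hcon n i)
  have hdvd : ∀ i, PowerSeries.X ^ Nat.find hex ∣ u i := by
    intro i
    rw [PowerSeries.X_pow_dvd_iff]
    intro m hm
    have := Nat.find_min hex hm
    push Not at this
    exact this i
  choose d hd using hdvd
  refine ⟨_, d, hd, ?_⟩
  obtain ⟨i, hi⟩ := Nat.find_spec hex
  refine ⟨i, ?_⟩
  have e := PowerSeries.coeff_X_pow_mul (d i) (Nat.find hex) 0
  rw [zero_add, ← hd i] at e
  rwa [e, PowerSeries.coeff_zero_eq_constantCoeff] at hi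

lemma PowerSeries.X_pow_dvd_pow_sub {p : ℕ} [Fact p.Prime] [CharP F p] (ν : ℕ)
    (u : PowerSeries F) : PowerSeries.X ^ p ^ ν ∣
      u ^ p ^ ν - PowerSeries.C (PowerSeries.constantCoeff u ^ p ^ ν) := by
  have : CharP (PowerSeries F) p := charP_of_injective_ringHom
    (PowerSeries.C_injective (R := F)) p
  rw [map_pow, ← sub_pow_char_pow]
  refine pow_dvd_pow_of_dvd ?_ _
  rw [PowerSeries.X_dvd_iff]
  simp

/-- The zeros of `f` in the torus. -/
noncomputable def torusZeros [Fintype F] (f : Biv F) : Finset (F × F) := by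
  classical
  exact Finset.univ.filter fun P => P.1 ≠ 0 ∧ P.2 ≠ 0 ∧ f.evalEval P.1 P.2 = 0

lemma mem_torusZeros [Fintype F] {f : Biv F} {P : F × F} :
    P ∈ torusZeros f ↔ P.1 ≠ 0 ∧ P.2 ≠ 0 ∧ f.evalEval P.1 P.2 = 0 := by
  simp [torusZeros]

lemma brMap_const (x y : F) (g : Biv F) :
    brMap (PowerSeries.C x) (PowerSeries.C y) g = PowerSeries.C (g.evalEval x y) := by
  have : (brMap (PowerSeries.C x) (PowerSeries.C y) : Biv F →ₐ[F] PowerSeries F).toRingHom =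
      (PowerSeries.C (R := F)).comp (evalEvalRingHom x y) := by
    refine Polynomial.ringHom_ext' (Polynomial.ringHom_ext ?_ ?_) ?_
    · intro a
      simp
    · simp
    · simp
  exact congrArg (fun φ => φ g) this

variable {V : Finset (ℤ × ℤ)} {w τ : ℕ} {f : Biv F}

lemma IsCurve.not_dvd_derivative (hC : IsCurve V w τ f) (hder : derivative f ≠ 0) :
    ¬ f ∣ derivative f := by
  intro h
  have h1 := natDegree_le_of_dvd h hder
  have h2 := natDegree_derivative_lt (p := f) (by rw [hC.deg]; exact hC.strip.pos.ne')
  omega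

lemma IsCurve.card_singular_le [Fintype F] (hC : IsCurve V w τ f) (hder : derivative f ≠ 0)
    {s : Finset (F × F)} (hs : s ⊆ torusZeros f)
    (hs' : ∀ P ∈ s, (derivative f).evalEval P.1 P.2 = 0) : s.card ≤ τ := by
  rcases s.eq_empty_or_nonempty with rfl | ⟨P, hP⟩
  · simp
  have hP1 := mem_torusZeros.1 (hs hP)
  have hX : ¬ f ∣ X * derivative f := by
    intro h
    rcases hC.prime.dvd_or_dvd h with ⟨c, hc⟩ | h
    · have := congrArg (evalEval P.1 P.2) hc
      rw [evalEval_mul, hP1.2.2, zero_mul, evalEval_X] at this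
      exact hP1.2.1 this
    · exact hC.not_dvd_derivative hder h
  have := hC.strip.order_count hC.nonneg hC.prime hC.mem one_pos
    (mul_derivative_mem_VS hC.mem) hX hC.area (ι := s)
    (fun P => P.1) Subtype.val_injective (fun P => ⟨(mem_torusZeros.1 (hs P.2)).1,
      (mem_torusZeros.1 (hs P.2)).2.1⟩)
    (fun P => PowerSeries.C P.1.1) (fun P => PowerSeries.C P.1.2) (by simp) (by simp)
    (fun P => by rw [brMap_const, (mem_torusZeros.1 (hs P.2)).2.2, map_zero]) (fun _ => 1)
    (fun _ => Or.inl le_rfl) (fun P => by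
      rw [brMap_const, evalEval_mul, hs' P.1 P.2, mul_zero, map_zero]; exact dvd_zero _)
  simpa using this

lemma IsBranch.iterate_br {P : F × F} {η : PowerSeries F} (hP : IsBranch f P η) (h : Biv F)
    (l : ℕ) : (fun u => br P η (C X * X * derivative f) * PowerSeries.derivative F u)^[l]
      (br P η h) = br P η ((curveD f)^[l] h) := by
  induction l with
  | zero => rfl
  | succ l ih => rw [Function.iterate_succ_apply', Function.iterate_succ_apply', ih, hP.br_curveD]

lemma curveD_iterate_sum {ι : Type*} (s : Finset ι) (c : ι → F) (a : ι → Biv F) (l : ℕ) :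
    (curveD f)^[l] (∑ i ∈ s, c i • a i) = ∑ i ∈ s, c i • (curveD f)^[l] (a i) := by
  rw [← Module.End.pow_apply, map_sum]
  simp only [map_smul, Module.End.pow_apply]

/-- The auxiliary function does not vanish on the curve. -/
lemma IsCurve.not_dvd_aux (hC : IsCurve V w τ f) {p ν : ℕ} [Fact p.Prime] [CharP F p]
    {P₀ : F × F} {η₀ : PowerSeries F} (hP₀ : IsBranch f P₀ η₀) {k α A : ℕ}
    (hαk : α ≤ τ + k * w) (hα : α < p ^ ν) {a c : Fin A → Biv F}
    (ha : ∀ i, a i ∈ VS F (stripS V w 1 k : Set (ℤ × ℤ)))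
    (hao : ∀ i, PowerSeries.X ^ (τ + k * w - α) ∣ br P₀ η₀ (a i))
    (hai : ∀ x : Fin A → F, f ∣ ∑ i, x i • a i → x = 0) (hc : ∃ i, ¬ f ∣ c i) :
    ¬ f ∣ ∑ i, a i * c i ^ p ^ ν := by
  intro hH
  have h0 := hP₀.eq_zero_of_dvd hH
  obtain ⟨v, d, hd, i₀, hi₀⟩ := PowerSeries.exists_factor_X_pow (fun i => br P₀ η₀ (c i))
    (hc.imp fun i hi h => hi (hC.dvd_of_eq_zero hP₀ h))
  have h1 : ∑ i, br P₀ η₀ (a i) * d i ^ p ^ ν = 0 := by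
    have h2 : PowerSeries.X ^ (v * p ^ ν) * ∑ i, br P₀ η₀ (a i) * d i ^ p ^ ν = 0 := by
      rw [map_sum] at h0
      rw [← h0, Finset.mul_sum]
      refine Finset.sum_congr rfl fun i _ => ?_
      rw [map_mul, map_pow, hd i, mul_pow, pow_mul]
      ring
    exact (mul_eq_zero.1 h2).resolve_left (pow_ne_zero _ PowerSeries.X_ne_zero)
  set δ : Fin A → F := fun i => PowerSeries.constantCoeff (d i) ^ p ^ ν with hδ
  have h3 : PowerSeries.X ^ (1 * τ + k * w + 1) ∣ br P₀ η₀ (∑ i, δ i • a i) := by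
    have h4 : br P₀ η₀ (∑ i, δ i • a i) =
        -∑ i, br P₀ η₀ (a i) * (d i ^ p ^ ν - PowerSeries.C (δ i)) := by
      simp only [mul_sub, Finset.sum_sub_distrib, h1, map_sum, map_smul]
      rw [zero_sub, neg_neg]
      refine Finset.sum_congr rfl fun i _ => ?_
      rw [PowerSeries.smul_eq_C_mul, mul_comm]
    rw [h4, dvd_neg]
    refine Finset.dvd_sum fun i _ => ?_
    refine (pow_dvd_pow _ ?_).trans
      ((pow_add PowerSeries.X (τ + k * w - α) (p ^ ν)).dvd.trans
        (mul_dvd_mul (hao i) (PowerSeries.X_pow_dvd_pow_sub ν (d i))))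
    omega
  have h5 := hai δ (hC.dvd_of_order hP₀ one_pos
    (Submodule.sum_mem _ fun i _ => Submodule.smul_mem _ _ (ha i)) h3)
  exact pow_ne_zero _ hi₀ (congrFun h5 i₀)

/-- The auxiliary function vanishes to order `m` at the rational points with a branch. -/
lemma IsBranch.dvd_aux [Fintype F] {p μ ν : ℕ} [Fact p.Prime] [CharP F p]
    (hq : Fintype.card F = p ^ μ * p ^ ν) {P : F × F} {η : PowerSeries F} (hP : IsBranch f P η)
    (hder : (derivative f).evalEval P.1 P.2 ≠ 0) {m A : ℕ} (hm : ∀ s : ℕ, 1 ≤ s → s < m → (s : F) ≠ 0)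
    (hmν : m ≤ p ^ ν) {a c : Fin A → Biv F}
    (hvan : ∀ l < m, f ∣ ∑ i, ((curveD f)^[l] (a i)) ^ p ^ μ * c i) :
    PowerSeries.X ^ m ∣ br P η (∑ i, a i * c i ^ p ^ ν) := by
  set κ : Fin A → F := fun i => (c i).evalEval P.1 P.2 ^ p ^ ν with hκ
  have h1 : br P η (∑ i, a i * c i ^ p ^ ν) = br P η (∑ i, κ i • a i) +
      ∑ i, br P η (a i) * (br P η (c i) ^ p ^ ν - PowerSeries.C (κ i)) := by
    simp only [map_sum, map_smul, map_mul, map_pow, mul_sub, Finset.sum_sub_distrib]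
    have : ∀ i, κ i • br P η (a i) = br P η (a i) * PowerSeries.C (κ i) := fun i => by
      rw [PowerSeries.smul_eq_C_mul, mul_comm]
    simp only [this]
    ring
  rw [h1]
  refine dvd_add ?_ (Finset.dvd_sum fun i _ => Dvd.dvd.mul_left ?_ _)
  · refine PowerSeries.dvd_of_iterate_eq_zero
      (v := br P η (C X * X * derivative f)) ?_ hm fun l hl => ?_
    · rw [hP.constantCoeff, evalEval_mul, evalEval_mul, evalEval_X]
      refine mul_ne_zero (mul_ne_zero ?_ hP.snd) hder
      simpa [evalEval] using hP.fst
    · rw [hP.iterate_br, hP.constantCoeff, curveD_iterate_sum]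
      obtain ⟨r, hr⟩ := hvan l hl
      have h2 := congrArg (evalEval P.1 P.2) hr
      have hf0 : f.evalEval P.1 P.2 = 0 := by
        rw [← hP.constantCoeff, br, hP.root, map_zero]
      have hsmul : ∀ (x : F) (g : Biv F),
          (x • g).evalEval P.1 P.2 = x * g.evalEval P.1 P.2 := by
        intro x g
        rw [← hP.constantCoeff, map_smul, ← hP.constantCoeff]
        simp
      rw [evalEval_mul, hf0, zero_mul, evalEval_finsetSum] at h2
      have h3 : (∑ i, κ i * ((curveD f)^[l] (a i)).evalEval P.1 P.2) ^ p ^ μ = 0 := by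
        rw [sum_pow_char_pow, ← h2]
        refine Finset.sum_congr rfl fun i _ => ?_
        rw [mul_pow, hκ, ← pow_mul, mul_comm (p ^ ν), ← hq, FiniteField.pow_card, evalEval_mul,
          evalEval_pow, mul_comm]
      rw [evalEval_finsetSum]
      simp only [hsmul]
      exact eq_zero_of_pow_eq_zero h3
  · have h2 := PowerSeries.X_pow_dvd_pow_sub (p := p) ν (br P η (c i))
    rw [hP.constantCoeff] at h2
    exact (pow_dvd_pow _ hmν).trans h2

theorem IsCurve.stepanov_core [Fintype F] (hC : IsCurve V w τ f) (hder : derivative f ≠ 0)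
    {p μ ν : ℕ} [Fact p.Prime] [CharP F p] (hq : Fintype.card F = p ^ μ * p ^ ν)
    {P₀ : F × F} {η₀ : PowerSeries F} (hP₀ : IsBranch f P₀ η₀) {k α β m A B : ℕ}
    (hαk : α ≤ τ + k * w) (hβk : β ≤ τ + k * w) (hα : α < p ^ ν) (hm0 : 1 ≤ m)
    (hm : ∀ s : ℕ, 1 ≤ s → s < m → (s : F) ≠ 0) (hmν : m ≤ p ^ ν)
    {a : Fin A → Biv F} {b : Fin B → Biv F}
    (ha : ∀ i, a i ∈ VS F (stripS V w 1 k : Set (ℤ × ℤ)))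
    (hb : ∀ i, b i ∈ VS F (stripS V w 1 k : Set (ℤ × ℤ)))
    (hao : ∀ i, PowerSeries.X ^ (τ + k * w - α) ∣ br P₀ η₀ (a i))
    (hbo : ∀ i, PowerSeries.X ^ (τ + k * w - β) ∣ br P₀ η₀ (b i))
    (hai : ∀ x : Fin A → F, f ∣ ∑ i, x i • a i → x = 0)
    (hbi : ∀ x : Fin B → F, f ∣ ∑ i, x i • b i → x = 0)
    {γ : Fin A → Fin B → F} (hγ : γ ≠ 0)
    (hvan : ∀ l < m, f ∣ ∑ i, ((curveD f)^[l] (a i)) ^ p ^ μ * ∑ j, γ i j • b j) :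
    m * (torusZeros f).card ≤ m + α + p ^ ν * β + (m - 1) * τ := by
  classical
  set c : Fin A → Biv F := fun i => ∑ j, γ i j • b j with hc
  set H := ∑ i, a i * c i ^ p ^ ν with hH
  have hcm : ∀ i, c i ∈ VS F (stripS V w 1 k : Set (ℤ × ℤ)) := fun i =>
    Submodule.sum_mem _ fun j _ => Submodule.smul_mem _ _ (hb j)
  have hHm : H ∈ VS F (stripS V w (1 + p ^ ν * 1) (k + p ^ ν * k) : Set (ℤ × ℤ)) :=
    Submodule.sum_mem _ fun i _ => hC.strip.mul_mem (ha i) (hC.strip.pow_mem (hcm i) _)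
  have hfH : ¬ f ∣ H := by
    refine hC.not_dvd_aux hP₀ hαk hα ha hao hai ?_
    by_contra! hcon
    exact hγ (funext fun i => hbi _ (hcon i))
  have hco : ∀ i, PowerSeries.X ^ (τ + k * w - β) ∣ br P₀ η₀ (c i) := by
    intro i
    rw [hc, map_sum]
    refine Finset.dvd_sum fun j _ => ?_
    rw [map_smul, PowerSeries.smul_eq_C_mul]
    exact (hbo j).mul_left _
  set M₀ := (τ + k * w - α) + p ^ ν * (τ + k * w - β) with hM₀
  have hH0 : PowerSeries.X ^ M₀ ∣ br P₀ η₀ H := by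
    rw [hH, map_sum]
    refine Finset.dvd_sum fun i _ => ?_
    rw [map_mul, map_pow, hM₀, pow_add, mul_comm (p ^ ν), pow_mul]
    exact mul_dvd_mul (hao i) (pow_dvd_pow_of_dvd (hco i) _)
  have hP₀Z : P₀ ∈ torusZeros f := mem_torusZeros.2 ⟨hP₀.fst, hP₀.snd, by
    rw [← hP₀.constantCoeff, br, hP₀.root, map_zero]⟩
  have hex : ∀ P : torusZeros f, ∃ (ξ η : PowerSeries F) (o : ℕ),
      PowerSeries.constantCoeff ξ = P.1.1 ∧ PowerSeries.constantCoeff η = P.1.2 ∧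
      brMap ξ η f = 0 ∧ (o ≤ 1 ∨ ξ = PowerSeries.C P.1.1 + PowerSeries.X) ∧
      PowerSeries.X ^ o ∣ brMap ξ η H ∧
      o = if P.1 = P₀ then M₀ else if (derivative f).evalEval P.1.1 P.1.2 = 0 then 1 else m := by
    intro P
    have hPZ := mem_torusZeros.1 P.2
    by_cases h0 : P.1 = P₀
    · rw [h0]
      refine ⟨PowerSeries.C P₀.1 + PowerSeries.X, η₀, M₀, by simp, hP₀.coeff, hP₀.root,
        Or.inr rfl, hH0, by simp⟩
    by_cases h1 : (derivative f).evalEval P.1.1 P.1.2 = 0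
    · refine ⟨PowerSeries.C P.1.1, PowerSeries.C P.1.2, 1, by simp, by simp, ?_, Or.inl le_rfl,
        ?_, by simp [h0, h1]⟩
      · rw [brMap_const, hPZ.2.2, map_zero]
      · have hcc : H.evalEval P.1.1 P.1.2 = 0 := by
          obtain ⟨r, hr⟩ := hvan 0 hm0
          have h2 := congrArg (evalEval P.1.1 P.1.2) hr
          rw [evalEval_mul, hPZ.2.2, zero_mul, evalEval_finsetSum] at h2
          have h3 : (H.evalEval P.1.1 P.1.2) ^ p ^ μ = 0 := by
            rw [hH, evalEval_finsetSum, sum_pow_char_pow, ← h2]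
            refine Finset.sum_congr rfl fun i _ => ?_
            rw [evalEval_mul, evalEval_pow, evalEval_mul, mul_pow, ← pow_mul, mul_comm (p ^ ν),
              ← hq, FiniteField.pow_card, evalEval_pow]
            rfl
          exact eq_zero_of_pow_eq_zero h3
        rw [brMap_const, hcc, map_zero]
        exact dvd_zero _
    · obtain ⟨η, hη, hr⟩ := exists_branch hPZ.2.2 h1
      have hB : IsBranch f P.1 η := ⟨hPZ.1, hPZ.2.1, hη, hr⟩
      refine ⟨_, η, m, by simp, hη, hr, Or.inr rfl, hB.dvd_aux hq h1 hm hmν hvan, by simp [h0, h1]⟩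
  choose ξ η o hξ hη hbr ho hdvd hoe using hex
  have key := hC.strip.order_count hC.nonneg hC.prime hC.mem (by omega) hHm hfH hC.area
    (fun P : torusZeros f => P.1) Subtype.val_injective
    (fun P => ⟨(mem_torusZeros.1 P.2).1, (mem_torusZeros.1 P.2).2.1⟩) ξ η hξ hη hbr o ho hdvd
  simp only [hoe] at key
  rw [Finset.sum_coe_sort (torusZeros f) (fun P => if P = P₀ then M₀ else
    if (derivative f).evalEval P.1 P.2 = 0 then 1 else m)] at key
  rw [← Finset.add_sum_erase _ _ hP₀Z, if_pos rfl] at key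
  set T := (torusZeros f).erase P₀ with hT
  have hcard : (torusZeros f).card = T.card + 1 := by
    rw [hT, Finset.card_erase_add_one hP₀Z]
  have hbad : (T.filter fun P => (derivative f).evalEval P.1 P.2 = 0).card ≤ τ :=
    hC.card_singular_le hder ((Finset.filter_subset _ _).trans (Finset.erase_subset _ _))
      (fun P hP => (Finset.mem_filter.1 hP).2)
  have h4 : m * T.card ≤ (∑ P ∈ T, if P = P₀ then M₀ else
      if (derivative f).evalEval P.1 P.2 = 0 then 1 else m) + (m - 1) * τ := by
    have h5 : m * T.card ≤ ∑ P ∈ T, ((if P = P₀ then M₀ else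
        if (derivative f).evalEval P.1 P.2 = 0 then 1 else m) +
          if (derivative f).evalEval P.1 P.2 = 0 then m - 1 else 0) := by
      rw [mul_comm, ← smul_eq_mul]
      refine Finset.card_nsmul_le_sum _ _ _ fun P hP => ?_
      rw [if_neg (Finset.ne_of_mem_erase hP)]
      split_ifs <;> omega
    rw [Finset.sum_add_distrib, ← Finset.sum_filter, Finset.sum_const, smul_eq_mul,
      mul_comm _ (m - 1)] at h5
    exact h5.trans (Nat.add_le_add_left (Nat.mul_le_mul_left _ hbad) _)
  rw [hcard]
  have e1 : p ^ ν * (τ + k * w - β) + p ^ ν * β = p ^ ν * (τ + k * w) := by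
    rw [← mul_add, Nat.sub_add_cancel hβk]
  have e2 : (1 + p ^ ν * 1) * τ + (k + p ^ ν * k) * w = (τ + k * w) + p ^ ν * (τ + k * w) := by
    ring
  rw [mul_add, mul_one]
  omega

end Core

section Bounds

variable {F : Type} [Field F] {V : Finset (ℤ × ℤ)} {w τ : ℕ} {f : Biv F}

lemma IsCurve.exists_relation (hC : IsCurve V w τ f) {P₀ : F × F} {η₀ : PowerSeries F}
    (hP₀ : IsBranch f P₀ η₀) {k α β m e A B : ℕ} (hαk : α + m ≤ τ + k * w)
    (hβk : β ≤ τ + k * w) {a : Fin A → Biv F} {b : Fin B → Biv F}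
    (ha : ∀ i, a i ∈ VS F (stripS V w 1 k : Set (ℤ × ℤ)))
    (hb : ∀ i, b i ∈ VS F (stripS V w 1 k : Set (ℤ × ℤ)))
    (hao : ∀ i, PowerSeries.X ^ (τ + k * w - α) ∣ br P₀ η₀ (a i))
    (hbo : ∀ i, PowerSeries.X ^ (τ + k * w - β) ∣ br P₀ η₀ (b i))
    (hAB : ∑ l ∈ Finset.range m, (e * (α + l * (τ + 1)) + β + 1) < A * B) :
    ∃ γ : Fin A → Fin B → F, γ ≠ 0 ∧
      ∀ l < m, f ∣ ∑ i, ((curveD f)^[l] (a i)) ^ e * ∑ j, γ i j • b j := by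
  let n : ℕ → ℕ := fun l => e * (α + l * (τ + 1)) + β + 1
  let O : ℕ → ℕ := fun l => e * (τ + k * w - α - l) + (τ + k * w - β)
  let G : ℕ → (Fin A → Fin B → F) →ₗ[F] Biv F := fun l =>
    { toFun := fun γ => ∑ i, ((curveD f)^[l] (a i)) ^ e * ∑ j, γ i j • b j
      map_add' := fun x y => by
        simp only [Pi.add_apply, add_smul, Finset.sum_add_distrib, mul_add]
      map_smul' := fun c x => by
        simp only [Pi.smul_apply, smul_eq_mul, mul_smul, ← Finset.smul_sum, RingHom.id_apply,
          Algebra.mul_smul_comm] }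
  let Φ : (Fin A → Fin B → F) →ₗ[F] ((Σ l : Fin m, Fin (n l)) → F) :=
    LinearMap.pi fun z => (PowerSeries.coeff (O z.1 + z.2) : PowerSeries F →ₗ[F] F).comp
      ((br P₀ η₀).toLinearMap.comp (G z.1))
  have hker : LinearMap.ker Φ ≠ ⊥ := by
    refine LinearMap.ker_ne_bot_of_finrank_lt ?_
    rw [Module.finrank_fintype_fun_eq_card, Module.finrank_pi_fintype]
    simp only [Module.finrank_fintype_fun_eq_card, Fintype.card_sigma, Fintype.card_fin,
      Finset.sum_const, Finset.card_univ, smul_eq_mul]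
    rw [Fin.sum_univ_eq_sum_range (fun l => n l) m]
    exact hAB
  obtain ⟨γ, hγ, hγ0⟩ := (Submodule.ne_bot_iff _).1 hker
  refine ⟨γ, hγ0, fun l hl => ?_⟩
  have hmem : G l γ ∈ VS F (stripS V w (e * (1 + l) + 1) (e * k + k) : Set (ℤ × ℤ)) := by
    change ∑ i, ((curveD f)^[l] (a i)) ^ e * ∑ j, γ i j • b j ∈ _
    exact Submodule.sum_mem _ fun i _ => hC.strip.mul_mem
      (hC.strip.pow_mem (hC.curveD_iterate_mem (ha i) l) e)
      (Submodule.sum_mem _ fun j _ => Submodule.smul_mem _ _ (hb j))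
  refine hC.dvd_of_order hP₀ (by omega) hmem ?_
  have hO : PowerSeries.X ^ O l ∣ br P₀ η₀ (G l γ) := by
    change _ ∣ br P₀ η₀ (∑ i, ((curveD f)^[l] (a i)) ^ e * ∑ j, γ i j • b j)
    rw [map_sum]
    refine Finset.dvd_sum fun i _ => ?_
    rw [map_mul, map_pow, pow_add, mul_comm e, pow_mul]
    refine mul_dvd_mul (pow_dvd_pow_of_dvd (hP₀.dvd_curveD_iterate (hao i) l) _) ?_
    rw [map_sum]
    refine Finset.dvd_sum fun j _ => ?_
    rw [map_smul, PowerSeries.smul_eq_C_mul]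
    exact (hbo j).mul_left _
  have hle : (e * (1 + l) + 1) * τ + (e * k + k) * w + 1 = O l + n l := by
    have h1 : e * (τ + k * w - α - l) + e * (α + l) = e * (τ + k * w) := by
      rw [← mul_add]
      congr 1
      omega
    have h2 : e * (α + l * (τ + 1)) = e * (α + l) + e * (l * τ) := by ring
    have h3 : (e * (1 + l) + 1) * τ + (e * k + k) * w =
      e * (τ + k * w) + e * (l * τ) + (τ + k * w) := by ring
    simp only [O, n]
    omega
  rw [PowerSeries.X_pow_dvd_iff] at hO ⊢
  intro r hr
  rw [hle] at hr
  by_cases hrO : r < O l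
  · exact hO r hrO
  · have := congrFun (LinearMap.mem_ker.1 hγ) ⟨⟨l, hl⟩, ⟨r - O l, by simp only; omega⟩⟩
    simp only [Φ, LinearMap.pi_apply, LinearMap.comp_apply, Pi.zero_apply] at this
    rw [Nat.add_sub_cancel' (by omega)] at this
    exact this

theorem IsCurve.card_le_or_branch [Fintype F] (hC : IsCurve V w τ f) (hder : derivative f ≠ 0) :
    (torusZeros f).card ≤ τ ∨ ∃ P η, IsBranch f P η := by
  by_cases h : ∃ P ∈ torusZeros f, (derivative f).evalEval P.1 P.2 ≠ 0
  · obtain ⟨P, hP, hd⟩ := h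
    have hPZ := mem_torusZeros.1 hP
    obtain ⟨η, hη, hr⟩ := exists_branch hPZ.2.2 hd
    exact Or.inr ⟨P, η, hPZ.1, hPZ.2.1, hη, hr⟩
  · push Not at h
    exact Or.inl (hC.card_singular_le hder subset_rfl h)

/-- Stepanov's bound with parameters. -/
theorem IsCurve.stepanov [Fintype F] (hC : IsCurve V w τ f) (hder : derivative f ≠ 0)
    {p μ ν : ℕ} [Fact p.Prime] [CharP F p] (hq : Fintype.card F = p ^ μ * p ^ ν) {g : ℕ}
    (hg : τ + 2 ≤ g + (stripS V w 1 0).card) {α β m : ℕ} (hα : α < p ^ ν) (hm0 : 1 ≤ m)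
    (hm : m ≤ p) (hmν : m ≤ p ^ ν)
    (hAB : ∑ l ∈ Finset.range m, (p ^ μ * (α + l * (τ + 1)) + β + 1) <
      (α + 1 - g) * (β + 1 - g)) :
    (torusZeros f).card ≤ τ ∨
      m * (torusZeros f).card ≤ m + α + p ^ ν * β + (m - 1) * τ := by
  refine (hC.card_le_or_branch hder).imp_right ?_
  rintro ⟨P₀, η₀, hP₀⟩
  have hw := hC.strip.pos
  set k := α + β + m with hk
  have hkw : k ≤ k * w := Nat.le_mul_of_pos_right _ hw
  have hA : g ≤ α := by
    by_contra hcon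
    rw [show α + 1 - g = 0 by omega, zero_mul] at hAB
    omega
  have hB : g ≤ β := by
    by_contra hcon
    rw [show β + 1 - g = 0 by omega, mul_zero] at hAB
    omega
  obtain ⟨a, ha, hao, hai⟩ := hC.exists_family P₀ η₀ (k := k) (o := τ + k * w - α)
    (N := α + 1 - g) (by omega)
  obtain ⟨b, hb, hbo, hbi⟩ := hC.exists_family P₀ η₀ (k := k) (o := τ + k * w - β)
    (N := β + 1 - g) (by omega)
  obtain ⟨γ, hγ, hvan⟩ := hC.exists_relation hP₀ (by omega) (by omega) ha hb hao hbo hAB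
  refine hC.stepanov_core hder hq hP₀ (by omega) (by omega) hα hm0 (fun s h1 h2 h0 => ?_) hmν
    ha hb hao hbo hai hbi hγ hvan
  have := Nat.le_of_dvd (by omega) ((CharP.cast_eq_zero_iff F p s).1 h0)
  omega

/-- The bound from a pencil of functions. -/
theorem IsCurve.pencil [Fintype F] (hC : IsCurve V w τ f) (hder : derivative f ≠ 0) {g : ℕ}
    (hg : τ + 2 ≤ g + (stripS V w 1 0).card) (hgq : g + 1 < Fintype.card F) :
    (torusZeros f).card ≤ τ ∨
      (torusZeros f).card ≤ 1 + (Fintype.card F + 1) * (g + 1) := by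
  refine (hC.card_le_or_branch hder).imp_right ?_
  rintro ⟨P₀, η₀, hP₀⟩
  obtain ⟨p, hchar⟩ := CharP.exists F
  obtain ⟨r, hp, hr⟩ := FiniteField.card F p
  have : Fact p.Prime := ⟨hp⟩
  have hw := hC.strip.pos
  obtain ⟨k, hk⟩ : ∃ k, k = g + 1 := ⟨_, rfl⟩
  have hkw : k ≤ k * w := Nat.le_mul_of_pos_right _ hw
  obtain ⟨a, ha, hao, hai⟩ := hC.exists_family P₀ η₀ (k := k) (o := τ + k * w - (g + 1))
    (N := 2) (by omega)
  have h1 := hC.stepanov_core hder (μ := 0) (ν := r) (m := 1) (p := p) (by rw [pow_zero, one_mul, hr])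
    hP₀ (k := k) (α := g + 1) (β := g + 1) (by omega) (by omega) (by rw [← hr]; exact hgq) le_rfl
    (fun s h1 h2 => by omega) (by rw [← hr]; omega) ha ha hao hao hai hai
    (γ := ![![0, 1], ![-1, 0]]) (fun h => by simpa using congrFun (congrFun h 0) 1) (by
      intro l hl
      obtain rfl : l = 0 := by omega
      convert dvd_zero f using 1
      simp [Fin.sum_univ_two]
      ring)
  rw [← hr] at h1
  have : (Fintype.card F + 1) * (g + 1) = Fintype.card F * (g + 1) + (g + 1) := by ring
  omega

end Bounds

section Arith

lemma sum_range_arith (e α β t k : ℕ) :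
    2 * ∑ l ∈ Finset.range (k + 1), (e * (α + l * t) + β + 1) =
      2 * (k + 1) * (e * α + β + 1) + e * t * (k + 1) * k := by
  induction k with
  | zero => simp
  | succ k ih => rw [Finset.sum_range_succ, mul_add, ih]; ring

/-- The family of bounds for the number `N` of zeros furnished by Stepanov's method on a curve with
invariants `g` and `τ` over a field with `q` elements of characteristic `p`. -/
def StepanovBound (p q g τ N : ℕ) : Prop :=
  ∀ μ ν α β m : ℕ, q = p ^ μ * p ^ ν → α < p ^ ν → 1 ≤ m → m ≤ p → m ≤ p ^ ν →
    ∑ l ∈ Finset.range m, (p ^ μ * (α + l * (τ + 1)) + β + 1) < (α + 1 - g) * (β + 1 - g) →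
    N ≤ τ ∨ m * N ≤ m + α + p ^ ν * β + (m - 1) * τ

variable {p q g n τ N L : ℕ}

lemma StepanovBound.prime_two (h : StepanovBound q q g τ N) (hg : 1 ≤ g)
    (hqg : (4 * g + 3) ^ 2 ≤ q) (hτ : τ ≤ g + 7) : N ≤ τ ∨ N ≤ 2 * (q - 1) := by
  obtain ⟨k, rfl⟩ : ∃ k, g = k + 1 := ⟨g - 1, by omega⟩
  refine (h 0 1 (2 * k * k + 30 * k + 18) (4 * k + 3) (2 * k + 1 + 1) (by simp) ?_ (by omega)
    ?_ ?_ ?_).imp_right fun h1 => ?_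
  · rw [pow_one]; nlinarith
  · nlinarith
  · nlinarith
  · have h2 := sum_range_arith (q ^ 0) (2 * k * k + 30 * k + 18) (4 * k + 3) (τ + 1) (2 * k + 1)
    have e1 : 4 * k + 3 + 1 - (k + 1) = 3 * k + 3 := by omega
    have e2 : 2 * k * k + 30 * k + 18 + 1 - (k + 1) = 2 * k * k + 29 * k + 18 := by omega
    rw [e1, e2]
    have e3 : q ^ 0 * (τ + 1) * (2 * k + 1 + 1) * (2 * k + 1) ≤
        (k + 9) * (2 * k + 1 + 1) * (2 * k + 1) := by
      rw [pow_zero, one_mul]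
      exact Nat.mul_le_mul_right _ (Nat.mul_le_mul_right _ (by omega))
    have e4 : 2 * (2 * k + 1 + 1) * (q ^ 0 * (2 * k * k + 30 * k + 18) + (4 * k + 3) + 1) +
        (k + 9) * (2 * k + 1 + 1) * (2 * k + 1) <
          2 * ((2 * k * k + 29 * k + 18) * (3 * k + 3)) := by
      rw [pow_zero, one_mul]
      nlinarith
    omega
  · rw [pow_one] at h1
    have h3 : (2 * k + 2) * N ≤ (2 * k + 2) * (2 * (q - 1)) := by
      have e5 : (2 * k + 1 + 1 - 1) * τ ≤ (2 * k + 1) * (k + 8) := by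
        rw [Nat.add_sub_cancel]
        exact Nat.mul_le_mul_left _ (by omega)
      obtain ⟨q', rfl⟩ : ∃ q', q = q' + 1 :=
        ⟨q - 1, (Nat.sub_add_cancel (show 1 ≤ q by nlinarith)).symm⟩
      rw [Nat.add_sub_cancel]
      nlinarith
    exact Nat.le_of_mul_le_mul_left h3 (by omega)

lemma StepanovBound.prime (h : StepanovBound q q g τ N)
    (hqg : (4 * g + 3) ^ 2 ≤ q) (hL : 3 ≤ L) (hLg : L ≤ g + 1) (hτ : τ + 2 ≤ g + (L + 1) ^ 2) :
    N ≤ τ ∨ N ≤ L * (q - 1) := by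
  obtain ⟨d, hd⟩ : ∃ d, 2 * L = d + 3 := ⟨2 * L - 3, by omega⟩
  have hg : 2 ≤ g := by omega
  -- the number of derivatives is `k + 1`
  obtain ⟨k, hk1, hk2⟩ : ∃ k, 4 * g ≤ (k + 1) * d ∧ k * d ≤ 4 * g := by
    refine ⟨4 * g / d, ?_, Nat.div_mul_le_self _ _⟩
    have := Nat.div_add_mod (4 * g) d
    have := Nat.mod_lt (4 * g) (show 0 < d by omega)
    nlinarith
  have hkd : 3 * k ≤ 4 * g := by nlinarith [show 3 ≤ d by omega]
  have hT : 3 * (k * (τ + 1)) ≤ 20 * g * g + 28 * g := by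
    have e1 : 3 * (k * (L + 1)) ≤ 16 * g := by
      have : 6 * (L + 1) ≤ 8 * d := by omega
      have := Nat.mul_le_mul_left k this
      nlinarith
    have e2 : 3 * (k * (L + 1) ^ 2) ≤ 16 * g * (g + 2) := by
      calc 3 * (k * (L + 1) ^ 2) = 3 * (k * (L + 1)) * (L + 1) := by ring
        _ ≤ 16 * g * (g + 2) := Nat.mul_le_mul e1 (by omega)
    have e3 : k * (τ + 2) ≤ k * g + k * (L + 1) ^ 2 := by
      rw [← mul_add]; exact Nat.mul_le_mul_left _ hτ
    have e4 : 3 * k * (g - 1) ≤ 4 * g * (g - 1) := Nat.mul_le_mul_right _ hkd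
    obtain ⟨g', rfl⟩ : ∃ g', g = g' + 1 := ⟨g - 1, by omega⟩
    rw [Nat.add_sub_cancel] at e4
    nlinarith
  set Y2 := 2 * (k + 1) * (k + 3 * g) + (τ + 1) * (k + 1) * k with hY2
  set D := Y2 / (2 * g) with hD
  have hD1 : Y2 < 2 * g * (D + 1) := Nat.lt_mul_div_succ _ (by omega)
  have hD2 : 2 * g * D ≤ Y2 := Nat.mul_div_le _ _
  have hD3 : 6 * D ≤ (k + 1) * (20 * g + 54) := by
    have : g * (6 * D) ≤ g * ((k + 1) * (20 * g + 54)) := by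
      have e1 : 3 * ((τ + 1) * (k + 1) * k) ≤ (k + 1) * (20 * g * g + 28 * g) := by
        calc 3 * ((τ + 1) * (k + 1) * k) = (k + 1) * (3 * (k * (τ + 1))) := by ring
          _ ≤ _ := by gcongr
      nlinarith
    exact Nat.le_of_mul_le_mul_left this (by omega)
  refine (h 0 1 (g + D) (k + 2 * g) (k + 1) (by simp) ?_ (by omega) ?_ ?_ ?_).imp_right fun h1 => ?_
  · rw [pow_one]; nlinarith
  · nlinarith
  · nlinarith
  · have h2 := sum_range_arith (q ^ 0) (g + D) (k + 2 * g) (τ + 1) k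
    have e1 : k + 2 * g + 1 - g = k + 1 + g := by omega
    have e2 : g + D + 1 - g = D + 1 := by omega
    rw [e1, e2]
    rw [pow_zero, one_mul, one_mul] at h2
    have e3 : 2 * ((D + 1) * (k + 1 + g)) = 2 * (k + 1) * (D + 1) + 2 * g * (D + 1) := by ring
    have e4 : 2 * (k + 1) * (g + D + (k + 2 * g) + 1) + (τ + 1) * (k + 1) * k =
        2 * (k + 1) * (D + 1) + Y2 := by rw [hY2]; ring
    clear_value Y2 D
    simp only [pow_zero, one_mul] at *
    omega
  · rw [pow_one, Nat.add_sub_cancel] at h1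
    have h3 : 2 * ((k + 1) * N) ≤ 2 * ((k + 1) * (L * (q - 1))) := by
      zify [show 1 ≤ q by nlinarith] at *
      have e1 : 6 * ((k + 1 : ℤ) + (g + D) + k * τ + (k + 1) * L) ≤ 3 * (q * (k + 3)) := by
        nlinarith [mul_nonneg (show (0 : ℤ) ≤ k by positivity) (show (0 : ℤ) ≤ g + 1 - L by linarith),
          mul_nonneg (show (0 : ℤ) ≤ k by positivity)
            (show (0 : ℤ) ≤ q - (4 * g + 3) ^ 2 by linarith)]
      have e2 : (q : ℤ) * (4 * g) ≤ q * ((k + 1) * d) :=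
        mul_le_mul_of_nonneg_left hk1 (by positivity)
      have e3 : 2 * ((k + 1) * (L * q) : ℤ) = q * ((k + 1) * d) + 3 * (k + 1) * q := by
        calc 2 * ((k + 1) * (L * q) : ℤ) = (k + 1) * q * (2 * L) := by ring
          _ = _ := by rw [hd]; ring
      nlinarith
    exact Nat.le_of_mul_le_mul_left (by omega : (k + 1) * N ≤ (k + 1) * (L * (q - 1))) (by omega)

end Arith

section Arith

variable {p q g n τ N L : ℕ}

lemma StepanovBound.even_power {μ : ℕ} (h : StepanovBound p q g τ N) (hp : p.Prime) (hg : 1 ≤ g)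
    (hq : q = p ^ μ * p ^ μ) (hqg : (4 * g + 3) ^ 2 ≤ q) : N ≤ τ ∨ N ≤ 2 * (q - 1) := by
  obtain ⟨M, hM⟩ : ∃ M, M = p ^ μ := ⟨_, rfl⟩
  have hMg : 4 * g + 3 ≤ M := by
    rw [← hM] at hq
    by_contra hcon
    nlinarith
  refine (h μ μ (g + M / 2 + 2) (M + 3 * g - 1) 1 hq (by omega) le_rfl hp.one_lt.le (by omega)
    ?_).imp_right fun h1 => ?_
  · rw [← hM]
    simp only [Finset.range_one, Finset.sum_singleton, zero_mul, add_zero]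
    have e1 : M + 3 * g - 1 + 1 = M + 3 * g := by omega
    have e2 : g + M / 2 + 2 + 1 - g = M / 2 + 3 := by omega
    have e3 : M + 3 * g - g = M + 2 * g := by omega
    have e4 : M ≤ 2 * (M / 2) + 1 := by omega
    rw [e1, e2, e3]
    obtain ⟨D, hD⟩ : ∃ D, D = M / 2 := ⟨_, rfl⟩
    rw [← hD] at e4 ⊢
    have : (g : ℕ) * M ≤ g * (2 * D + 1) := Nat.mul_le_mul_left _ e4
    have : M * (g + D + 2) + (M + 3 * g) < (D + 3) * (M + 2 * g) := by nlinarith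
    omega
  · rw [← hM] at hq h1
    have e1 : M / 2 ≤ M := Nat.div_le_self _ _
    have e2 : M * (M + 3 * g - 1) + M = M * (M + 3 * g) := by
      rw [← Nat.mul_succ]; congr 1; omega
    have e3 : M * (4 * g + 3) ≤ M * M := Nat.mul_le_mul_left _ hMg
    rw [hq]
    simp only [one_mul, Nat.sub_self, zero_mul, add_zero] at h1
    have e4 : M * (M + 3 * g) = M * M + 3 * (M * g) := by ring
    have e5 : M * (4 * g + 3) = 4 * (M * g) + 3 * M := by ring
    have e6 : 1 * g ≤ M * g := Nat.mul_le_mul_right _ (by omega)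
    omega

lemma odd_power_aux {M p g s L : ℕ} (hp : 2 ≤ p) (hpM : p ≤ M) (hg : 1 ≤ g)
    (hqg : (4 * g + 3) ^ 2 ≤ M * M * p) (hs : s * p ≤ 2 * g + p - 1) (hL : 2 ≤ L)
    (hgL : g + 2 ≤ (L + 1) ^ 2) : g + s + 1 ≤ (L - 1) * M := by
  obtain ⟨K, rfl⟩ : ∃ K, L = K + 1 := ⟨L - 1, by omega⟩
  rw [Nat.add_sub_cancel]
  have hs2 : s ≤ g := by
    by_contra hcon
    nlinarith [Nat.sub_add_cancel (show 1 ≤ 2 * g + p by omega)]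
  have hKM : M ≤ K * M := Nat.le_mul_of_pos_left _ (by omega)
  rcases Nat.lt_or_ge p 4 with h4 | h4
  · have : 2 * g + 1 ≤ M := by
      by_contra hcon
      have : M * M * p ≤ (2 * g) * (2 * g) * 3 := by gcongr <;> omega
      nlinarith
    omega
  have hs3 : 2 * s ≤ g + 2 := by
    by_contra hcon
    have : 4 * s ≤ s * p := by nlinarith
    have : (2 * s - 2) * p ≤ 4 * g - 2 := by
      have : (2 * s - 2) * p + 2 * p = 2 * (s * p) := by
        rw [← add_mul, Nat.sub_add_cancel (by omega)]; ring
      omega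
    have : (2 * s - 2) * 4 ≤ (2 * s - 2) * p := Nat.mul_le_mul_left _ h4
    omega
  rcases Nat.lt_or_ge (4 * K * K) p with h1 | h1
  · rcases Nat.lt_or_ge K 2 with hK | hK
    · obtain rfl : K = 1 := by omega
      have hg7 : g ≤ 7 := by omega
      rcases Nat.lt_or_ge p 13 with h13 | h13
      · have h5 : M * M * p ≤ M * M * 12 := by gcongr; omega
        by_contra hcon
        rw [one_mul] at hcon
        interval_cases g <;> interval_cases p <;> first
          | omega
          | (have h6 : M ≤ 10 := by omega
             interval_cases M <;> omega)
      · have : s ≤ 2 := by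
          by_contra hcon
          have : 3 * p ≤ s * p := Nat.mul_le_mul_right _ (by omega)
          omega
        omega
    · have : 4 * K * K + 1 ≤ M := by omega
      have : K * (4 * K * K + 1) ≤ K * M := Nat.mul_le_mul_left _ this
      nlinarith
  · have h2 : (4 * g + 3) * (4 * g + 3) ≤ (2 * (K * M)) * (2 * (K * M)) := by
      calc (4 * g + 3) * (4 * g + 3) ≤ M * M * p := by nlinarith
        _ ≤ M * M * (4 * K * K) := by gcongr
        _ = _ := by ring
    have := Nat.mul_self_le_mul_self_iff.1 h2
    omega

lemma StepanovBound.odd_power {μ : ℕ} (h : StepanovBound p q g τ N) (hp : p.Prime) (hg : 1 ≤ g)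
    (hμ : 1 ≤ μ) (hq : q = p ^ μ * p ^ (μ + 1)) (hqg : (4 * g + 3) ^ 2 ≤ q) (hL : 2 ≤ L)
    (hLg : L ≤ g + 1) (hgL : g + 2 ≤ (L + 1) ^ 2) : N ≤ τ ∨ N ≤ L * (q - 1) := by
  obtain ⟨M, hM⟩ : ∃ M, M = p ^ μ := ⟨_, rfl⟩
  have hp2 := hp.two_le
  have hpM : p ≤ M := by
    rw [hM]; exact Nat.le_self_pow (by omega) p
  have hν : p ^ (μ + 1) = M * p := by rw [pow_succ, hM]
  have hq' : q = M * (M * p) := by rw [hq, ← hM, hν]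
  obtain ⟨s, hs1, hs2⟩ : ∃ s, s * p ≤ 2 * g + p - 1 ∧ 2 * g ≤ s * p := by
    refine ⟨(2 * g + p - 1) / p, Nat.div_mul_le_self _ _, ?_⟩
    have := Nat.div_add_mod' (2 * g + p - 1) p
    have := Nat.mod_lt (2 * g + p - 1) hp.pos
    omega
  have hkey := odd_power_aux hp2 hpM hg (by rw [mul_assoc, ← hq']; exact hqg) hs1 hL hgL
  obtain ⟨D, hD1, hD2⟩ : ∃ D, p * (M + 2) ≤ 2 * D ∧ 2 * D ≤ p * (M + 2) + 1 :=
    ⟨(p * (M + 2) + 1) / 2, by omega, by omega⟩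
  have hα : g + D < M * p := by
    have hM5 : 5 ≤ M := by
      by_contra hcon
      have h49 : 49 ≤ q := by nlinarith
      have : M ≤ 4 := by omega
      have hp4 : p ≤ 3 := by
        by_contra hp3
        have : p = 4 := by omega
        rw [this] at hp
        exact absurd hp (by decide)
      have : M * (M * p) ≤ 4 * (4 * 3) := by gcongr
      omega
    have h1 : (4 * g + 3) * (4 * g + 3) * 2 ≤ (M * p) * (M * p) := by
      calc (4 * g + 3) * (4 * g + 3) * 2 ≤ q * p := Nat.mul_le_mul (by nlinarith) hp2
        _ = _ := by rw [hq']; ring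
    have h2 : 7 * (4 * g + 3) ≤ 5 * (M * p) := by
      by_contra hcon
      have h3 : 5 * (M * p) < 7 * (4 * g + 3) := by omega
      have h4 := Nat.mul_lt_mul'' h3 h3
      have h5 : 5 * (M * p) * (5 * (M * p)) = 25 * (M * p * (M * p)) := by ring
      have h6 : 7 * (4 * g + 3) * (7 * (4 * g + 3)) = 49 * ((4 * g + 3) * (4 * g + 3)) := by ring
      omega
    have h7 : p * (M + 2) = M * p + 2 * p := by ring
    have h8 : 5 * p ≤ M * p := Nat.mul_le_mul_right _ hM5
    omega
  have hge : g ≤ M * p := by omega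
  have hs0 : 1 ≤ s := by
    by_contra hcon
    have : s = 0 := by omega
    rw [this] at hs2
    omega
  refine (h μ (μ + 1) (g + D) (M + g + s - 1) 1 hq (by rw [hν]; exact hα) le_rfl hp.one_lt.le
    (by rw [hν]; omega) ?_).imp_right fun h1 => ?_
  · rw [← hM]
    simp only [Finset.range_one, Finset.sum_singleton, zero_mul, add_zero]
    have e1 : M + g + s - 1 + 1 = M + g + s := by omega
    have e2 : g + D + 1 - g = D + 1 := by omega
    have e3 : M + g + s - g = M + s := by omega
    have e4 : g * (M + 2) ≤ s * D := by
      have : p * (g * (M + 2)) ≤ p * (s * D) := by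
        calc p * (g * (M + 2)) = g * (p * (M + 2)) := by ring
          _ ≤ g * (2 * D) := by gcongr
          _ = 2 * g * D := by ring
          _ ≤ s * p * D := by gcongr
          _ = _ := by ring
      exact Nat.le_of_mul_le_mul_left this hp.pos
    have e5 : M * (g + D) + (M + g + s - 1) + 1 = M * (g + D) + (M + g + s) := by omega
    rw [e5, e1, e2, e3]
    nlinarith
  · rw [hν] at h1
    have e1 : M * p * (M + g + s - 1) + M * p = M * p * (M + g + s) := by
      rw [← Nat.mul_succ]; congr 1; omega
    have e2 : M * p * (g + s + 1) ≤ M * p * ((L - 1) * M) := Nat.mul_le_mul_left _ hkey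
    obtain ⟨K, rfl⟩ : ∃ K, L = K + 1 := ⟨L - 1, by omega⟩
    rw [Nat.add_sub_cancel] at e2
    simp only [one_mul, Nat.sub_self, zero_mul, add_zero] at h1
    have e3 : N + (K + 1) ≤ (K + 1) * q := by
      have e4 : (K + 1) * q = M * p * (K * M) + M * p * M := by rw [hq']; ring
      have e5 : M * p * (M + g + s) + M * p = M * p * (g + s + 1) + M * p * M := by ring
      omega
    rw [Nat.mul_sub, mul_one]
    omega

lemma exceptional_aux {E M : ℕ} (hqE : 2 * (E * (12 * E + 4) + (E + 1)) ≤ q) (hM1 : 2 * E ≤ M)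
    (hM2 : M + 1 ≤ 4 * E) (hM0 : 0 < M)
    (h : M * N ≤ M + M * (3 * M + 3) + q * (M + 1) + 3 * M) : E * N ≤ (E + 1) * (q - 1) := by
  refine Nat.le_of_mul_le_mul_left ?_ hM0
  have e1 : q * (2 * E) ≤ q * M := Nat.mul_le_mul_left _ hM1
  obtain ⟨q', rfl⟩ : ∃ q', q = q' + 1 := ⟨q - 1, by omega⟩
  rw [Nat.add_sub_cancel]
  have e2 : E * (M * N) ≤ E * (M + M * (3 * M + 3) + (q' + 1) * (M + 1) + 3 * M) :=
    Nat.mul_le_mul_left _ h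
  have e3 : E * (3 * M + 7) ≤ E * (12 * E + 4) := Nat.mul_le_mul_left _ (by omega)
  have e4 : 2 * (E * (3 * M + 7) + (E + 1)) ≤ q' + 1 := by omega
  have e5 : M * (2 * (E * (3 * M + 7) + (E + 1))) ≤ M * (q' + 1) := Nat.mul_le_mul_left _ e4
  have e6 : M * (E * N) = E * (M * N) := by ring
  have e7 : E * (M + M * (3 * M + 3) + (q' + 1) * (M + 1) + 3 * M) =
      E * (M * (3 * M + 7)) + E * ((q' + 1) * M) + E * (q' + 1) := by ring
  have e8 : M * (2 * (E * (3 * M + 7) + (E + 1))) =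
      2 * (E * (M * (3 * M + 7))) + 2 * (M * E) + 2 * M := by ring
  have e9 : M * ((E + 1) * q') + M * E + M = E * ((q' + 1) * M) + M * (q' + 1) := by ring
  have e10 : (q' + 1) * (2 * E) = 2 * (E * (q' + 1)) := by ring
  have e11 : (q' + 1) * M = M * (q' + 1) := by ring
  omega

lemma StepanovBound.exceptional {r E : ℕ} (h : StepanovBound p q 1 3 N) (hp : p.Prime)
    (hq : q = p ^ r) (hE : 2 ≤ E) (hqE : (12 * E - 5) ^ 2 ≤ q) :
    N ≤ 3 ∨ E * N ≤ (E + 1) * (q - 1) := by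
  obtain ⟨E', rfl⟩ : ∃ E', E = E' + 2 := ⟨E - 2, by omega⟩
  have hqE' : (12 * E' + 19) * (12 * E' + 19) ≤ q := by
    rw [show 12 * (E' + 2) - 5 = 12 * E' + 19 by omega, sq] at hqE
    exact hqE
  obtain ⟨E, hEE⟩ : ∃ E, E = E' + 2 := ⟨_, rfl⟩
  have hq0 : 2 * (E * (12 * E + 4) + (E + 1)) ≤ q := by
    refine le_trans ?_ hqE'
    rw [hEE]
    nlinarith
  rw [← hEE]
  obtain ⟨μ, hμ1, hμ2⟩ : ∃ μ, p ^ μ ≤ 2 * E ∧ 2 * E < p ^ (μ + 1) :=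
    ⟨Nat.log p (2 * E), Nat.pow_log_le_self p (by omega), Nat.lt_pow_succ_log_self hp.one_lt _⟩
  have hμr : μ ≤ r := by
    by_contra hcon
    have : p ^ r ≤ p ^ μ := Nat.pow_le_pow_right hp.pos (by omega)
    nlinarith
  obtain ⟨ν, rfl⟩ : ∃ ν, r = μ + ν := ⟨r - μ, by omega⟩
  rw [pow_add] at hq
  obtain ⟨e, he⟩ : ∃ e, e = p ^ μ := ⟨_, rfl⟩
  obtain ⟨Q, hQ⟩ : ∃ Q, Q = p ^ ν := ⟨_, rfl⟩
  have he0 : 0 < e := by rw [he]; exact pow_pos hp.pos _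
  obtain ⟨k, hk1, hk2⟩ : ∃ k, 2 * E ≤ (k + 1) * e ∧ k * e < 2 * E := by
    refine ⟨(2 * E - 1) / e, ?_, ?_⟩
    · have := Nat.lt_mul_div_succ (2 * E - 1) he0
      rw [mul_comm e] at this
      omega
    · have := Nat.div_mul_le_self (2 * E - 1) e
      omega
  rw [pow_succ, ← he] at hμ2
  rw [← he] at hμ1
  have hkp : k + 1 ≤ p := by
    by_contra hcon
    have : p * e ≤ k * e := Nat.mul_le_mul_right _ (by omega)
    nlinarith
  have hqeq : q = e * Q := by rw [hq, he, hQ]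
  obtain ⟨M, hM⟩ : ∃ M, M = (k + 1) * e := ⟨_, rfl⟩
  have hM2 : M + 1 ≤ 4 * E := by rw [hM, add_mul]; omega
  have hMk : k + 1 ≤ M := by rw [hM]; exact Nat.le_mul_of_pos_right _ he0
  have hα : e * (2 * M * k + (k + 1) * (M + 2) + 1) ≤ M * (3 * M + 3) := by
    have : e * k ≤ M := by rw [hM]; nlinarith
    have h2 : e * (k + 1) = M := by rw [hM]; ring
    have h3 : e ≤ M := by nlinarith
    nlinarith
  have hαq : M * (3 * M + 3) < e * Q := by
    rw [← hqeq]
    nlinarith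
  refine (h μ ν (2 * M * k + (k + 1) * (M + 2) + 1) (M + 1) (k + 1) hq ?_ (by omega) hkp ?_
    ?_).imp_right fun h1 => ?_
  · rw [← hQ]
    exact Nat.lt_of_mul_lt_mul_left (lt_of_le_of_lt hα hαq)
  · rw [← hQ]
    refine le_trans ?_ (Nat.lt_of_mul_lt_mul_left (lt_of_le_of_lt hα hαq)).le
    nlinarith
  · rw [← he]
    have h2 := sum_range_arith e (2 * M * k + (k + 1) * (M + 2) + 1) (M + 1) (3 + 1) k
    rw [Nat.add_sub_cancel, Nat.add_sub_cancel]
    have h3 : 2 * (k + 1) * (e * (2 * M * k + (k + 1) * (M + 2) + 1) + (M + 1) + 1) +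
        e * (3 + 1) * (k + 1) * k < 2 * ((2 * M * k + (k + 1) * (M + 2) + 1) * (M + 1)) := by
      generalize hA : 2 * M * k + (k + 1) * (M + 2) + 1 = A
      have : 2 * (k + 1) * (e * A + (M + 1) + 1) + e * (3 + 1) * (k + 1) * k =
          2 * (M * A) + 2 * ((k + 1) * (M + 2)) + 4 * M * k := by
        rw [hM]; ring
      rw [this, ← hA]
      nlinarith
    omega
  · rw [← hQ, Nat.add_sub_cancel] at h1
    have h2 : M * N ≤ M + M * (3 * M + 3) + q * (M + 1) + 3 * M := by
      have := Nat.mul_le_mul_left e h1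
      have e1 : e * ((k + 1) * N) = M * N := by rw [hM]; ring
      have e2 : e * (k + 1) = M := by rw [hM]; ring
      rw [e1] at this
      have e3 : e * (k + 1 + (2 * M * k + (k + 1) * (M + 2) + 1) + Q * (M + 1) + k * 3) =
          e * (k + 1) + e * (2 * M * k + (k + 1) * (M + 2) + 1) + e * Q * (M + 1) +
            3 * (e * k) := by
        ring
      rw [e3, e2, ← hqeq] at this
      have : e * k ≤ M := e2 ▸ Nat.mul_le_mul_left _ (Nat.le_succ k)
      omega
    exact exceptional_aux hq0 (by omega) hM2 (by omega) h2

end Arith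

section Arith

lemma StepanovBound.main {p q g n τ N L r : ℕ} (h : StepanovBound p q g τ N)
    (hpen : g + 1 < q → N ≤ τ ∨ N ≤ 1 + (q + 1) * (g + 1)) (hp : p.Prime) (hq : q = p ^ r)
    (h49 : 49 ≤ q) (hqg : (4 * g + 3) ^ 2 ≤ q) (hτ : τ + 2 = g + n) (hn : n ≤ (L + 1) ^ 2)
    (hgn : g + 2 ≤ n) (hnq : n ≤ g + 4 * (q - 1)) (hL : 2 ≤ L) : N ≤ L * (q - 1) := by
  have hg8 : 8 * g + 9 ≤ q := by nlinarith
  have hL2 : 2 * (q - 1) ≤ L * (q - 1) := Nat.mul_le_mul_right _ hL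
  have hτL : τ ≤ L * (q - 1) := by
    rcases Nat.lt_or_ge L 5 with h5 | h5
    · have : (L + 1) ^ 2 ≤ 5 ^ 2 := Nat.pow_le_pow_left (by omega) 2
      omega
    · have : 5 * (q - 1) ≤ L * (q - 1) := Nat.mul_le_mul_right _ h5
      omega
  suffices N ≤ τ ∨ N ≤ L * (q - 1) by omega
  rcases Nat.lt_or_ge (g + 1) L with hLg | hLg
  · refine (hpen (by omega)).imp_right fun h1 => h1.trans ?_
    have h2 : (g + 2) * (q - 1) ≤ L * (q - 1) := Nat.mul_le_mul_right _ hLg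
    refine le_trans ?_ h2
    obtain ⟨q', rfl⟩ : ∃ q', q = q' + 1 := ⟨q - 1, by omega⟩
    rw [Nat.add_sub_cancel]
    nlinarith
  · have hg : 1 ≤ g := by omega
    rcases Nat.even_or_odd' r with ⟨μ, rfl | rfl⟩
    · rw [two_mul, pow_add] at hq
      exact (h.even_power hp hg hq hqg).imp_right fun h1 => h1.trans hL2
    · rcases Nat.eq_zero_or_pos μ with rfl | hμ
      · have hpq : p = q := by simpa using hq.symm
        subst hpq
        rcases Nat.lt_or_ge L 3 with h3 | h3
        · obtain rfl : L = 2 := by omega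
          exact h.prime_two hg hqg (by omega)
        · exact h.prime hqg h3 hLg (by omega)
      · exact h.odd_power hp hg hμ (by rw [hq, ← pow_add]; congr 1; omega) hqg hL hLg (by omega)

end Arith

section Support

variable {F : Type} [Field F]

/-- The support of a bivariate polynomial. -/
noncomputable def bsupp (f : Biv F) : Finset (ℤ × ℤ) :=
  f.support.biUnion fun m => (f.coeff m).support.image fun i : ℕ => ((i : ℤ), (m : ℤ))

lemma mem_bsupp {f : Biv F} {v : ℤ × ℤ} :
    v ∈ bsupp f ↔ ∃ i m : ℕ, (f.coeff m).coeff i ≠ 0 ∧ v = ((i : ℤ), (m : ℤ)) := by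
  simp only [bsupp, Finset.mem_biUnion, Finset.mem_image, mem_support_iff]
  constructor
  · rintro ⟨m, -, i, hi, rfl⟩
    exact ⟨i, m, hi, rfl⟩
  · rintro ⟨i, m, h, rfl⟩
    exact ⟨m, fun h0 => h (by rw [h0, coeff_zero]), i, h, rfl⟩

lemma mk_mem_bsupp {f : Biv F} {i m : ℕ} :
    ((i : ℤ), (m : ℤ)) ∈ bsupp f ↔ (f.coeff m).coeff i ≠ 0 := by
  rw [mem_bsupp]
  constructor
  · rintro ⟨i', m', h, he⟩
    rw [Prod.mk.injEq, Nat.cast_inj, Nat.cast_inj] at he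
    rw [he.1, he.2]
    exact h
  · exact fun h => ⟨i, m, h, rfl⟩

lemma bsupp_nonneg {f : Biv F} {v : ℤ × ℤ} (h : v ∈ bsupp f) : 0 ≤ v.1 ∧ 0 ≤ v.2 := by
  obtain ⟨i, m, -, rfl⟩ := mem_bsupp.1 h
  simp

lemma isStrip_bsupp {f : Biv F} (hw : 0 < f.natDegree) (h0 : f.coeff 0 ≠ 0) :
    IsStrip (bsupp f) f.natDegree where
  pos := hw
  ge v hv := (bsupp_nonneg hv).2
  le v hv := by
    obtain ⟨i, m, h, rfl⟩ := mem_bsupp.1 hv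
    have : m ≤ f.natDegree := le_natDegree_of_ne_zero fun h1 => h (by rw [h1, coeff_zero])
    simpa using this
  bot := ⟨_, mk_mem_bsupp.2 (show (f.coeff 0).coeff (f.coeff 0).natDegree ≠ 0 from
    leadingCoeff_ne_zero.2 h0), by simp⟩
  top := ⟨_, mk_mem_bsupp.2 (show (f.coeff f.natDegree).coeff (f.coeff f.natDegree).natDegree ≠ 0
    from leadingCoeff_ne_zero.2 (leadingCoeff_ne_zero.2 fun h => by simp [h] at h0)), rfl⟩

lemma IsStrip.exists_vertex_top {V : Finset (ℤ × ℤ)} {w : ℕ} (hV : IsStrip V w) :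
    ∃ v ∈ V, v.2 = w ∧ rowR V w ≤ v.1 := by
  have hmem := hV.rowR_mem (y := (w : ℝ)) (by positivity) le_rfl
  have hw := hV.pos
  obtain ⟨a, ha, b, hb, ha2, hb2, hseg⟩ := hV.split ((w : ℤ) - 1) (by omega) (by omega) hmem
  have hbw : b.2 ≤ w := hV.le_top (hullZ_subset (hullZ_convex V)
    (fun v hv => mem_hullZ (Finset.mem_filter.1 hv).1) hb)
  push_cast at ha2 hb2
  have hpb : (rowR V w, (w : ℝ)) = b := by
    obtain ⟨s, t, hs, ht, hst, h⟩ := hseg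
    have h2 := congrArg Prod.snd h
    simp only [Prod.snd_add, Prod.smul_snd, smul_eq_mul] at h2
    have hs0 : s = 0 := by nlinarith
    have ht1 : t = 1 := by linarith
    rw [← h, hs0, ht1]
    simp
  rw [← hpb] at hb
  set W := V.filter (fun v => (w : ℤ) - 1 < v.2) with hW
  have hWne : W.Nonempty := by
    obtain ⟨v, hv, hvw⟩ := hV.top
    exact ⟨v, Finset.mem_filter.2 ⟨hv, by omega⟩⟩
  obtain ⟨v, hv, hmax⟩ := W.exists_max_image (fun v => v.1) hWne
  have hvV := (Finset.mem_filter.1 hv)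
  refine ⟨v, hvV.1, le_antisymm (hV.le v hvV.1) (by have := hvV.2; omega), ?_⟩
  have := hullZ_halfplane (V := W) (a := 1) (b := 0) (c := v.1) (fun u hu => by
    have : (u.1 : ℝ) ≤ v.1 := by exact_mod_cast hmax u hu
    linarith) hb
  simpa using this

lemma IsStrip.card_eq_numPts {V : Finset (ℤ × ℤ)} {w : ℕ} (hV : IsStrip V w) :
    (stripS V w 1 0).card = numPts (hullZ V) := by
  rw [numPts, hV.stripS_one, Set.ncard_coe_finset]

lemma interior_halfplane_lt {V : Finset (ℤ × ℤ)} {a b c : ℝ} (hab : (a, b) ≠ (0, 0))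
    (h : ∀ v ∈ V, a * (v.1 : ℝ) + b * (v.2 : ℝ) ≤ c) {p : ℝ × ℝ} (hp : p ∈ interior (hullZ V)) :
    a * p.1 + b * p.2 < c := by
  by_contra hcon
  rw [mem_interior_iff_mem_nhds] at hp
  have hcont : Filter.Tendsto (fun t : ℝ => (p.1 + t * a, p.2 + t * b)) (nhds 0) (nhds p) := by
    have : Continuous fun t : ℝ => (p.1 + t * a, p.2 + t * b) := by fun_prop
    have h1 := this.tendsto 0
    simpa using h1
  have hev := (hcont.eventually hp).filter_mono (nhdsWithin_le_nhds (s := Set.Ioi 0))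
  obtain ⟨t, ht, ht0⟩ := (hev.and self_mem_nhdsWithin).exists
  have h2 := hullZ_halfplane h ht
  simp only at h2
  have : 0 < a * a + b * b := by
    rcases eq_or_ne a 0 with rfl | ha
    · have : b ≠ 0 := fun hb => hab (by rw [hb])
      have := mul_self_pos.2 this
      nlinarith
    · have := mul_self_pos.2 ha
      nlinarith [mul_self_nonneg b]
  nlinarith

lemma IsStrip.intPts_add_two_le {V : Finset (ℤ × ℤ)} {w : ℕ} (hV : IsStrip V w) :
    intPts (hullZ V) + 2 ≤ numPts (hullZ V) := by
  obtain ⟨u, hu, hu0⟩ := hV.bot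
  obtain ⟨v, hv, hvw⟩ := hV.top
  have hw := hV.pos
  have hfin := hV.latticePts_finite
  have hint : (latticePts (interior (hullZ V))).Finite :=
    hfin.subset fun x hx => interior_subset (s := hullZ V) hx
  have hbot : ∀ x ∈ latticePts (interior (hullZ V)), 0 < x.2 ∧ x.2 < w := by
    intro x hx
    have h1 := interior_halfplane_lt (V := V) (a := 0) (b := -1) (c := 0) (by simp)
      (fun y hy => by
        have : (0 : ℝ) ≤ y.2 := by exact_mod_cast hV.ge y hy
        linarith) hx
    have h2 := interior_halfplane_lt (V := V) (a := 0) (b := 1) (c := w) (by simp)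
      (fun y hy => by
        have : (y.2 : ℝ) ≤ w := by exact_mod_cast hV.le y hy
        linarith) hx
    simp only [toR2] at h1 h2
    constructor
    · have : (0 : ℝ) < x.2 := by linarith
      exact_mod_cast this
    · have : (x.2 : ℝ) < w := by linarith
      exact_mod_cast this
  have hv' : v ∉ latticePts (interior (hullZ V)) := fun h => by have := hbot v h; omega
  have hu' : u ∉ insert v (latticePts (interior (hullZ V))) := by
    rw [Set.mem_insert_iff, not_or]
    refine ⟨fun h => ?_, fun h => by have := hbot u h; omega⟩
    rw [h] at hu0
    omega
  rw [numPts, intPts]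
  have h1 := Set.ncard_insert_of_notMem hv' hint
  have h2 := Set.ncard_insert_of_notMem hu' (hint.insert v)
  have h3 := Set.ncard_le_ncard (s := insert u (insert v (latticePts (interior (hullZ V)))))
    (t := latticePts (hullZ V)) (by
      rintro x (rfl | rfl | hx)
      · exact mem_hullZ hu
      · exact mem_hullZ hv
      · exact interior_subset (s := hullZ V) hx) hfin
  omega

lemma IsStrip.numPts_le {V : Finset (ℤ × ℤ)} {w : ℕ} (hV : IsStrip V w) {B : ℕ}
    (hV0 : ∀ v ∈ V, 0 ≤ v.1) (hB : ∀ v ∈ V, v.1 ≤ B) :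
    numPts (hullZ V) ≤ intPts (hullZ V) + 2 * w + 2 * B := by
  have h1 := hV.numPts_eq
  have h2 := hV.intPts_ge
  have hw := hV.pos
  rw [sum_Icc_eq_Ioo w hw] at h1
  have hrow : ∀ y : ℝ, 0 ≤ y → y ≤ w → ⌊rowR V y⌋ + 1 - ⌈rowL V y⌉ ≤ B + 1 := by
    intro y h0 h1
    have e1 : rowR V y ≤ B := by
      have := hullZ_halfplane (V := V) (a := 1) (b := 0) (c := B) (fun v hv => by
        have : (v.1 : ℝ) ≤ B := by exact_mod_cast hB v hv
        linarith) (hV.rowR_mem h0 h1)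
      simpa using this
    have e2 : 0 ≤ rowL V y := by
      have := hullZ_halfplane (V := V) (a := -1) (b := 0) (c := 0) (fun v hv => by
        have : (0 : ℝ) ≤ v.1 := by exact_mod_cast hV0 v hv
        linarith) (hV.rowL_mem h0 h1)
      simpa using this
    have e3 : ⌊rowR V y⌋ ≤ B := by
      have := Int.floor_le_floor e1
      simpa using this
    have e4 := Int.ceil_nonneg e2
    omega
  have hsum : ∑ m ∈ Finset.Ioo (0 : ℤ) w, (⌊rowR V m⌋ + 1 - ⌈rowL V m⌉) ≤
      ∑ m ∈ Finset.Ioo (0 : ℤ) w, (⌈rowR V m⌉ - ⌊rowL V m⌋ - 1 + 2) := by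
    refine Finset.sum_le_sum fun m _ => ?_
    have := Int.floor_le_ceil (rowR V m)
    have := Int.floor_le_ceil (rowL V m)
    omega
  rw [Finset.sum_add_distrib, Finset.sum_const, Int.card_Ioo, nsmul_eq_mul] at hsum
  have h3 := hrow 0 le_rfl (by positivity)
  have h4 := hrow w (by positivity) le_rfl
  simp only [Int.cast_zero, Int.cast_natCast] at *
  omega

variable {f : Biv F}

lemma isCurve_bsupp (hf : Irreducible f) (hw : 0 < f.natDegree) (h0 : f.coeff 0 ≠ 0) :
    IsCurve (bsupp f) f.natDegree (intPts (hullZ (bsupp f)) + numPts (hullZ (bsupp f)) - 2) f := by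
  have hV := isStrip_bsupp hw h0
  have h2 := hV.intPts_add_two_le
  refine ⟨hV, fun v hv => (bsupp_nonneg hv).1, hf.prime, ?_, rfl, ?_, ?_⟩
  · rw [← hV.stripS_one]
    exact fun m i h => mem_hullZ (mk_mem_bsupp.2 h)
  · obtain ⟨v, hv, hvw, hr⟩ := hV.exists_vertex_top
    refine hr.trans ?_
    obtain ⟨i, m, h, rfl⟩ := mem_bsupp.1 hv
    simp only [Nat.cast_inj] at hvw
    subst hvw
    have := le_natDegree_of_ne_zero h
    simp only [leadingCoeff, Int.cast_natCast]
    exact_mod_cast this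
  · have := hV.pick
    rw [Nat.cast_sub (by omega)]
    push_cast
    linarith

lemma IsCurve.stepanovBound [Fintype F] {V : Finset (ℤ × ℤ)} {w τ g p : ℕ}
    (hC : IsCurve V w τ f) (hder : derivative f ≠ 0) (hp : p.Prime) [CharP F p]
    (hg : τ + 2 ≤ g + numPts (hullZ V)) :
    StepanovBound p (Fintype.card F) g τ (torusZeros f).card := by
  have : Fact p.Prime := ⟨hp⟩
  intro μ ν α β m hq hα h1 h2 h3 h4
  exact hC.stepanov hder hq (by rwa [hC.strip.card_eq_numPts]) hα h1 h2 h3 h4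

end Support

lemma latticePts_hullZ_finite (V : Finset (ℤ × ℤ)) : (latticePts (hullZ V)).Finite := by
  obtain ⟨B, hB⟩ := ((hullZ_compact V).isBounded).exists_norm_le
  refine (((Set.finite_Icc (-⌈B⌉) ⌈B⌉).prod (Set.finite_Icc (-⌈B⌉) ⌈B⌉))).subset ?_
  intro v hv
  have h := hB _ hv
  have h1 := (norm_fst_le (toR2 v)).trans h
  have h2 := (norm_snd_le (toR2 v)).trans h
  simp only [toR2, Real.norm_eq_abs, abs_le] at h1 h2
  have hc := Int.le_ceil B
  rw [Set.mem_prod, Set.mem_Icc, Set.mem_Icc]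
  refine ⟨⟨?_, ?_⟩, ?_, ?_⟩
  all_goals
    have : ∀ a b : ℤ, (a : ℝ) ≤ b → a ≤ b := fun a b h => by exact_mod_cast h
    apply this
    push_cast
    linarith

lemma latticePts_interior_finite (V : Finset (ℤ × ℤ)) :
    (latticePts (interior (hullZ V))).Finite :=
  (latticePts_hullZ_finite V).subset fun _ hx => interior_subset (s := hullZ V) hx

section Equiv

variable {T : ℤ × ℤ → ℤ × ℤ} (e : (ℝ × ℝ) ≃L[ℝ] (ℝ × ℝ))

lemma hullZ_image (h : ∀ v, toR2 (T v) = e (toR2 v)) (V : Finset (ℤ × ℤ)) :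
    hullZ (V.image T) = e '' hullZ V := by
  have := (e : (ℝ × ℝ) →L[ℝ] (ℝ × ℝ)).toLinearMap.image_convexHull (toR2 '' (V : Set (ℤ × ℤ)))
  rw [hullZ, hullZ]
  refine Eq.trans ?_ this.symm
  congr 1
  rw [Finset.coe_image, Set.image_image, Set.image_image]
  exact Set.image_congr fun v _ => h v

lemma numPts_le_image (h : ∀ v, toR2 (T v) = e (toR2 v)) (hT : Function.Injective T)
    (V : Finset (ℤ × ℤ)) : numPts (hullZ V) ≤ numPts (hullZ (V.image T)) := by
  refine Set.ncard_le_ncard_of_injOn T (fun v hv => ?_) hT.injOn (latticePts_hullZ_finite _)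
  rw [latticePts, Set.mem_ofPred_eq, hullZ_image e h, h]
  exact Set.mem_image_of_mem _ hv

lemma intPts_le_image (h : ∀ v, toR2 (T v) = e (toR2 v)) (hT : Function.Injective T)
    (V : Finset (ℤ × ℤ)) : intPts (hullZ V) ≤ intPts (hullZ (V.image T)) := by
  refine Set.ncard_le_ncard_of_injOn T (fun v hv => ?_) hT.injOn (latticePts_interior_finite _)
  have : e '' interior (hullZ V) = interior (e '' hullZ V) := e.toHomeomorph.image_interior _
  rw [latticePts, Set.mem_ofPred_eq, hullZ_image e h, h, ← this]
  exact Set.mem_image_of_mem _ hv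

end Equiv

section Contract

variable {F : Type} [Field F]

/-- Scaling of the second coordinate. -/
noncomputable def scaleSnd (p : ℕ) (hp : p ≠ 0) : (ℝ × ℝ) ≃L[ℝ] (ℝ × ℝ) :=
  (ContinuousLinearEquiv.refl ℝ ℝ).prodCongr
    (ContinuousLinearEquiv.unitsEquivAut ℝ (Units.mk0 (p : ℝ) (Nat.cast_ne_zero.2 hp)))

lemma toR2_scaleSnd (p : ℕ) (hp : p ≠ 0) (v : ℤ × ℤ) :
    toR2 (v.1, v.2 * p) = scaleSnd p hp (toR2 v) := by
  simp [toR2, scaleSnd]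

lemma bsupp_expand {p : ℕ} (hp : p ≠ 0) (g : Biv F) :
    bsupp (expand (Polynomial F) p g) = (bsupp g).image fun v : ℤ × ℤ => (v.1, v.2 * (p : ℤ)) := by
  ext v
  rw [Finset.mem_image, mem_bsupp]
  constructor
  · rintro ⟨i, m, h, rfl⟩
    rw [coeff_expand (Nat.pos_of_ne_zero hp)] at h
    split_ifs at h with hm
    · obtain ⟨k, rfl⟩ := hm
      rw [Nat.mul_div_cancel_left _ (Nat.pos_of_ne_zero hp)] at h
      exact ⟨_, mk_mem_bsupp.2 h, by simp [mul_comm]⟩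
    · simp at h
  · rintro ⟨_, hv, rfl⟩
    obtain ⟨i, m, h, rfl⟩ := mem_bsupp.1 hv
    exact ⟨i, m * p, by rwa [coeff_expand_mul (Nat.pos_of_ne_zero hp)], by simp⟩

lemma card_torusZeros_expand_le [Fintype F] {p : ℕ} [Fact p.Prime] [CharP F p] (g : Biv F) :
    (torusZeros (expand (Polynomial F) p g)).card ≤ (torusZeros g).card := by
  refine Finset.card_le_card_of_injOn (fun P => (P.1, P.2 ^ p)) (fun P hP => ?_) ?_
  · have hP := mem_torusZeros.1 hP
    refine mem_torusZeros.2 ⟨hP.1, pow_ne_zero _ hP.2.1, ?_⟩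
    have h := hP.2.2
    rw [evalEval, expand_eval, ← C_pow] at h
    exact h
  · rintro ⟨a, b⟩ - ⟨a', b'⟩ - h
    simp only [Prod.mk.injEq] at h
    rw [h.1, frobenius_inj F p h.2]

/-- The bounds of Stepanov's method for an irreducible bivariate polynomial. -/
theorem exists_stepanovBound [Fintype F] (B W : ℕ) : ∀ f : Biv F, Irreducible f →
    0 < f.natDegree → f.coeff 0 ≠ 0 → f.natDegree ≤ W → (∀ v ∈ bsupp f, v.1 ≤ B) →
    ∃ p r g n τ : ℕ, p.Prime ∧ Fintype.card F = p ^ r ∧ τ + 2 = g + n ∧ g + 2 ≤ n ∧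
      g ≤ intPts (hullZ (bsupp f)) ∧ n ≤ numPts (hullZ (bsupp f)) ∧ n ≤ g + 2 * W + 2 * B ∧
      StepanovBound p (Fintype.card F) g τ (torusZeros f).card ∧
      (g + 1 < Fintype.card F → (torusZeros f).card ≤ τ ∨
        (torusZeros f).card ≤ 1 + (Fintype.card F + 1) * (g + 1)) := by
  intro f
  induction hd : f.natDegree using Nat.strong_induction_on generalizing f with
  | _ d ih =>
  intro hf hw h0 hW hB
  obtain ⟨p, hchar⟩ := CharP.exists F
  obtain ⟨r, hp, hr⟩ := FiniteField.card F p
  have : Fact p.Prime := ⟨hp⟩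
  subst hd
  by_cases hder : derivative f = 0
  · have hexp := expand_contract p hder hp.ne_zero
    set g := contract p f with hg
    have hdeg : f.natDegree = g.natDegree * p := by rw [← hexp, natDegree_expand]
    have hgw : 0 < g.natDegree := by
      rcases Nat.eq_zero_or_pos g.natDegree with h | h
      · rw [hdeg, h, zero_mul] at hw
        omega
      · exact h
    have hlt : g.natDegree < f.natDegree := by
      rw [hdeg]
      exact lt_mul_of_one_lt_right hgw hp.one_lt
    have hbs := bsupp_expand hp.ne_zero g
    rw [hexp] at hbs
    have hinj : Function.Injective fun v : ℤ × ℤ => (v.1, v.2 * (p : ℤ)) := by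
      rintro ⟨a, b⟩ ⟨a', b'⟩ h
      simp only [Prod.mk.injEq, mul_eq_mul_right_iff, Nat.cast_eq_zero] at h
      rw [h.1, h.2.resolve_right hp.ne_zero]
    obtain ⟨p', r', γ, n, τ, h1, h2, h3, h4, h5, h6, h7, h8, h9⟩ := ih _ hlt g rfl
      (of_irreducible_expand hp.ne_zero (by rwa [hexp])) hgw (by
        rw [hg, coeff_contract hp.ne_zero, zero_mul]; exact h0) (by omega) (fun v hv => by
        exact hB (v.1, v.2 * p) (by rw [hbs]; exact Finset.mem_image_of_mem _ hv))
    have hN := card_torusZeros_expand_le (p := p) g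
    rw [hexp] at hN
    refine ⟨p', r', γ, n, τ, h1, h2, h3, h4, ?_, ?_, h7, ?_, ?_⟩
    · rw [hbs]
      exact h5.trans (intPts_le_image _ (toR2_scaleSnd p hp.ne_zero) hinj _)
    · rw [hbs]
      exact h6.trans (numPts_le_image _ (toR2_scaleSnd p hp.ne_zero) hinj _)
    · intro μ ν α β m e1 e2 e3 e4 e5 e6
      refine (h8 μ ν α β m e1 e2 e3 e4 e5 e6).imp hN.trans fun h => ?_
      exact (Nat.mul_le_mul_left _ hN).trans h
    · exact fun h => (h9 h).imp hN.trans hN.trans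
  · have hC := isCurve_bsupp hf hw h0
    have h2 := hC.strip.intPts_add_two_le
    refine ⟨p, r, intPts (hullZ (bsupp f)), numPts (hullZ (bsupp f)), _, hp, hr, ?_, h2, le_rfl,
      le_rfl, ?_, hC.stepanovBound hder hp (by omega), fun h => hC.pencil hder ?_ h⟩
    · omega
    · have := hC.strip.numPts_le hC.nonneg hB
      omega
    · rw [hC.strip.card_eq_numPts]
      omega

lemma StepanovBound.mono {p q g g' τ τ' N : ℕ} (h : StepanovBound p q g τ N) (hg : g ≤ g')
    (hτ : τ ≤ τ') : StepanovBound p q g' τ' N := by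
  intro μ ν α β m e1 e2 e3 e4 e5 e6
  refine (h μ ν α β m e1 e2 e3 e4 e5 (lt_of_le_of_lt ?_ (e6.trans_le ?_))).imp
    (fun h => h.trans hτ) fun h => h.trans ?_
  · exact Finset.sum_le_sum fun l _ => by gcongr
  · gcongr
  · gcongr

theorem card_torusZeros_le_of_irreducible [Fintype F] {f : Biv F} (hf : Irreducible f)
    (hw : 0 < f.natDegree) (h0 : f.coeff 0 ≠ 0) (hbox : ∀ v ∈ bsupp f, v ∈ box (Fintype.card F))
    (h49 : 49 ≤ Fintype.card F)
    (hI : (4 * intPts (hullZ (bsupp f)) + 3) ^ 2 ≤ Fintype.card F) {L : ℕ} (hL : 2 ≤ L)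
    (hn : numPts (hullZ (bsupp f)) ≤ (L + 1) ^ 2) :
    (torusZeros f).card ≤ L * (Fintype.card F - 1) := by
  obtain ⟨v, hv, hvw⟩ := (isStrip_bsupp hw h0).top
  have := (hbox v hv).2.2.2
  obtain ⟨p, r, g, n, τ, h1, h2, h3, h4, h5, h6, h7, h8, h9⟩ := exists_stepanovBound
    (Fintype.card F - 2) (Fintype.card F - 2) f hf hw h0 (by omega) (fun v hv => by
      have := (hbox v hv).2.1
      omega)
  have hg : (4 * g + 3) ^ 2 ≤ (4 * intPts (hullZ (bsupp f)) + 3) ^ 2 :=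
    Nat.pow_le_pow_left (by omega) 2
  exact h8.main h9 h1 h2 h49 (hg.trans hI) h3 (h6.trans hn) h4 (by omega) hL

theorem card_torusZeros_le_of_exceptional [Fintype F] {f : Biv F} (hf : Irreducible f)
    (hw : 0 < f.natDegree) (h0 : f.coeff 0 ≠ 0) (hI : intPts (hullZ (bsupp f)) ≤ 1)
    (hn : numPts (hullZ (bsupp f)) ≤ 4) {E : ℕ} (hE : 2 ≤ E)
    (hqE : (12 * E - 5) ^ 2 ≤ Fintype.card F) :
    E * (torusZeros f).card ≤ (E + 1) * (Fintype.card F - 1) := by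
  obtain ⟨p, r, g, n, τ, h1, h2, h3, h4, h5, h6, h7, h8, h9⟩ := exists_stepanovBound
    ((bsupp f).sup fun v => v.1.toNat) f.natDegree f hf hw h0 le_rfl (fun v hv => by
      have : v.1.toNat ≤ _ := Finset.le_sup (f := fun v : ℤ × ℤ => v.1.toNat) hv
      omega)
  refine ((h8.mono (show g ≤ 1 by omega) (show τ ≤ 3 by omega)).exceptional h1 h2 hE hqE).elim
    (fun h => ?_) id
  have e1 : 19 ≤ 12 * E - 5 := by omega
  have e2 : 19 ^ 2 ≤ (12 * E - 5) ^ 2 := Nat.pow_le_pow_left e1 2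
  exact Nat.mul_le_mul (by omega) (by omega)

end Contract

lemma toR2_add (u v : ℤ × ℤ) : toR2 (u + v) = toR2 u + toR2 v := by
  simp [toR2]

lemma toR2_injective : Function.Injective toR2 := by
  rintro ⟨a, b⟩ ⟨c, d⟩ h
  simpa [toR2] using h

lemma toR2_sum {ι : Type*} (s : Finset ι) (v : ι → ℤ × ℤ) :
    toR2 (∑ i ∈ s, v i) = ∑ i ∈ s, toR2 (v i) := by
  classical
  induction s using Finset.induction_on with
  | empty => simp [toR2]
  | insert a s ha ih => rw [Finset.sum_insert ha, Finset.sum_insert ha, toR2_add, ih]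

section Product

variable {F : Type} [Field F]

lemma bsupp_nonempty {f : Biv F} (hf : f ≠ 0) : (bsupp f).Nonempty := by
  obtain ⟨m, hm⟩ : ∃ m, f.coeff m ≠ 0 := by
    by_contra! h
    exact hf (Polynomial.ext (by simpa using h))
  obtain ⟨i, hi⟩ : ∃ i, (f.coeff m).coeff i ≠ 0 := by
    by_contra! h
    exact hm (Polynomial.ext (by simpa using h))
  exact ⟨_, mk_mem_bsupp.2 hi⟩

/-- A sum of support vectors attained only once survives in the support of the product. -/
lemma add_mem_bsupp_mul {g a : Biv F} {u w : ℤ × ℤ} (hu : u ∈ bsupp g) (hw : w ∈ bsupp a)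
    (huniq : ∀ u' ∈ bsupp g, ∀ w' ∈ bsupp a, u' + w' = u + w → u' = u ∧ w' = w) :
    u + w ∈ bsupp (g * a) := by
  obtain ⟨i, m, hi, rfl⟩ := mem_bsupp.1 hu
  obtain ⟨j, n, hj, rfl⟩ := mem_bsupp.1 hw
  have hcast : (((i : ℤ), (m : ℤ)) + ((j : ℤ), (n : ℤ))) = (((i + j : ℕ) : ℤ), ((m + n : ℕ) : ℤ)) := by
    simp
  have key : ∀ i' m' j' n' : ℕ, (g.coeff m').coeff i' ≠ 0 → (a.coeff n').coeff j' ≠ 0 →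
      i' + j' = i + j → m' + n' = m + n → i' = i ∧ m' = m := by
    intro i' m' j' n' h1 h2 h3 h4
    have := (huniq _ (mk_mem_bsupp.2 h1) _ (mk_mem_bsupp.2 h2) (by
      ext
      · simp only [Prod.fst_add]; exact_mod_cast h3
      · simp only [Prod.snd_add]; exact_mod_cast h4)).1
    simpa using this
  rw [hcast, mk_mem_bsupp, coeff_mul, finsetSum_coeff,
    Finset.sum_eq_single (m, n), coeff_mul, Finset.sum_eq_single (i, j)]
  · exact mul_ne_zero hi hj
  · rintro ⟨i', j'⟩ h hne
    rw [Finset.HasAntidiagonal.mem_antidiagonal] at h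
    by_contra hcon
    obtain ⟨h1, h2⟩ := mul_ne_zero_iff.1 hcon
    have := (key i' m j' n h1 h2 h rfl).1
    apply hne
    simp only at h
    ext <;> simp <;> omega
  · intro h
    simp at h
  · rintro ⟨m', n'⟩ h hne
    rw [Finset.HasAntidiagonal.mem_antidiagonal] at h
    rw [coeff_mul]
    refine Finset.sum_eq_zero ?_
    rintro ⟨i', j'⟩ h'
    rw [Finset.HasAntidiagonal.mem_antidiagonal] at h'
    by_contra hcon
    obtain ⟨h1, h2⟩ := mul_ne_zero_iff.1 hcon
    have := (key i' m' j' n' h1 h2 h' h).2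
    apply hne
    simp only at h
    ext <;> simp <;> omega
  · intro h
    simp at h

/-- The Newton polygon of a product contains the Minkowski sum of the Newton polygons. -/
lemma hullZ_add_subset {g a : Biv F} :
    hullZ (bsupp g) + hullZ (bsupp a) ⊆ hullZ (bsupp (g * a)) := by
  rw [hullZ, hullZ, ← convexHull_add]
  refine convexHull_min ?_ (hullZ_convex _)
  rintro _ ⟨_, ⟨u, hu, rfl⟩, _, ⟨w, hw, rfl⟩, rfl⟩
  by_contra hcon
  obtain ⟨φ, s, hs, hs'⟩ := geometric_hahn_banach_closed_point (hullZ_convex (bsupp (g * a)))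
    (hullZ_compact (bsupp (g * a))).isClosed hcon
  let key : ℤ × ℤ → ℝ ×ₗ (ℤ ×ₗ ℤ) := fun v => toLex (φ (toR2 v), toLex v)
  have hkey : ∀ v w, key (v + w) = key v + key w := by
    intro v w
    simp only [key, toR2_add, map_add]
    rfl
  have hinj : Function.Injective key := by
    intro v w h
    have := congrArg (fun x => ofLex (ofLex x).2) h
    simpa [key] using this
  have hfst : ∀ v w, key v ≤ key w → φ (toR2 v) ≤ φ (toR2 w) := by
    intro v w h
    exact Prod.Lex.monotone_fst _ _ h
  obtain ⟨u0, hu0, hmu⟩ := Finset.exists_max_image (bsupp g) key ⟨u, hu⟩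
  obtain ⟨w0, hw0, hmw⟩ := Finset.exists_max_image (bsupp a) key ⟨w, hw⟩
  have hmem : u0 + w0 ∈ bsupp (g * a) := by
    refine add_mem_bsupp_mul hu0 hw0 ?_
    intro u' hu' w' hw' h
    have h1 := hmu u' hu'
    have h2 := hmw w' hw'
    have h3 : key u' + key w' = key u0 + key w0 := by rw [← hkey, ← hkey, h]
    have h4 : key u' = key u0 := by
      by_contra hne
      exact absurd h3 (add_lt_add_of_lt_of_le (lt_of_le_of_ne h1 hne) h2).ne
    have h5 := hinj h4
    subst h5
    exact ⟨rfl, by simpa using h⟩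
  have h1 := hs _ (mem_hullZ hmem)
  have h2 := hfst _ _ (hmu u hu)
  have h3 := hfst _ _ (hmw w hw)
  rw [toR2_add, map_add] at h1
  simp only [map_add] at hs'
  linarith

lemma add_mem_latticePts_mul {g a : Biv F} {u w : ℤ × ℤ}
    (hu : u ∈ latticePts (hullZ (bsupp g))) (hw : w ∈ latticePts (hullZ (bsupp a))) :
    u + w ∈ latticePts (hullZ (bsupp (g * a))) := by
  rw [latticePts, Set.mem_ofPred_eq, toR2_add]
  exact hullZ_add_subset (Set.add_mem_add hu hw)

lemma add_mem_interior_mul {g a : Biv F} {u w : ℤ × ℤ}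
    (hu : u ∈ latticePts (interior (hullZ (bsupp g)))) (hw : w ∈ latticePts (hullZ (bsupp a))) :
    u + w ∈ latticePts (interior (hullZ (bsupp (g * a)))) := by
  rw [latticePts, Set.mem_ofPred_eq, toR2_add]
  have h1 : IsOpen (interior (hullZ (bsupp g)) + {toR2 w}) :=
    isOpen_interior.add_right
  refine interior_maximal ?_ h1 (Set.add_mem_add hu rfl)
  refine (Set.add_subset_add interior_subset ?_).trans hullZ_add_subset
  exact Set.singleton_subset_iff.2 hw

/-- The lattice points of `S` can be moved into `T` by a translation. -/
def FitsIn (S T : Set (ℤ × ℤ)) : Prop := ∃ u, ∀ v ∈ S, v + u ∈ T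

lemma fitsIn_of_dvd {g f : Biv F} (h : g ∣ f) (hf : f ≠ 0) :
    FitsIn (latticePts (hullZ (bsupp g))) (latticePts (hullZ (bsupp f))) := by
  obtain ⟨a, rfl⟩ := h
  obtain ⟨u, hu⟩ := bsupp_nonempty (right_ne_zero_of_mul hf)
  exact ⟨u, fun v hv => add_mem_latticePts_mul hv (mem_hullZ hu)⟩

lemma intPts_le_of_dvd {g f : Biv F} (h : g ∣ f) (hf : f ≠ 0) :
    intPts (hullZ (bsupp g)) ≤ intPts (hullZ (bsupp f)) := by
  obtain ⟨a, rfl⟩ := h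
  obtain ⟨u, hu⟩ := bsupp_nonempty (right_ne_zero_of_mul hf)
  exact Set.ncard_le_ncard_of_injOn (fun v => v + u)
    (fun v hv => add_mem_interior_mul hv (mem_hullZ hu)) (add_left_injective u).injOn
    (latticePts_interior_finite _)

lemma latticePts_subset_box_of_dvd {g f : Biv F} {q : ℕ} (h : g ∣ f) (hf : f ≠ 0)
    (hbox : latticePts (hullZ (bsupp f)) ⊆ box q) : latticePts (hullZ (bsupp g)) ⊆ box q := by
  obtain ⟨a, rfl⟩ := h
  obtain ⟨u, hu⟩ := bsupp_nonempty (right_ne_zero_of_mul hf)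
  intro v hv
  have h1 := hbox (add_mem_latticePts_mul hv (mem_hullZ hu))
  have h2 := bsupp_nonneg hu
  have h3 := hullZ_halfplane (V := bsupp g) (a := -1) (b := 0) (c := 0) (fun v hv => by
    have : (0 : ℝ) ≤ v.1 := by exact_mod_cast (bsupp_nonneg hv).1
    linarith) hv
  have h4 := hullZ_halfplane (V := bsupp g) (a := 0) (b := -1) (c := 0) (fun v hv => by
    have : (0 : ℝ) ≤ v.2 := by exact_mod_cast (bsupp_nonneg hv).2
    linarith) hv
  have h5 : (0 : ℝ) ≤ v.1 := by simpa [toR2] using h3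
  have h6 : (0 : ℝ) ≤ v.2 := by simpa [toR2] using h4
  norm_cast at h5 h6
  simp only [box, Set.mem_ofPred_eq, Prod.fst_add, Prod.snd_add] at h1 ⊢
  omega

end Product

/-- A translate of the sum of `n` finite sets with at least two elements fits in `S`. -/
def DecZ (S : Set (ℤ × ℤ)) (n : ℕ) : Prop :=
  ∃ (V : Fin n → Finset (ℤ × ℤ)) (u : ℤ × ℤ), (∀ i, (V i).Nontrivial) ∧
    ∀ v : Fin n → ℤ × ℤ, (∀ i, v i ∈ V i) → ∑ i, v i + u ∈ S

lemma hullZ_nontrivial {V : Finset (ℤ × ℤ)} (h : V.Nontrivial) : (hullZ V).Nontrivial := by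
  obtain ⟨a, ha, b, hb, hab⟩ := h
  exact ⟨_, mem_hullZ ha, _, mem_hullZ hb, fun h => hab (toR2_injective h)⟩

lemma nontrivial_of_hullZ {V : Finset (ℤ × ℤ)} (h : (hullZ V).Nontrivial) : V.Nontrivial := by
  by_contra hcon
  have h1 : (V : Set (ℤ × ℤ)).Subsingleton := Set.not_nontrivial_iff.1 hcon
  rcases h1.eq_empty_or_singleton with h2 | ⟨x, h2⟩
  · rw [hullZ, h2] at h
    simp at h
  · rw [hullZ, h2] at h
    simp at h

/-- Membership of a Minkowski sum in a convex set may be tested on the generating points. -/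
lemma sum_hullZ_add_mem {n : ℕ} {V : Fin n → Finset (ℤ × ℤ)} {u : ℤ × ℤ} {P : Set (ℝ × ℝ)}
    (hP : Convex ℝ P)
    (h : ∀ v : Fin n → ℤ × ℤ, (∀ i, v i ∈ V i) → ∑ i, v i + u ∈ latticePts P)
    {y : Fin n → ℝ × ℝ} (hy : ∀ i, y i ∈ hullZ (V i)) : ∑ i, y i + toR2 u ∈ P := by
  have h1 : ∑ i, y i ∈ ∑ i, hullZ (V i) := (Set.mem_fintype_sum _ _).2 ⟨y, hy, rfl⟩
  simp only [hullZ] at h1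
  rw [← convexHull_sum] at h1
  have h2 : Convex ℝ {z : ℝ × ℝ | z + toR2 u ∈ P} := hP.translate_preimage_left (toR2 u)
  refine convexHull_min ?_ h2 h1
  intro z hz
  obtain ⟨w, hw, rfl⟩ := (Set.mem_fintype_sum _ _).1 hz
  choose v hv hvw using hw
  have := h v hv
  rw [latticePts, Set.mem_ofPred_eq, toR2_add, toR2_sum] at this
  simp only [hvw] at this
  exact this

lemma HasDecomp.decZ {P : Set (ℝ × ℝ)} {n : ℕ} (h : HasDecomp P n) : DecZ (latticePts P) n := by
  obtain ⟨Q, hQ, hsum⟩ := h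
  choose V hV hQV using fun i => (hQ i).1
  refine ⟨V, 0, fun i => nontrivial_of_hullZ ?_, fun v hv => ?_⟩
  · have := (hQ i).2
    rwa [hQV i] at this
  · rw [add_zero, latticePts, Set.mem_ofPred_eq, toR2_sum]
    refine hsum ((Set.mem_fintype_sum _ _).2 ⟨_, fun i => ?_, rfl⟩)
    rw [hQV i]
    exact mem_hullZ (hv i)

lemma DecZ.hasDecomp {P : Set (ℝ × ℝ)} (hP : Convex ℝ P) {n : ℕ} (h : DecZ (latticePts P) n)
    (hn : 0 < n) : HasDecomp P n := by
  obtain ⟨V, u, hV, hs⟩ := h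
  let i₀ : Fin n := ⟨0, hn⟩
  let t : Fin n → ℤ × ℤ := Pi.single i₀ u
  let W : Fin n → Finset (ℤ × ℤ) := fun i => (V i).image (· + t i)
  have hW : ∀ i, (W i).Nontrivial := by
    intro i
    obtain ⟨a, ha, b, hb, hab⟩ := hV i
    exact ⟨_, Finset.mem_coe.2 (Finset.mem_image_of_mem _ ha), _,
      Finset.mem_coe.2 (Finset.mem_image_of_mem _ hb), fun h => hab (add_right_cancel h)⟩
  refine ⟨fun i => hullZ (W i), fun i => ⟨⟨W i, (hW i).nonempty, rfl⟩, hullZ_nontrivial (hW i)⟩, ?_⟩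
  intro z hz
  obtain ⟨y, hy, rfl⟩ := (Set.mem_fintype_sum _ _).1 hz
  have := sum_hullZ_add_mem (u := 0) hP (fun v hv => ?_) (fun i => hy i)
  · have h0 : toR2 0 = 0 := by simp [toR2]
    rwa [h0, add_zero] at this
  · choose w hw hwv using fun i => Finset.mem_image.1 (hv i)
    have h1 := hs w hw
    have h2 : ∑ i, v i + 0 = ∑ i, w i + u := by
      simp only [← hwv, Finset.sum_add_distrib, add_zero]
      simp [t]
    rwa [h2]

lemma DecZ.of_fitsIn {S T : Set (ℤ × ℤ)} {n : ℕ} (h : DecZ S n) (hST : FitsIn S T) : DecZ T n := by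
  obtain ⟨V, u, hV, hs⟩ := h
  obtain ⟨t, ht⟩ := hST
  exact ⟨V, u + t, hV, fun v hv => by rw [← add_assoc]; exact ht _ (hs v hv)⟩

lemma DecZ.of_segment {S : Set (ℤ × ℤ)} {u d : ℤ × ℤ} (hd : d ≠ 0) {n : ℕ}
    (h : ∀ k : ℕ, k ≤ n → u + k • d ∈ S) : DecZ S n := by
  refine ⟨fun _ => {0, d}, u, fun i => ⟨0, by simp, d, by simp, hd.symm⟩, fun v hv => ?_⟩
  have h1 : ∀ i, v i = (if v i = d then 1 else 0 : ℕ) • d := by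
    intro i
    have := hv i
    simp only [Finset.mem_insert, Finset.mem_singleton] at this
    split_ifs with h2
    · simp [h2]
    · simpa using this.resolve_right h2
  rw [Finset.sum_congr rfl fun i _ => h1 i, ← Finset.sum_smul, add_comm]
  refine h _ ?_
  refine (Finset.sum_le_sum (g := fun _ => 1) fun i _ => by split_ifs <;> simp).trans ?_
  simp

lemma DecZ.of_parallelogram {S : Set (ℤ × ℤ)} {u d e : ℤ × ℤ} (hd : d ≠ 0) (he : e ≠ 0)
    (h0 : u ∈ S) (h1 : u + d ∈ S) (h2 : u + e ∈ S) (h3 : u + d + e ∈ S) : DecZ S 2 := by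
  refine ⟨![{0, d}, {0, e}], u, ?_, fun v hv => ?_⟩
  · intro i
    fin_cases i
    · exact ⟨0, by simp, d, by simp, hd.symm⟩
    · exact ⟨0, by simp, e, by simp, he.symm⟩
  · have hv0 := hv 0
    have hv1 := hv 1
    simp only [Matrix.cons_val_zero, Matrix.cons_val_one, Finset.mem_insert,
      Finset.mem_singleton] at hv0 hv1
    rw [Fin.sum_univ_two]
    rcases hv0 with a | a <;> rcases hv1 with b | b <;> rw [a, b]
    · simpa using h0
    · rw [zero_add, add_comm]; exact h2
    · rw [add_zero, add_comm]; exact h1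
    · rw [add_comm, ← add_assoc]; exact h3

/-- Lattice points on the segment between two lattice points of a convex set. -/
lemma lattice_segment {P : Set (ℝ × ℝ)} (hP : Convex ℝ P) {u d : ℤ × ℤ} {n : ℕ} (hn : 0 < n)
    (h0 : u ∈ latticePts P) (h1 : u + n • d ∈ latticePts P) {k : ℕ} (hk : k ≤ n) :
    u + k • d ∈ latticePts P := by
  have hn' : (0 : ℝ) < n := by exact_mod_cast hn
  have hk' : (k : ℝ) ≤ n := by exact_mod_cast hk
  have := hP h0 h1 (a := (n - k) / n) (b := k / n) (div_nonneg (by linarith) hn'.le)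
    (by positivity) (by field_simp; ring)
  have he : toR2 (u + k • d) = ((n - k) / n : ℝ) • toR2 u + (k / n : ℝ) • toR2 (u + n • d) := by
    ext
    · simp [toR2]; field_simp; ring
    · simp [toR2]; field_simp; ring
  rw [latticePts, Set.mem_ofPred_eq, he]
  exact this

lemma numPts_le_of_not_decZ {V : Finset (ℤ × ℤ)} {n : ℕ} (hn : 0 < n)
    (h : ¬ DecZ (latticePts (hullZ V)) n) : numPts (hullZ V) ≤ n ^ 2 := by
  by_contra! hcon
  have : NeZero n := ⟨hn.ne'⟩
  rw [numPts, Set.ncard_eq_toFinset_card _ (latticePts_hullZ_finite V)] at hcon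
  obtain ⟨a, ha, b, hb, hab, he⟩ := Finset.exists_ne_map_eq_of_card_lt_of_maps_to
    (s := (latticePts_hullZ_finite V).toFinset) (t := (Finset.univ : Finset (ZMod n × ZMod n)))
    (f := fun v => ((v.1 : ZMod n), (v.2 : ZMod n)))
    (by simpa [ZMod.card, pow_two] using hcon) (fun _ _ => Finset.mem_coe.2 (Finset.mem_univ _))
  rw [Set.Finite.mem_toFinset] at ha hb
  simp only [Prod.mk.injEq, ZMod.intCast_eq_intCast_iff, Int.modEq_iff_dvd] at he
  obtain ⟨⟨x, hx⟩, y, hy⟩ := he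
  have hbd : b = a + n • ((x, y) : ℤ × ℤ) := by
    ext
    · simp; linarith
    · simp; linarith
  refine h (DecZ.of_segment (u := a) (d := (x, y)) ?_ fun k hk =>
    lattice_segment (hullZ_convex V) hn ha (hbd ▸ hb) hk)
  intro h0
  rw [h0, smul_zero, add_zero] at hbd
  exact hab hbd.symm

section Codewords

variable {F : Type} [Field F]

/-- The coefficient of the monomial with exponent vector `v`. -/
noncomputable def bcoef (f : Biv F) (v : ℤ × ℤ) : F :=
  if v ∈ bsupp f then (f.coeff v.2.toNat).coeff v.1.toNat else 0

lemma bcoef_ne_zero {f : Biv F} {v : ℤ × ℤ} (h : v ∈ bsupp f) : bcoef f v ≠ 0 := by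
  rw [bcoef, if_pos h]
  obtain ⟨i, m, hi, rfl⟩ := mem_bsupp.1 h
  simpa using hi

/-- The values of a polynomial on the torus. -/
noncomputable def cw (f : Biv F) : Fˣ × Fˣ → F := fun p => f.evalEval (p.1 : F) (p.2 : F)

lemma cw_add (f g : Biv F) : cw (f + g) = cw f + cw g := by
  ext p
  simp [cw, evalEval_add]

lemma cw_smul (c : F) (f : Biv F) : cw (c • f) = c • cw f := by
  ext p
  have : c • f = CC c * f := by
    ext m i
    simp [coeff_smul]
  simp [cw, this, evalEval_mul, evalEval_C]

lemma cw_mono {v : ℤ × ℤ} (h1 : 0 ≤ v.1) (h2 : 0 ≤ v.2) :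
    cw (mono F v.1.toNat v.2.toNat) = evalVec F v := by
  obtain ⟨a, ha⟩ := Int.eq_ofNat_of_zero_le h1
  obtain ⟨b, hb⟩ := Int.eq_ofNat_of_zero_le h2
  ext p
  rw [cw, evalEval_mono, evalVec, ha, hb]
  simp

lemma eq_sum_mono (f : Biv F) {T : Finset (ℤ × ℤ)} (hT : bsupp f ⊆ T) :
    f = ∑ v ∈ T, bcoef f v • mono F v.1.toNat v.2.toNat := by
  classical
  rw [← Finset.sum_subset hT (fun v _ hv => by rw [bcoef, if_neg hv, zero_smul])]
  ext m i
  rw [finsetSum_coeff, finsetSum_coeff]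
  have h1 : ∀ v ∈ bsupp f, ((bcoef f v • mono F v.1.toNat v.2.toNat).coeff m).coeff i =
      if ((i : ℤ), (m : ℤ)) = v then (f.coeff m).coeff i else 0 := by
    intro v hv
    obtain ⟨j, n, hj, rfl⟩ := mem_bsupp.1 hv
    rw [bcoef, if_pos hv]
    simp only [Int.toNat_natCast, mono, coeff_smul, coeff_monomial, Prod.mk.injEq,
      Nat.cast_inj, smul_eq_mul]
    by_cases hm : n = m
    · by_cases hi : j = i
      · simp [hm, hi]
      · simp [hm, hi, coeff_monomial, Ne.symm hi]
    · simp [hm, Ne.symm hm]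
  rw [Finset.sum_congr rfl h1, Finset.sum_ite_eq]
  split_ifs with h
  · rfl
  · by_contra hne
    exact h (mk_mem_bsupp.2 hne)

lemma cw_eq_sum (f : Biv F) {T : Finset (ℤ × ℤ)} (hT : bsupp f ⊆ T) :
    cw f = ∑ v ∈ T, bcoef f v • evalVec F v := by
  have hsum : ∀ (s : Finset (ℤ × ℤ)) (h : ℤ × ℤ → Biv F), cw (∑ v ∈ s, h v) = ∑ v ∈ s, cw (h v) := by
    intro s h
    classical
    induction s using Finset.induction_on with
    | empty => ext p; simp [cw]
    | insert a s ha ih => rw [Finset.sum_insert ha, Finset.sum_insert ha, cw_add, ih]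
  conv_lhs => rw [eq_sum_mono f hT]
  rw [hsum]
  refine Finset.sum_congr rfl fun v _ => ?_
  rw [cw_smul]
  by_cases hv : v ∈ bsupp f
  · rw [cw_mono (bsupp_nonneg hv).1 (bsupp_nonneg hv).2]
  · rw [bcoef, if_neg hv, zero_smul, zero_smul]

lemma cw_mem_toricCode {f : Biv F} {S : Set (ℤ × ℤ)} (h : ↑(bsupp f) ⊆ S) :
    cw f ∈ toricCode F S := by
  rw [cw_eq_sum f subset_rfl]
  exact Submodule.sum_mem _ fun v hv => Submodule.smul_mem _ _
    (Submodule.subset_span ⟨v, h hv, rfl⟩)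

lemma bsupp_subset_iff {f : Biv F} {S : Set (ℤ × ℤ)} : ↑(bsupp f) ⊆ S ↔ f ∈ VS F S := by
  rw [mem_VS]
  constructor
  · intro h m i hmi
    exact h (mk_mem_bsupp.2 hmi)
  · intro h v hv
    obtain ⟨i, m, hi, rfl⟩ := mem_bsupp.1 hv
    exact h m i hi

lemma exists_cw_of_mem {S : Set (ℤ × ℤ)} (hS : ∀ v ∈ S, 0 ≤ v.1 ∧ 0 ≤ v.2)
    {c : Fˣ × Fˣ → F} (hc : c ∈ toricCode F S) : ∃ f : Biv F, ↑(bsupp f) ⊆ S ∧ cw f = c := by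
  simp only [bsupp_subset_iff]
  induction hc using Submodule.span_induction with
  | mem x h =>
    obtain ⟨v, hv, rfl⟩ := h
    refine ⟨_, mono_mem_VS ?_, cw_mono (hS v hv).1 (hS v hv).2⟩
    rwa [Int.toNat_of_nonneg (hS v hv).1, Int.toNat_of_nonneg (hS v hv).2]
  | zero => exact ⟨0, zero_mem _, by ext p; simp [cw]⟩
  | add x y _ _ hx hy =>
    obtain ⟨f, hf, rfl⟩ := hx
    obtain ⟨g, hg, rfl⟩ := hy
    exact ⟨f + g, add_mem hf hg, cw_add f g⟩
  | smul a x _ hx =>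
    obtain ⟨f, hf, rfl⟩ := hx
    exact ⟨a • f, Submodule.smul_mem _ _ hf, cw_smul a f⟩

variable [Fintype F]

lemma poly_eq_zero_of_units {h : F[X]} (hdeg : ∀ i, h.coeff i ≠ 0 → (i : ℤ) ≤ (Fintype.card F : ℤ) - 2)
    (hz : ∀ x : Fˣ, h.eval (x : F) = 0) : h = 0 := by
  classical
  by_contra hne
  have h1 : h.natDegree < Fintype.card Fˣ := by
    have := hdeg h.natDegree (by simpa using hne)
    rw [Fintype.card_units]
    omega
  refine hne (eq_zero_of_natDegree_lt_card_of_eval_eq_zero h (f := fun x : Fˣ => (x : F))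
    Units.val_injective hz h1)

lemma eq_zero_of_cw_eq_zero {f : Biv F} (hf : ↑(bsupp f) ⊆ box (Fintype.card F)) (h : cw f = 0) :
    f = 0 := by
  have h1 : ∀ x : Fˣ, f.map (evalRingHom (x : F)) = 0 := by
    intro x
    refine poly_eq_zero_of_units ?_ ?_
    · intro m hm
      rw [coeff_map] at hm
      have hm' : f.coeff m ≠ 0 := by
        intro h0
        rw [h0] at hm
        simp at hm
      obtain ⟨i, hi⟩ : ∃ i, (f.coeff m).coeff i ≠ 0 := by
        by_contra! h
        exact hm' (Polynomial.ext (by simpa using h))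
      exact (hf (mk_mem_bsupp.2 hi)).2.2.2
    · intro y
      have := congrFun h (x, y)
      simp only [cw, Pi.zero_apply] at this
      rw [← this, eval_map, ← eval₂_evalRingHom]
  refine Polynomial.ext fun m => ?_
  rw [coeff_zero]
  refine poly_eq_zero_of_units ?_ ?_
  · intro i hi
    exact (hf (mk_mem_bsupp.2 hi)).2.1
  · intro x
    have := congrArg (fun g => g.coeff m) (h1 x)
    simpa using this

lemma card_torusZeros_eq (f : Biv F) :
    (torusZeros f).card = {p : Fˣ × Fˣ | cw f p = 0}.ncard := by
  rw [← Set.ncard_coe_finset]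
  symm
  refine Set.ncard_congr (fun p _ => ((p.1 : F), (p.2 : F))) ?_ ?_ ?_
  · intro p hp
    exact mem_torusZeros.2 ⟨p.1.ne_zero, p.2.ne_zero, hp⟩
  · intro p p' _ _ h
    simp only [Prod.mk.injEq, Units.val_inj] at h
    exact Prod.ext h.1 h.2
  · rintro ⟨x, y⟩ h
    obtain ⟨hx, hy, h0⟩ := mem_torusZeros.1 (Finset.mem_coe.1 h)
    exact ⟨(Units.mk0 x hx, Units.mk0 y hy), h0, rfl⟩

lemma wt_add_card_torusZeros (f : Biv F) :
    wt (cw f) + (torusZeros f).card = (Fintype.card F - 1) ^ 2 := by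
  classical
  rw [card_torusZeros_eq, wt]
  have h1 : {p : Fˣ × Fˣ | cw f p = 0} = {p | cw f p ≠ 0}ᶜ := by
    ext p
    simp
  rw [h1, Set.ncard_add_ncard_compl, Nat.card_eq_fintype_card, Fintype.card_prod,
    Fintype.card_units, pow_two]

lemma minDist_add_card_le {S : Set (ℤ × ℤ)} (hS : S ⊆ box (Fintype.card F)) {f : Biv F}
    (hf : f ≠ 0) (hfS : ↑(bsupp f) ⊆ S) :
    minDist F (toricCode F S) + (torusZeros f).card ≤ (Fintype.card F - 1) ^ 2 := by
  rw [← wt_add_card_torusZeros f]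
  have h0 : cw f ≠ 0 := fun h => hf (eq_zero_of_cw_eq_zero (hfS.trans hS) h)
  have h1 : minDist F (toricCode F S) ≤ wt (cw f) :=
    Nat.sInf_le ⟨cw f, cw_mem_toricCode hfS, h0, rfl⟩
  omega

lemma exists_minDist_eq {S : Set (ℤ × ℤ)} (hS : S ⊆ box (Fintype.card F)) (hne : S.Nonempty) :
    ∃ f : Biv F, f ≠ 0 ∧ ↑(bsupp f) ⊆ S ∧
      minDist F (toricCode F S) + (torusZeros f).card = (Fintype.card F - 1) ^ 2 := by
  obtain ⟨v, hv⟩ := hne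
  have hnn : ∀ v ∈ S, 0 ≤ v.1 ∧ 0 ≤ v.2 := fun v hv => ⟨(hS hv).1, (hS hv).2.2.1⟩
  have h1 : {w | ∃ c ∈ toricCode F S, c ≠ 0 ∧ wt c = w}.Nonempty := by
    refine ⟨_, evalVec F v, Submodule.subset_span ⟨v, hv, rfl⟩, ?_, rfl⟩
    intro h
    have := congrFun h 1
    simp [evalVec] at this
  obtain ⟨c, hc, hc0, hw⟩ := Nat.sInf_mem h1
  obtain ⟨f, hfS, rfl⟩ := exists_cw_of_mem hnn hc
  refine ⟨f, ?_, hfS, ?_⟩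
  · rintro rfl
    exact hc0 (by ext p; simp [cw])
  · rw [minDist, ← hw, wt_add_card_torusZeros]

end Codewords

/-- The determinant of two lattice vectors. -/
def det2 (d e : ℤ × ℤ) : ℤ := d.1 * e.2 - d.2 * e.1

/-- The character of the torus with exponent vector `d`. -/
def torusChar {F : Type} [Field F] (d : ℤ × ℤ) (p : Fˣ × Fˣ) : Fˣ := p.1 ^ d.1 * p.2 ^ d.2

section Characters

variable {F : Type} [Field F]

lemma torusChar_add (d e : ℤ × ℤ) (p : Fˣ × Fˣ) :
    torusChar (d + e) p = torusChar d p * torusChar e p := by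
  simp only [torusChar, Prod.fst_add, Prod.snd_add, zpow_add]
  exact mul_mul_mul_comm _ _ _ _

lemma evalVec_eq_torusChar (d : ℤ × ℤ) (p : Fˣ × Fˣ) : evalVec F d p = (torusChar d p : Fˣ) := rfl

lemma torus_ext_of_det {d e : ℤ × ℤ} (hdet : IsUnit (det2 d e)) {p p' : Fˣ × Fˣ}
    (hd : torusChar d p = torusChar d p') (he : torusChar e p = torusChar e p') : p = p' := by
  have h1 : ∀ p : Fˣ × Fˣ, torusChar d p ^ e.2 * torusChar e p ^ (-d.2) = p.1 ^ det2 d e := by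
    intro p
    simp only [torusChar, mul_zpow, ← zpow_mul, det2]
    rw [mul_mul_mul_comm, ← zpow_add, ← zpow_add]
    have : d.2 * e.2 + e.2 * -d.2 = 0 := by ring
    rw [this, zpow_zero, mul_one]
    congr 1
    ring
  have h2 : ∀ p : Fˣ × Fˣ, torusChar d p ^ (-e.1) * torusChar e p ^ d.1 = p.2 ^ det2 d e := by
    intro p
    simp only [torusChar, mul_zpow, ← zpow_mul, det2]
    rw [mul_mul_mul_comm, ← zpow_add, ← zpow_add]
    have : d.1 * -e.1 + e.1 * d.1 = 0 := by ring
    rw [this, zpow_zero, one_mul]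
    congr 1
    ring
  have h3 : p.1 ^ det2 d e = p'.1 ^ det2 d e := by rw [← h1, ← h1, hd, he]
  have h4 : p.2 ^ det2 d e = p'.2 ^ det2 d e := by rw [← h2, ← h2, hd, he]
  rcases Int.isUnit_iff.1 hdet with h | h <;> rw [h] at h3 h4
  · exact Prod.ext (by simpa using h3) (by simpa using h4)
  · exact Prod.ext (by simpa using h3) (by simpa using h4)

variable [Fintype F]

/-- A curve supported on a unimodular triangle has at most `q - 1` points in the torus. -/
lemma card_torusZeros_le_of_unimodular {f : Biv F} {a b c : ℤ × ℤ}
    (hf : bsupp f ⊆ {a, b, c}) (hb : b ∈ bsupp f) (hdet : IsUnit (det2 (b - a) (c - a))) :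
    (torusZeros f).card ≤ Fintype.card F - 1 := by
  classical
  rw [card_torusZeros_eq]
  have hab : a ≠ b := by
    rintro rfl
    simp [det2] at hdet
  have hac : a ≠ c := by
    rintro rfl
    simp [det2] at hdet
  have hbc : b ≠ c := by
    rintro rfl
    simp [det2, mul_comm] at hdet
  have hval : ∀ p : Fˣ × Fˣ, cw f p = (torusChar a p : F) *
      (bcoef f a + bcoef f b * torusChar (b - a) p + bcoef f c * torusChar (c - a) p) := by
    intro p
    have hb' : torusChar b p = torusChar a p * torusChar (b - a) p := by
      rw [← torusChar_add, add_sub_cancel]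
    have hc' : torusChar c p = torusChar a p * torusChar (c - a) p := by
      rw [← torusChar_add, add_sub_cancel]
    rw [cw_eq_sum f hf, Finset.sum_insert (by simp [hab, hac]), Finset.sum_insert (by simp [hbc]),
      Finset.sum_singleton]
    simp only [Pi.add_apply, Pi.smul_apply, evalVec_eq_torusChar, smul_eq_mul, hb', hc',
      Units.val_mul]
    ring
  have h1 : {p : Fˣ × Fˣ | cw f p = 0}.ncard ≤ (Set.univ : Set Fˣ).ncard := by
    refine Set.ncard_le_ncard_of_injOn (torusChar (c - a)) (fun _ _ => Set.mem_univ _) ?_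
    intro p hp p' hp' h
    simp only [Set.mem_ofPred_eq, hval, mul_eq_zero, Units.ne_zero, false_or] at hp hp'
    refine torus_ext_of_det hdet ?_ h
    have h2 : bcoef f b * torusChar (b - a) p = bcoef f b * torusChar (b - a) p' := by
      rw [h] at hp
      linear_combination hp - hp'
    exact Units.ext (mul_left_cancel₀ (bcoef_ne_zero hb) h2)
  refine h1.trans ?_
  rw [Set.ncard_univ, Nat.card_eq_fintype_card, Fintype.card_units]

end Characters

/-- The lattice point `e` lies in the triangle with vertices `a`, `b`, `c`. -/
def InTri (a b c e : ℤ × ℤ) : Prop :=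
  ∃ α β γ : ℝ, 0 ≤ α ∧ 0 ≤ β ∧ 0 ≤ γ ∧ α + β + γ = 1 ∧
    toR2 e = α • toR2 a + β • toR2 b + γ • toR2 c

lemma InTri.rotate {a b c e : ℤ × ℤ} (h : InTri a b c e) : InTri b c a e := by
  obtain ⟨α, β, γ, hα, hβ, hγ, h1, h2⟩ := h
  exact ⟨β, γ, α, hβ, hγ, hα, by linarith, by rw [h2]; abel⟩

lemma InTri.mem {P : Set (ℝ × ℝ)} (hP : Convex ℝ P) {a b c e : ℤ × ℤ} (h : InTri a b c e)
    (ha : a ∈ latticePts P) (hb : b ∈ latticePts P) (hc : c ∈ latticePts P) :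
    e ∈ latticePts P := by
  obtain ⟨α, β, γ, hα, hβ, hγ, h1, h2⟩ := h
  have := hP.sum_mem (t := Finset.univ) (w := ![α, β, γ]) (z := ![toR2 a, toR2 b, toR2 c])
    (by simp [Fin.forall_fin_succ, hα, hβ, hγ]) (by simp [Fin.sum_univ_three, h1])
    (by simp only [Finset.mem_univ, Fin.forall_fin_succ]; exact ⟨fun _ => ha, fun _ => hb, fun _ => hc, by simp⟩)
  rw [latticePts, Set.mem_ofPred_eq, h2]
  simpa [Fin.sum_univ_three] using this

/-- A lattice triangle that is not unimodular contains a lattice point besides its vertices. -/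
lemma exists_inTri {a b c : ℤ × ℤ} (h0 : det2 (b - a) (c - a) ≠ 0)
    (h1 : ¬ IsUnit (det2 (b - a) (c - a))) :
    ∃ e, e ≠ a ∧ e ≠ b ∧ e ≠ c ∧ InTri a b c e := by
  obtain ⟨d, hd⟩ : ∃ d, d = b - a := ⟨_, rfl⟩
  obtain ⟨e, he⟩ : ∃ e, e = c - a := ⟨_, rfl⟩
  obtain rfl : b = a + d := by rw [hd]; abel
  obtain rfl : c = a + e := by rw [he]; abel
  rw [← hd, ← he] at h0 h1
  clear hd he
  have hD : (det2 d e : ℝ) ≠ 0 := by exact_mod_cast h0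
  have hDe : (det2 d e : ℝ) = d.1 * e.2 - d.2 * e.1 := by simp [det2]
  have hcoord : ∀ x y x' y' : ℝ, x * d.1 + y * e.1 = x' * d.1 + y' * e.1 →
      x * d.2 + y * e.2 = x' * d.2 + y' * e.2 → x = x' ∧ y = y' := by
    intro x y x' y' h2 h3
    constructor
    · apply mul_right_cancel₀ hD
      rw [hDe]
      linear_combination e.2 * h2 - e.1 * h3
    · apply mul_right_cancel₀ hD
      rw [hDe]
      linear_combination d.1 * h3 - d.2 * h2
  have hex : ∃ v : ℤ × ℤ, ¬ ∃ x y : ℤ, x * d.1 + y * e.1 = v.1 ∧ x * d.2 + y * e.2 = v.2 := by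
    by_contra! hcon
    obtain ⟨x, y, h2, h3⟩ := hcon (1, 0)
    obtain ⟨x', y', h4, h5⟩ := hcon (0, 1)
    refine h1 (IsUnit.of_mul_eq_one (x * y' - y * x') ?_)
    simp only [det2] at *
    have : (x * d.1 + y * e.1) * (x' * d.2 + y' * e.2) - (x * d.2 + y * e.2) * (x' * d.1 + y' * e.1) = 1 := by
      rw [h2, h3, h4, h5]; norm_num
    linear_combination this
  obtain ⟨v, hv⟩ := hex
  obtain ⟨x, hx⟩ : ∃ x : ℝ, x = (v.1 * e.2 - v.2 * e.1) / det2 d e := ⟨_, rfl⟩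
  obtain ⟨y, hy⟩ : ∃ y : ℝ, y = (d.1 * v.2 - d.2 * v.1) / det2 d e := ⟨_, rfl⟩
  have hv1 : x * d.1 + y * e.1 = v.1 := by
    rw [hx, hy]; field_simp; rw [hDe]; ring
  have hv2 : x * d.2 + y * e.2 = v.2 := by
    rw [hx, hy]; field_simp; rw [hDe]; ring
  have hxf := Int.floor_add_fract x
  have hyf := Int.floor_add_fract y
  have hx0 := Int.fract_nonneg x
  have hy0 := Int.fract_nonneg y
  have hx1 := Int.fract_lt_one x
  have hy1 := Int.fract_lt_one y
  have hne : ¬ (Int.fract x = 0 ∧ Int.fract y = 0) := by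
    rintro ⟨h2, h3⟩
    rw [h2, add_zero] at hxf
    rw [h3, add_zero] at hyf
    refine hv ⟨⌊x⌋, ⌊y⌋, ?_, ?_⟩
    · have : (⌊x⌋ * d.1 + ⌊y⌋ * e.1 : ℝ) = v.1 := by
        linear_combination hv1 + d.1 * hxf + e.1 * hyf
      exact_mod_cast this
    · have : (⌊x⌋ * d.2 + ⌊y⌋ * e.2 : ℝ) = v.2 := by
        linear_combination hv2 + d.2 * hxf + e.2 * hyf
      exact_mod_cast this
  have main : ∀ (w : ℤ × ℤ) (s t : ℝ), s * d.1 + t * e.1 = w.1 → s * d.2 + t * e.2 = w.2 →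
      0 ≤ s → 0 ≤ t → s < 1 → t < 1 → ¬ (s = 0 ∧ t = 0) → s + t ≤ 1 →
      ∃ z, z ≠ a ∧ z ≠ a + d ∧ z ≠ a + e ∧ InTri a (a + d) (a + e) z := by
    intro w s t hw1 hw2 hs ht hs1 ht1 hst0 hst
    refine ⟨a + w, ?_, ?_, ?_, 1 - s - t, s, t, by linarith, hs, ht, by ring, ?_⟩
    · intro h
      have hw : w = 0 := by simpa using h
      rw [hw] at hw1 hw2
      exact hst0 (hcoord s t 0 0 (by simpa using hw1) (by simpa using hw2))
    · intro h
      have hw : w = d := by simpa using h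
      rw [hw] at hw1 hw2
      exact hs1.ne (hcoord s t 1 0 (by simpa using hw1) (by simpa using hw2)).1
    · intro h
      have hw : w = e := by simpa using h
      rw [hw] at hw1 hw2
      exact ht1.ne (hcoord s t 0 1 (by simpa using hw1) (by simpa using hw2)).2
    · ext
      · simp [toR2, ← hw1]; ring
      · simp [toR2, ← hw2]; ring
  rcases le_or_gt (Int.fract x + Int.fract y) 1 with hle | hgt
  · refine main (v.1 - ⌊x⌋ * d.1 - ⌊y⌋ * e.1, v.2 - ⌊x⌋ * d.2 - ⌊y⌋ * e.2) _ _ ?_ ?_ hx0 hy0 hx1 hy1 hne hle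
    · push_cast; rw [← hv1, Int.fract, Int.fract]; ring
    · push_cast; rw [← hv2, Int.fract, Int.fract]; ring
  · refine main (d.1 + e.1 - (v.1 - ⌊x⌋ * d.1 - ⌊y⌋ * e.1), d.2 + e.2 - (v.2 - ⌊x⌋ * d.2 - ⌊y⌋ * e.2))
      (1 - Int.fract x) (1 - Int.fract y) ?_ ?_ (by linarith) (by linarith) (by linarith) (by linarith)
      (by rintro ⟨h2, h3⟩; linarith) (by linarith)
    · push_cast; rw [← hv1, Int.fract, Int.fract]; ring
    · push_cast; rw [← hv2, Int.fract, Int.fract]; ring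

lemma eq_zero_of_not_decZ {P : Set (ℝ × ℝ)} (hP : Convex ℝ P) (h : ¬ DecZ (latticePts P) 2)
    {a d : ℤ × ℤ} (ha : a ∈ latticePts P) (hb : a + 2 • d ∈ latticePts P) : d = 0 := by
  by_contra hd
  exact h (DecZ.of_segment hd fun k hk => lattice_segment hP two_pos ha hb hk)

lemma not_even_of_not_decZ {P : Set (ℝ × ℝ)} (hP : Convex ℝ P) (h : ¬ DecZ (latticePts P) 2)
    {a b : ℤ × ℤ} (ha : a ∈ latticePts P) (hb : b ∈ latticePts P) (hab : a ≠ b) :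
    ¬ (2 ∣ b.1 - a.1 ∧ 2 ∣ b.2 - a.2) := by
  rintro ⟨⟨x, hx⟩, y, hy⟩
  have hb' : b = a + 2 • ((x, y) : ℤ × ℤ) := by
    ext
    · simp; omega
    · simp; omega
  have := eq_zero_of_not_decZ hP h ha (hb' ▸ hb)
  rw [this] at hb'
  exact hab (by simpa using hb'.symm)

lemma det2_odd {P : Set (ℝ × ℝ)} (hP : Convex ℝ P) (h : ¬ DecZ (latticePts P) 2)
    {a b c : ℤ × ℤ} (ha : a ∈ latticePts P) (hb : b ∈ latticePts P) (hc : c ∈ latticePts P)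
    (hab : a ≠ b) (hac : a ≠ c) (hbc : b ≠ c) : Odd (det2 (b - a) (c - a)) := by
  have h1 := not_even_of_not_decZ hP h ha hb hab
  have h2 := not_even_of_not_decZ hP h ha hc hac
  have h3 := not_even_of_not_decZ hP h hb hc hbc
  obtain ⟨x, hx⟩ : ∃ x, x = b.1 - a.1 := ⟨_, rfl⟩
  obtain ⟨y, hy⟩ : ∃ y, y = b.2 - a.2 := ⟨_, rfl⟩
  obtain ⟨z, hz⟩ : ∃ z, z = c.1 - a.1 := ⟨_, rfl⟩
  obtain ⟨w, hw⟩ : ∃ w, w = c.2 - a.2 := ⟨_, rfl⟩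
  have h3' : ¬ (2 ∣ z - x ∧ 2 ∣ w - y) := by
    intro h
    apply h3
    rw [hx, hy, hz, hw] at h
    simpa using h
  simp only [det2, Prod.fst_sub, Prod.snd_sub]
  rw [← hx, ← hy] at h1 ⊢
  rw [← hz, ← hw] at h2 ⊢
  rw [← even_iff_two_dvd, ← even_iff_two_dvd] at h1 h2
  rw [← even_iff_two_dvd, ← even_iff_two_dvd, Int.even_sub, Int.even_sub] at h3'
  rw [← Int.not_even_iff_odd, Int.even_sub, Int.even_mul, Int.even_mul]
  tauto

lemma InTri.vertex_notMem_interior {V : Finset (ℤ × ℤ)} {a b c e : ℤ × ℤ}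
    (hV : ∀ v ∈ V, v = a ∨ v = b ∨ v = c ∨ v = e) (h : InTri a b c e)
    (hdet : det2 (b - a) (c - a) ≠ 0) : a ∉ latticePts (interior (hullZ V)) := by
  intro ha
  have hD : (det2 (b - a) (c - a) : ℝ) ≠ 0 := by exact_mod_cast hdet
  have hDe : (det2 (b - a) (c - a) : ℝ) =
      (b.1 - a.1) * (c.2 - a.2) - (b.2 - a.2) * (c.1 - a.1) := by simp [det2]
  obtain ⟨D, hDdef⟩ : ∃ D : ℝ, D = det2 (b - a) (c - a) := ⟨_, rfl⟩
  rw [← hDdef] at hD hDe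
  obtain ⟨α, β, γ, hα, hβ, hγ, h1, h2⟩ := h
  have he1 : (e.1 : ℝ) = α * a.1 + β * b.1 + γ * c.1 := by
    have := congrArg Prod.fst h2; simpa [toR2] using this
  have he2 : (e.2 : ℝ) = α * a.2 + β * b.2 + γ * c.2 := by
    have := congrArg Prod.snd h2; simpa [toR2] using this
  have hα' : α = 1 - β - γ := by linarith
  have key := interior_halfplane_lt (V := V) (a := -(((c.2 : ℝ) - b.2) / D))
    (b := -(((b.1 : ℝ) - c.1) / D))
    (c := -(((c.2 : ℝ) - b.2) / D) * a.1 + -(((b.1 : ℝ) - c.1) / D) * a.2) ?_ ?_ ha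
  · simp [toR2] at key
  · intro h0
    simp only [Prod.mk.injEq, neg_eq_zero, div_eq_zero_iff, hD, or_false, sub_eq_zero] at h0
    apply hD
    rw [hDe]
    rw [h0.1, h0.2]
    ring
  · have hb : (-(((c.2 : ℝ) - b.2) / D) * b.1 + -(((b.1 : ℝ) - c.1) / D) * b.2) =
        (-(((c.2 : ℝ) - b.2) / D) * a.1 + -(((b.1 : ℝ) - c.1) / D) * a.2) - 1 := by
      field_simp
      rw [hDe]
      ring
    have hc : (-(((c.2 : ℝ) - b.2) / D) * c.1 + -(((b.1 : ℝ) - c.1) / D) * c.2) =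
        (-(((c.2 : ℝ) - b.2) / D) * a.1 + -(((b.1 : ℝ) - c.1) / D) * a.2) - 1 := by
      field_simp
      rw [hDe]
      ring
    intro v hv
    rcases hV v hv with rfl | rfl | rfl | rfl
    · exact le_rfl
    · linarith
    · linarith
    · rw [he1, he2, hα']
      have : -(((c.2 : ℝ) - b.2) / D) * ((1 - β - γ) * a.1 + β * b.1 + γ * c.1) +
          -(((b.1 : ℝ) - c.1) / D) * ((1 - β - γ) * a.2 + β * b.2 + γ * c.2) =
          -(((c.2 : ℝ) - b.2) / D) * a.1 + -(((b.1 : ℝ) - c.1) / D) * a.2 - (β + γ) := by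
        linear_combination β * hb + γ * hc
      rw [this]
      linarith

lemma mem_interior_of_barycentric {V : Finset (ℤ × ℤ)} {a b c e : ℤ × ℤ}
    (ha : a ∈ V) (hb : b ∈ V) (hc : c ∈ V)
    (hdet : det2 (b - a) (c - a) ≠ 0) {α β γ : ℝ} (hα : 0 < α) (hβ : 0 < β) (hγ : 0 < γ)
    (h1 : α + β + γ = 1) (h2 : toR2 e = α • toR2 a + β • toR2 b + γ • toR2 c) :
    e ∈ latticePts (interior (hullZ V)) := by
  have hD : (det2 (b - a) (c - a) : ℝ) ≠ 0 := by exact_mod_cast hdet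
  have hDe : (det2 (b - a) (c - a) : ℝ) =
      (b.1 - a.1) * (c.2 - a.2) - (b.2 - a.2) * (c.1 - a.1) := by simp [det2]
  obtain ⟨D, hDdef⟩ : ∃ D : ℝ, D = det2 (b - a) (c - a) := ⟨_, rfl⟩
  rw [← hDdef] at hD hDe
  have he1 : (e.1 : ℝ) = α * a.1 + β * b.1 + γ * c.1 := by
    have := congrArg Prod.fst h2; simpa [toR2] using this
  have he2 : (e.2 : ℝ) = α * a.2 + β * b.2 + γ * c.2 := by
    have := congrArg Prod.snd h2; simpa [toR2] using this
  have hα' : α = 1 - β - γ := by linarith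
  let s : ℝ × ℝ → ℝ := fun p => ((p.1 - a.1) * (c.2 - a.2) - (p.2 - a.2) * (c.1 - a.1)) / D
  let t : ℝ × ℝ → ℝ := fun p => ((b.1 - a.1) * (p.2 - a.2) - (b.2 - a.2) * (p.1 - a.1)) / D
  have hs : Continuous s := by fun_prop
  have ht : Continuous t := by fun_prop
  have hU : IsOpen {p | 0 < s p ∧ 0 < t p ∧ s p + t p < 1} :=
    (isOpen_lt continuous_const hs).inter ((isOpen_lt continuous_const ht).inter
      (isOpen_lt (hs.add ht) continuous_const))
  refine interior_maximal ?_ hU ?_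
  · rintro p ⟨h3, h4, h5⟩
    have hp : p = (1 - s p - t p) • toR2 a + s p • toR2 b + t p • toR2 c := by
      ext
      · simp only [toR2, Prod.fst_add, Prod.smul_fst, smul_eq_mul, s, t]
        field_simp
        rw [hDe]
        ring
      · simp only [toR2, Prod.snd_add, Prod.smul_snd, smul_eq_mul, s, t]
        field_simp
        rw [hDe]
        ring
    have := (hullZ_convex V).sum_mem (t := Finset.univ) (w := ![1 - s p - t p, s p, t p])
      (z := ![toR2 a, toR2 b, toR2 c])
      (by simp only [Finset.mem_univ, Fin.forall_fin_succ]
          exact ⟨fun _ => by simp; linarith, fun _ => h3.le, fun _ => h4.le, by simp⟩)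
      (by simp [Fin.sum_univ_three]; ring)
      (by simp only [Finset.mem_univ, Fin.forall_fin_succ]
          exact ⟨fun _ => mem_hullZ ha, fun _ => mem_hullZ hb, fun _ => mem_hullZ hc, by simp⟩)
    rw [hp]
    simpa [Fin.sum_univ_three] using this
  · have h3 : s (toR2 e) = β := by
      simp only [s, toR2]
      rw [div_eq_iff hD, hDe, he1, he2, hα']
      ring
    have h4 : t (toR2 e) = γ := by
      simp only [t, toR2]
      rw [div_eq_iff hD, hDe, he1, he2, hα']
      ring
    refine ⟨?_, ?_, ?_⟩
    · rw [h3]; exact hβ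
    · rw [h4]; exact hγ
    · rw [h3, h4]; linarith

lemma InTri.coeff_ne_zero {a b c e : ℤ × ℤ} {α β γ : ℝ} (h1 : α + β + γ = 1)
    (h2 : toR2 e = α • toR2 a + β • toR2 b + γ • toR2 c) (hdet : det2 (c - b) (e - b) ≠ 0) :
    α ≠ 0 := by
  rintro rfl
  apply hdet
  have he1 : (e.1 : ℝ) = β * b.1 + γ * c.1 := by
    have := congrArg Prod.fst h2; simpa [toR2] using this
  have he2 : (e.2 : ℝ) = β * b.2 + γ * c.2 := by
    have := congrArg Prod.snd h2; simpa [toR2] using this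
  have : (det2 (c - b) (e - b) : ℝ) = 0 := by
    simp only [det2, Prod.fst_sub, Prod.snd_sub]
    push_cast
    rw [he1, he2]
    obtain rfl : γ = 1 - β := by linarith
    ring
  exact_mod_cast this

/-- A lattice polygon with four lattice points, one of them inside the triangle of the others. -/
lemma exceptional_of_inTri {V : Finset (ℤ × ℤ)} {a b c e : ℤ × ℤ}
    (hdec : ¬ DecZ (latticePts (hullZ V)) 2) (ha : a ∈ V) (hb : b ∈ V) (hc : c ∈ V)
    (hab : a ≠ b) (hac : a ≠ c) (hbc : b ≠ c) (hea : e ≠ a) (heb : e ≠ b) (hec : e ≠ c)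
    (h : InTri a b c e) : numPts (hullZ V) = 4 ∧ intPts (hullZ V) = 1 := by
  have hP := hullZ_convex V
  have ha' := mem_hullZ ha
  have hb' := mem_hullZ hb
  have hc' := mem_hullZ hc
  have he' := h.mem hP ha' hb' hc'
  have hodd : ∀ {a b c : ℤ × ℤ}, a ∈ latticePts (hullZ V) → b ∈ latticePts (hullZ V) →
      c ∈ latticePts (hullZ V) → a ≠ b → a ≠ c → b ≠ c → det2 (b - a) (c - a) ≠ 0 := by
    intro a b c h1 h2 h3 h4 h5 h6 h0
    have := det2_odd hP hdec h1 h2 h3 h4 h5 h6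
    rw [h0] at this
    simp at this
  have h4 : ({a, b, c, e} : Finset (ℤ × ℤ)).card = 4 := by
    rw [Finset.card_insert_of_notMem, Finset.card_insert_of_notMem, Finset.card_insert_of_notMem,
      Finset.card_singleton] <;> simp [hab, hac, hbc, hea.symm, heb.symm, hec.symm]
  have hle := numPts_le_of_not_decZ two_pos hdec
  have hsub : (({a, b, c, e} : Finset (ℤ × ℤ)) : Set (ℤ × ℤ)) ⊆ latticePts (hullZ V) := by
    intro v hv
    simp only [Finset.coe_insert, Finset.coe_singleton, Set.mem_insert_iff,
      Set.mem_singleton_iff] at hv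
    rcases hv with rfl | rfl | rfl | rfl <;> assumption
  have heq := Set.eq_of_subset_of_ncard_le hsub (by
    rw [Set.ncard_coe_finset, h4]; exact hle) (latticePts_hullZ_finite V)
  have hV : ∀ v ∈ latticePts (hullZ V), v = a ∨ v = b ∨ v = c ∨ v = e := by
    intro v hv
    rw [← heq] at hv
    simpa using hv
  refine ⟨by rw [numPts, ← heq, Set.ncard_coe_finset, h4], ?_⟩
  obtain ⟨α, β, γ, hα, hβ, hγ, h1, h2⟩ := id h
  have hint : e ∈ latticePts (interior (hullZ V)) := by
    refine mem_interior_of_barycentric ha hb hc (hodd ha' hb' hc' hab hac hbc)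
      (lt_of_le_of_ne hα (Ne.symm ?_)) (lt_of_le_of_ne hβ (Ne.symm ?_))
      (lt_of_le_of_ne hγ (Ne.symm ?_)) h1 h2
    · exact InTri.coeff_ne_zero h1 h2 (hodd hb' hc' he' hbc heb.symm hec.symm)
    · exact InTri.coeff_ne_zero (a := b) (b := c) (c := a) (α := β) (β := γ) (γ := α) (by linarith)
        (by rw [h2]; abel) (hodd hc' ha' he' hac.symm hec.symm hea.symm)
    · exact InTri.coeff_ne_zero (a := c) (b := a) (c := b) (α := γ) (β := α) (γ := β) (by linarith)
        (by rw [h2]; abel) (hodd ha' hb' he' hab hea.symm heb.symm)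
  rw [intPts, Set.ncard_eq_one]
  refine ⟨e, Set.eq_singleton_iff_unique_mem.2 ⟨hint, fun v hv => ?_⟩⟩
  rcases hV v (interior_subset (s := hullZ V) hv) with rfl | rfl | rfl | rfl
  · exact absurd hv (h.vertex_notMem_interior (fun u hu => hV u (mem_hullZ hu))
      (hodd ha' hb' hc' hab hac hbc))
  · exact absurd hv (h.rotate.vertex_notMem_interior
      (fun u hu => by have := hV u (mem_hullZ hu); tauto) (hodd hb' hc' ha' hbc hab.symm hac.symm))
  · exact absurd hv (h.rotate.rotate.vertex_notMem_interior
      (fun u hu => by have := hV u (mem_hullZ hu); tauto) (hodd hc' ha' hb' hac.symm hbc.symm hab))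
  · rfl

/-- A primitive lattice vector is part of a basis of the lattice. -/
lemma exists_det2_isUnit {P : Set (ℝ × ℝ)} (hP : Convex ℝ P) (h : ¬ DecZ (latticePts P) 2)
    {a b : ℤ × ℤ} (ha : a ∈ latticePts P) (hb : b ∈ latticePts P) (hab : a ≠ b) :
    ∃ c, IsUnit (det2 (b - a) (c - a)) := by
  obtain ⟨d, hd⟩ : ∃ d, d = b - a := ⟨_, rfl⟩
  obtain rfl : b = a + d := by rw [hd]; abel
  have hd0 : d ≠ 0 := by
    rintro rfl
    simp at hab
  have hg : Int.gcd d.1 d.2 = 1 := by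
    have hg0 : 0 < Int.gcd d.1 d.2 := by
      refine Int.gcd_pos_iff.2 ?_
      by_contra! hcon
      exact hd0 (Prod.ext hcon.1 hcon.2)
    by_contra hg1
    obtain ⟨x, hx⟩ := Int.gcd_dvd_left d.1 d.2
    obtain ⟨y, hy⟩ := Int.gcd_dvd_right d.1 d.2
    have hdx : d = Int.gcd d.1 d.2 • ((x, y) : ℤ × ℤ) := by
      refine Prod.ext ?_ ?_
      · rw [Prod.smul_fst, nsmul_eq_mul]; exact hx
      · rw [Prod.smul_snd, nsmul_eq_mul]; exact hy
    refine h (DecZ.of_segment (u := a) (d := (x, y)) ?_ fun k hk =>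
      lattice_segment hP hg0 ha (hdx ▸ hb) (hk.trans (by omega)))
    intro h0
    rw [h0, smul_zero] at hdx
    exact hd0 hdx
  have hbez := Int.gcd_eq_gcd_ab d.1 d.2
  rw [hg] at hbez
  refine ⟨a + (-Int.gcdB d.1 d.2, Int.gcdA d.1 d.2), ?_⟩
  have : det2 (a + d - a) (a + (-Int.gcdB d.1 d.2, Int.gcdA d.1 d.2) - a) = 1 := by
    simp only [det2, add_sub_cancel_left]
    push_cast at hbez
    linarith
  rw [this]
  exact isUnit_one

/-- Four lattice points all of whose triangles are unimodular form a parallelogram. -/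
lemma decZ_of_unimodular {S : Set (ℤ × ℤ)} {a b c e : ℤ × ℤ} (ha : a ∈ S) (hb : b ∈ S)
    (hc : c ∈ S) (he : e ∈ S) (h1 : IsUnit (det2 (b - a) (c - a)))
    (h2 : IsUnit (det2 (b - a) (e - a))) (h3 : IsUnit (det2 (c - a) (e - a)))
    (h4 : IsUnit (det2 (c - b) (e - b))) : DecZ S 2 := by
  obtain ⟨d, hd⟩ : ∃ d, d = b - a := ⟨_, rfl⟩
  obtain ⟨f, hf⟩ : ∃ f, f = c - a := ⟨_, rfl⟩
  obtain ⟨g, hg⟩ : ∃ g, g = e - a := ⟨_, rfl⟩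
  have hd0 : d ≠ 0 := by rintro rfl; rw [← hd] at h1; simp [det2] at h1
  have hf0 : f ≠ 0 := by rintro rfl; rw [← hf] at h1; simp [det2] at h1
  have hg0 : g ≠ 0 := by rintro rfl; rw [← hg] at h2; simp [det2] at h2
  have h4' : det2 (c - b) (e - b) = det2 d f - det2 d g + det2 f g := by
    rw [hd, hf, hg]
    simp only [det2, Prod.fst_sub, Prod.snd_sub]
    ring
  rw [h4'] at h4
  rw [← hd, ← hf] at h1
  rw [← hd, ← hg] at h2
  rw [← hf, ← hg] at h3
  obtain rfl : b = a + d := by rw [hd]; abel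
  obtain rfl : c = a + f := by rw [hf]; abel
  obtain rfl : e = a + g := by rw [hg]; abel
  have hcr1 : det2 d f * g.1 = det2 d g * f.1 - det2 f g * d.1 := by simp only [det2]; ring
  have hcr2 : det2 d f * g.2 = det2 d g * f.2 - det2 f g * d.2 := by simp only [det2]; ring
  have cases3 : g = f + d ∨ f = g + d ∨ d = f + g := by
    rw [Int.isUnit_iff] at h1 h2 h3 h4
    rcases h1 with h1 | h1 <;> rcases h2 with h2 | h2 <;> rcases h3 with h3 | h3 <;>
      rw [h1, h2, h3] at hcr1 hcr2 h4 <;> simp only [Prod.ext_iff, Prod.fst_add, Prod.snd_add] <;>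
      omega
  rcases cases3 with rfl | rfl | rfl
  · exact DecZ.of_parallelogram hd0 hf0 ha hb hc (by rwa [add_assoc, add_comm d])
  · exact DecZ.of_parallelogram hd0 hg0 ha hb he (by rwa [add_assoc, add_comm d])
  · exact DecZ.of_parallelogram hf0 hg0 ha hc he (by rwa [add_assoc])

/-- Curves whose Newton polygon contains no sum of two segments. -/
lemma card_torusZeros_le_or_exceptional {F : Type} [Field F] [Fintype F] {f : Biv F}
    (hne : (bsupp f).Nontrivial) (hdec : ¬ DecZ (latticePts (hullZ (bsupp f))) 2) :
    (torusZeros f).card ≤ Fintype.card F - 1 ∨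
      (numPts (hullZ (bsupp f)) = 4 ∧ intPts (hullZ (bsupp f)) = 1) := by
  obtain ⟨a, ha, b, hb, hab⟩ := hne
  rw [Finset.mem_coe] at ha hb
  have hP := hullZ_convex (bsupp f)
  by_cases h2 : ∀ v ∈ bsupp f, v = a ∨ v = b
  · left
    obtain ⟨c, hc⟩ := exists_det2_isUnit hP hdec (mem_hullZ ha) (mem_hullZ hb) hab
    refine card_torusZeros_le_of_unimodular (c := c) (fun v hv => ?_) hb hc
    have := h2 v hv
    simp only [Finset.mem_insert, Finset.mem_singleton]
    tauto
  push Not at h2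
  obtain ⟨c, hc, hca, hcb⟩ := h2
  have hne0 : ∀ {a b c : ℤ × ℤ}, a ∈ bsupp f → b ∈ bsupp f → c ∈ bsupp f → a ≠ b → a ≠ c →
      b ≠ c → det2 (b - a) (c - a) ≠ 0 := by
    intro a b c h1 h2 h3 h4 h5 h6 h0
    have := det2_odd hP hdec (mem_hullZ h1) (mem_hullZ h2) (mem_hullZ h3) h4 h5 h6
    rw [h0] at this
    simp at this
  have hexc : ∀ {a b c : ℤ × ℤ}, a ∈ bsupp f → b ∈ bsupp f → c ∈ bsupp f → a ≠ b → a ≠ c →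
      b ≠ c → ¬ IsUnit (det2 (b - a) (c - a)) →
      numPts (hullZ (bsupp f)) = 4 ∧ intPts (hullZ (bsupp f)) = 1 := by
    intro a b c h1 h2 h3 h4 h5 h6 h7
    obtain ⟨e, hea, heb, hec, he⟩ := exists_inTri (hne0 h1 h2 h3 h4 h5 h6) h7
    exact exceptional_of_inTri hdec h1 h2 h3 h4 h5 h6 hea heb hec he
  by_cases hu : IsUnit (det2 (b - a) (c - a))
  swap
  · exact Or.inr (hexc ha hb hc hab hca.symm hcb.symm hu)
  by_cases h3 : ∀ v ∈ bsupp f, v = a ∨ v = b ∨ v = c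
  · left
    refine card_torusZeros_le_of_unimodular (fun v hv => ?_) hb hu
    simpa using h3 v hv
  push Not at h3
  obtain ⟨e, he, hea, heb, hec⟩ := h3
  right
  by_contra hcon
  have h4 : IsUnit (det2 (b - a) (e - a)) := by
    by_contra h; exact hcon (hexc ha hb he hab hea.symm heb.symm h)
  have h5 : IsUnit (det2 (c - a) (e - a)) := by
    by_contra h; exact hcon (hexc ha hc he hca.symm hea.symm hec.symm h)
  have h6 : IsUnit (det2 (c - b) (e - b)) := by
    by_contra h; exact hcon (hexc hb hc he hcb.symm heb.symm hec.symm h)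
  exact hdec (decZ_of_unimodular (mem_hullZ ha) (mem_hullZ hb) (mem_hullZ hc) (mem_hullZ he)
    hu h4 h5 h6)

section Decompositions

variable {F : Type} [Field F] [Fintype F]

lemma minDist_add_le_of_nontrivial {V : Finset (ℤ × ℤ)} (hV : V.Nontrivial)
    (hbox : latticePts (hullZ V) ⊆ box (Fintype.card F)) :
    minDist F (toricCode F (latticePts (hullZ V))) + (Fintype.card F - 1) ≤
      (Fintype.card F - 1) ^ 2 := by
  classical
  obtain ⟨a, ha, b, hb, hab⟩ := hV
  obtain ⟨t, -, ht⟩ := Finset.exists_le_card_fiber_of_mul_le_card_of_maps_to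
    (s := (Finset.univ : Finset (Fˣ × Fˣ))) (t := (Finset.univ : Finset Fˣ))
    (f := torusChar (b - a)) (n := Fintype.card F - 1) (fun _ _ => Finset.mem_univ _)
    Finset.univ_nonempty (by simp [Fintype.card_units])
  have ha' := hbox (mem_hullZ ha)
  have hb' := hbox (mem_hullZ hb)
  have haS : ((a.1.toNat : ℤ), (a.2.toNat : ℤ)) = a := by
    rw [Int.toNat_of_nonneg ha'.1, Int.toNat_of_nonneg ha'.2.2.1]
  have hbS : ((b.1.toNat : ℤ), (b.2.toNat : ℤ)) = b := by
    rw [Int.toNat_of_nonneg hb'.1, Int.toNat_of_nonneg hb'.2.2.1]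
  obtain ⟨f, hf⟩ : ∃ f : Biv F, f = mono F b.1.toNat b.2.toNat +
    (-(t : F)) • mono F a.1.toNat a.2.toNat := ⟨_, rfl⟩
  have hfS : f ∈ VS F (latticePts (hullZ V)) := by
    rw [hf]
    refine add_mem (mono_mem_VS ?_) (Submodule.smul_mem _ _ (mono_mem_VS ?_))
    · rw [hbS]; exact mem_hullZ hb
    · rw [haS]; exact mem_hullZ ha
  have hf0 : f ≠ 0 := by
    intro h0
    have h1 := congrArg (fun g : Biv F => (g.coeff b.2.toNat).coeff b.1.toNat) (hf.symm.trans h0)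
    simp only [mono, coeff_add, coeff_smul, coeff_monomial, coeff_zero, smul_eq_mul,
      if_true] at h1
    by_cases h2 : a.2.toNat = b.2.toNat
    · have h3 : a.1.toNat ≠ b.1.toNat := by
        intro h3
        apply hab
        rw [← haS, ← hbS, h2, h3]
      simp [h2, coeff_monomial, h3] at h1
    · simp [h2] at h1
  have h1 := minDist_add_card_le (F := F) hbox hf0 (bsupp_subset_iff.2 hfS)
  have h2 : Fintype.card F - 1 ≤ (torusZeros f).card := by
    rw [card_torusZeros_eq]
    refine ht.trans ?_
    rw [← Set.ncard_coe_finset]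
    refine Set.ncard_le_ncard ?_ (Set.toFinite _)
    intro p hp
    simp only [Finset.coe_filter, Finset.mem_univ, true_and, Set.mem_ofPred_eq] at hp
    rw [Set.mem_ofPred_eq, hf, cw_add, cw_smul, cw_mono hb'.1 hb'.2.2.1, cw_mono ha'.1 ha'.2.2.1]
    have : torusChar b p = torusChar (b - a) p * torusChar a p := by
      rw [← torusChar_add, sub_add_cancel]
    simp [evalVec_eq_torusChar, this, hp]
  omega

variable (F) in
/-- A decomposition in `S` into `n` polygons whose codes account for `z` zeros. -/
def Dec (S : Set (ℤ × ℤ)) (n z : ℕ) : Prop :=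
  ∃ (V : Fin n → Finset (ℤ × ℤ)) (u : ℤ × ℤ) (zz : Fin n → ℕ),
    (∀ i, (V i).Nontrivial ∧ latticePts (hullZ (V i)) ⊆ box (Fintype.card F) ∧
      minDist F (toricCode F (latticePts (hullZ (V i)))) + zz i ≤ (Fintype.card F - 1) ^ 2) ∧
    (∀ v : Fin n → ℤ × ℤ, (∀ i, v i ∈ V i) → ∑ i, v i + u ∈ S) ∧ z ≤ ∑ i, zz i

lemma Dec.decZ {S : Set (ℤ × ℤ)} {n z : ℕ} (h : Dec F S n z) : DecZ S n := by
  obtain ⟨V, u, zz, h1, h2, -⟩ := h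
  exact ⟨V, u, fun i => (h1 i).1, h2⟩

lemma Dec.mono {S : Set (ℤ × ℤ)} {n z z' : ℕ} (h : Dec F S n z) (hz : z' ≤ z) : Dec F S n z' := by
  obtain ⟨V, u, zz, h1, h2, h3⟩ := h
  exact ⟨V, u, zz, h1, h2, hz.trans h3⟩

lemma Dec.of_fitsIn {S T : Set (ℤ × ℤ)} {n z : ℕ} (h : Dec F S n z) (hST : FitsIn S T) :
    Dec F T n z := by
  obtain ⟨V, u, zz, h1, h2, h3⟩ := h
  obtain ⟨t, ht⟩ := hST
  exact ⟨V, u + t, zz, h1, fun v hv => by rw [← add_assoc]; exact ht _ (h2 v hv), h3⟩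

lemma Dec.zero {S : Set (ℤ × ℤ)} (hS : S.Nonempty) : Dec F S 0 0 := by
  obtain ⟨u, hu⟩ := hS
  exact ⟨fun i => i.elim0, u, fun i => i.elim0, fun i => i.elim0, fun v _ => by simpa using hu,
    Nat.zero_le _⟩

lemma Dec.one {V : Finset (ℤ × ℤ)} (hV : V.Nontrivial)
    (hbox : latticePts (hullZ V) ⊆ box (Fintype.card F)) {z : ℕ}
    (hz : minDist F (toricCode F (latticePts (hullZ V))) + z ≤ (Fintype.card F - 1) ^ 2) :
    Dec F (latticePts (hullZ V)) 1 z :=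
  ⟨fun _ => V, 0, fun _ => z, fun _ => ⟨hV, hbox, hz⟩, fun v hv => by
    rw [Fin.sum_univ_one, add_zero]; exact mem_hullZ (hv 0), by simp⟩

lemma Dec.add {S T U : Set (ℤ × ℤ)} (hST : ∀ a ∈ S, ∀ b ∈ T, a + b ∈ U) {n z n' z' : ℕ}
    (h : Dec F S n z) (h' : Dec F T n' z') : Dec F U (n + n') (z + z') := by
  obtain ⟨V, u, zz, h1, h2, h3⟩ := h
  obtain ⟨V', u', zz', h1', h2', h3'⟩ := h'
  refine ⟨Fin.append V V', u + u', Fin.append zz zz', ?_, ?_, ?_⟩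
  · intro i
    refine Fin.addCases (fun i => ?_) (fun i => ?_) i
    · simp only [Fin.append_left]; exact h1 i
    · simp only [Fin.append_right]; exact h1' i
  · intro v hv
    rw [Fin.sum_univ_add, add_add_add_comm]
    refine hST _ (h2 _ fun i => ?_) _ (h2' _ fun i => ?_)
    · simpa only [Fin.append_left] using hv (Fin.castAdd n' i)
    · simpa only [Fin.append_right] using hv (Fin.natAdd n i)
  · rw [Fin.sum_univ_add]
    simp only [Fin.append_left, Fin.append_right]
    omega

lemma DecZ.dec {P : Set (ℝ × ℝ)} (hP : Convex ℝ P) (hbox : latticePts P ⊆ box (Fintype.card F))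
    {n : ℕ} (h : DecZ (latticePts P) n) :
    Dec F (latticePts P) n (n * (Fintype.card F - 1)) := by
  classical
  obtain ⟨V, u, hV, hs⟩ := h
  choose a ha using fun i => (hV i).nonempty
  let t : Fin n → ℤ × ℤ := fun i => ∑ j, a j - a i + u
  have hVP : ∀ i, ∀ v ∈ V i, v + t i ∈ latticePts P := by
    intro i v hv
    have h1 := hs (Function.update a i v) (fun j => by
      by_cases hj : j = i
      · subst hj; simpa using hv
      · simpa [hj] using ha j)
    have h2 : ∑ j, Function.update a i v j + u = v + t i := by
      rw [Finset.sum_update_of_mem (Finset.mem_univ i)]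
      have := Finset.add_sum_erase Finset.univ a (Finset.mem_univ i)
      simp only [t, ← this, Finset.sdiff_singleton_eq_erase]
      abel
    rwa [← h2]
  let W : Fin n → Finset (ℤ × ℤ) := fun i => (V i).image (· + t i)
  have hW : ∀ i, (W i).Nontrivial := by
    intro i
    obtain ⟨a, ha, b, hb, hab⟩ := hV i
    exact ⟨_, Finset.mem_coe.2 (Finset.mem_image_of_mem _ ha), _,
      Finset.mem_coe.2 (Finset.mem_image_of_mem _ hb), fun h => hab (add_right_cancel h)⟩
  have hWbox : ∀ i, latticePts (hullZ (W i)) ⊆ box (Fintype.card F) := by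
    intro i v hv
    refine hbox (hullZ_subset hP ?_ hv)
    intro w hw
    obtain ⟨w', hw', rfl⟩ := Finset.mem_image.1 hw
    exact hVP i w' hw'
  refine ⟨W, u - ∑ i, t i, fun _ => Fintype.card F - 1, fun i => ⟨hW i, hWbox i,
    minDist_add_le_of_nontrivial (hW i) (hWbox i)⟩, fun v hv => ?_, by simp⟩
  choose w hw hwv using fun i => Finset.mem_image.1 (hv i)
  have h1 := hs w hw
  have h2 : ∑ i, v i + (u - ∑ i, t i) = ∑ i, w i + u := by
    simp only [← hwv, Finset.sum_add_distrib]
    abel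
  rwa [h2]

/-- A decomposition accounting for all zeros of an optimal polynomial bounds the distance. -/
lemma Dec.exists_polygons {P : Set (ℝ × ℝ)} (hP : Convex ℝ P) {n z : ℕ} (hn : 0 < n)
    (h : Dec F (latticePts P) n z)
    (hz : (Fintype.card F - 1) ^ 2 ≤ minDist F (toricCode F (latticePts P)) + z) :
    ∃ (Q : Fin n → Set (ℝ × ℝ)) (v : Fin n → ℤ × ℤ),
      (∀ i, IsIntPolygon (Q i) ∧ (Q i).Nontrivial ∧ latticePts (Q i) ⊆ box (Fintype.card F)) ∧
      (∑ i, (fun x => x + toR2 (v i)) '' Q i) ⊆ P ∧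
      (minDist F (toricCode F (latticePts P)) : ℤ) ≥
        (∑ i, (minDist F (toricCode F (latticePts (Q i))) : ℤ)) -
          ((n : ℤ) - 1) * ((Fintype.card F : ℤ) - 1) ^ 2 := by
  obtain ⟨V, u, zz, h1, h2, h3⟩ := h
  refine ⟨fun i => hullZ (V i), Pi.single ⟨0, hn⟩ u, fun i => ⟨⟨V i, (h1 i).1.nonempty, rfl⟩,
    hullZ_nontrivial (h1 i).1, (h1 i).2.1⟩, ?_, ?_⟩
  · intro x hx
    obtain ⟨y, hy, rfl⟩ := (Set.mem_fintype_sum _ _).1 hx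
    choose w hw hwy using hy
    have := sum_hullZ_add_mem hP h2 (y := w) hw
    convert this using 1
    rw [← Finset.sum_congr rfl fun i _ => hwy i, Finset.sum_add_distrib, ← toR2_sum]
    simp
  · have h4 : ∑ i, minDist F (toricCode F (latticePts (hullZ (V i)))) + ∑ i, zz i ≤
        n * (Fintype.card F - 1) ^ 2 := by
      rw [← Finset.sum_add_distrib]
      refine (Finset.sum_le_sum fun i _ => (h1 i).2.2).trans ?_
      simp
    have h5 : ∑ i, minDist F (toricCode F (latticePts (hullZ (V i)))) + (Fintype.card F - 1) ^ 2 ≤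
        n * (Fintype.card F - 1) ^ 2 + minDist F (toricCode F (latticePts P)) := by omega
    have hq : 1 ≤ Fintype.card F := Fintype.card_pos
    zify [hq] at h5
    linarith

end Decompositions

section Factors

variable {F : Type} [Field F] [Fintype F]

lemma card_torusZeros_mul_le (g a : Biv F) :
    (torusZeros (g * a)).card ≤ (torusZeros g).card + (torusZeros a).card := by
  classical
  refine le_trans (Finset.card_le_card ?_) (Finset.card_union_le _ _)
  intro p hp
  simp only [Finset.mem_union, mem_torusZeros, evalEval_mul, mul_eq_zero] at hp ⊢
  tauto

lemma evalEval_ne_zero_of_isUnit {F : Type} [Field F] {g : Biv F} (hg : IsUnit g) (x y : F) :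
    g.evalEval x y ≠ 0 :=
  (hg.map (evalEvalRingHom x y)).ne_zero

lemma torusZeros_eq_empty_of_isUnit {g : Biv F} (hg : IsUnit g) : torusZeros g = ∅ := by
  rw [Finset.eq_empty_iff_forall_notMem]
  intro p hp
  exact evalEval_ne_zero_of_isUnit hg _ _ (mem_torusZeros.1 hp).2.2

/-- An irreducible polynomial divisible by a coordinate has no zeros in the torus. -/
lemma torusZeros_eq_empty_of_dvd {m g : Biv F} (hm : Irreducible m) (hg : Irreducible g)
    (h : m ∣ g) (h0 : ∀ x y : F, x ≠ 0 → y ≠ 0 → m.evalEval x y ≠ 0) : torusZeros g = ∅ := by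
  obtain ⟨u, rfl⟩ := hm.associated_of_dvd hg h
  rw [Finset.eq_empty_iff_forall_notMem]
  intro p hp
  obtain ⟨h1, h2, h3⟩ := mem_torusZeros.1 hp
  rw [evalEval_mul, mul_eq_zero] at h3
  rcases h3 with h3 | h3
  · exact h0 _ _ h1 h2 h3
  · exact evalEval_ne_zero_of_isUnit u.isUnit _ _ h3

lemma card_torusZeros_C_le {h : F[X]} (h0 : h ≠ 0) :
    (torusZeros (C h : Biv F)).card ≤ h.natDegree * (Fintype.card F - 1) := by
  classical
  have h1 : torusZeros (C h : Biv F) ⊆ h.roots.toFinset ×ˢ (Finset.univ.erase (0 : F)) := by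
    intro p hp
    obtain ⟨h1, h2, h3⟩ := mem_torusZeros.1 hp
    simp only [Finset.mem_product, Multiset.mem_toFinset, mem_roots h0, Finset.mem_erase,
      Finset.mem_univ, and_true, IsRoot]
    rw [evalEval_C] at h3
    exact ⟨h3, h2⟩
  refine (Finset.card_le_card h1).trans ?_
  rw [Finset.card_product, Finset.card_erase_of_mem (Finset.mem_univ _), Finset.card_univ]
  exact Nat.mul_le_mul_right _ ((Multiset.toFinset_card_le _).trans (card_roots' h))

/-- Irreducible curves whose Newton polygon has four lattice points, one of them interior. -/
structure IsExceptional (g : Biv F) : Prop where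
  irreducible : Irreducible g
  natDegree_pos : 0 < g.natDegree
  coeff_zero_ne : g.coeff 0 ≠ 0
  numPts_eq : numPts (hullZ (bsupp g)) = 4
  intPts_eq : intPts (hullZ (bsupp g)) = 1

lemma dec_of_irreducible {g : Biv F} (hg : Irreducible g)
    (hbox : latticePts (hullZ (bsupp g)) ⊆ box (Fintype.card F)) (h49 : 49 ≤ Fintype.card F)
    (hI : (4 * intPts (hullZ (bsupp g)) + 3) ^ 2 ≤ Fintype.card F) {B : ℕ}
    (hB : ∀ n, DecZ (latticePts (hullZ (bsupp g))) n → n ≤ B) :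
    ∃ c, Dec F (latticePts (hullZ (bsupp g))) c (torusZeros g).card ∧
      ((torusZeros g).card ≤ c * (Fintype.card F - 1) ∨ (c = 1 ∧ IsExceptional g)) := by
  classical
  have hP := hullZ_convex (bsupp g)
  have hSne : (latticePts (hullZ (bsupp g))).Nonempty := by
    obtain ⟨u, hu⟩ := bsupp_nonempty hg.ne_zero
    exact ⟨u, mem_hullZ hu⟩
  have hempty : torusZeros g = ∅ → ∃ c, Dec F (latticePts (hullZ (bsupp g))) c (torusZeros g).card ∧
      ((torusZeros g).card ≤ c * (Fintype.card F - 1) ∨ (c = 1 ∧ IsExceptional g)) := by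
    intro h
    refine ⟨0, ?_, Or.inl ?_⟩
    · rw [h]; exact Dec.zero hSne
    · rw [h]; simp
  rcases Nat.eq_zero_or_pos g.natDegree with hw | hw
  · obtain ⟨h, rfl⟩ : ∃ h : F[X], g = C h := ⟨_, eq_C_of_natDegree_eq_zero hw⟩
    have hh0 : h ≠ 0 := by
      rintro rfl
      exact hg.ne_zero (by simp)
    by_cases hc : h.coeff 0 = 0
    · refine hempty (torusZeros_eq_empty_of_dvd (m := C X) ?_ hg ?_ ?_)
      · exact (prime_C_iff.2 prime_X).irreducible
      · exact _root_.map_dvd C (X_dvd_iff.2 hc)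
      · intro x y hx _
        rw [evalEval_C, eval_X]
        exact hx
    · have hd : 0 < h.natDegree := by
        rw [Nat.pos_iff_ne_zero]
        intro hd
        apply hg.not_isUnit
        rw [eq_C_of_natDegree_eq_zero hd]
        exact ((isUnit_iff_ne_zero.2 hc).map C).map C
      have h1 : ((0 : ℤ), (0 : ℤ)) ∈ bsupp (C h : Biv F) := by
        have := mk_mem_bsupp (f := (C h : Biv F)) (i := 0) (m := 0)
        simp only [Nat.cast_zero, coeff_C_zero] at this
        exact this.2 hc
      have h2 : ((h.natDegree : ℤ), (0 : ℤ)) ∈ bsupp (C h : Biv F) := by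
        have := mk_mem_bsupp (f := (C h : Biv F)) (i := h.natDegree) (m := 0)
        simp only [Nat.cast_zero, coeff_C_zero] at this
        exact this.2 (by simpa using hh0)
      have h3 : DecZ (latticePts (hullZ (bsupp (C h : Biv F)))) h.natDegree := by
        refine DecZ.of_segment (u := (0, 0)) (d := (1, 0)) (by simp) fun k hk =>
          lattice_segment hP hd (mem_hullZ h1) ?_ hk
        have : ((0 : ℤ), (0 : ℤ)) + h.natDegree • ((1 : ℤ), (0 : ℤ)) = ((h.natDegree : ℤ), (0 : ℤ)) := by
          simp
        rw [this]
        exact mem_hullZ h2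
      have h4 := card_torusZeros_C_le hh0
      exact ⟨h.natDegree, (h3.dec hP hbox).mono h4, Or.inl h4⟩
  by_cases h0 : g.coeff 0 = 0
  · refine hempty (torusZeros_eq_empty_of_dvd (m := X) irreducible_X hg (X_dvd_iff.2 h0) ?_)
    intro x y _ hy
    simpa using hy
  have hne : (bsupp g).Nontrivial := by
    have hs := isStrip_bsupp hw h0
    obtain ⟨u, hu, hu0⟩ := hs.bot
    obtain ⟨v, hv, hv0⟩ := hs.top
    refine ⟨u, hu, v, hv, ?_⟩
    rintro rfl
    omega
  have hone : Dec F (latticePts (hullZ (bsupp g))) 1 (torusZeros g).card :=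
    Dec.one hne hbox (minDist_add_card_le hbox hg.ne_zero fun v hv => mem_hullZ hv)
  have hB1 : 1 ≤ B := hB 1 hone.decZ
  obtain ⟨L, hL⟩ : ∃ L, L = Nat.findGreatest (DecZ (latticePts (hullZ (bsupp g)))) B := ⟨_, rfl⟩
  have hL1 : 1 ≤ L := hL ▸ Nat.le_findGreatest hB1 hone.decZ
  have hLD : DecZ (latticePts (hullZ (bsupp g))) L :=
    hL ▸ Nat.findGreatest_spec hB1 hone.decZ
  have hLn : ¬ DecZ (latticePts (hullZ (bsupp g))) (L + 1) := fun h =>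
    Nat.findGreatest_is_greatest (by omega) (hB _ h) h
  rcases hL1.lt_or_eq with hL2 | hL2
  · have h1 : (torusZeros g).card ≤ L * (Fintype.card F - 1) :=
      card_torusZeros_le_of_irreducible hg hw h0 (fun v hv => hbox (mem_hullZ hv)) h49 hI
        hL2 (numPts_le_of_not_decZ (Nat.succ_pos L) hLn)
    exact ⟨L, (hLD.dec hP hbox).mono h1, Or.inl h1⟩
  · subst hL2
    refine ⟨1, hone, ?_⟩
    rcases card_torusZeros_le_or_exceptional hne hLn with h1 | ⟨h1, h2⟩
    · left; simpa using h1
    · exact Or.inr ⟨rfl, hg, hw, h0, h1, h2⟩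

/-- The polygons of the factors of `f`, with the exceptional factors listed separately. -/
lemma dec_of_factorization (h49 : 49 ≤ Fintype.card F) {B : ℕ} (f : Biv F) (hf : f ≠ 0)
    (hbox : latticePts (hullZ (bsupp f)) ⊆ box (Fintype.card F))
    (hI : (4 * intPts (hullZ (bsupp f)) + 3) ^ 2 ≤ Fintype.card F)
    (hB : ∀ n, DecZ (latticePts (hullZ (bsupp f))) n → n ≤ B) :
    ∃ (c : ℕ) (l : List (Biv F)), (∀ e ∈ l, IsExceptional e) ∧ l.prod ∣ f ∧
      Dec F (latticePts (hullZ (bsupp f))) c (torusZeros f).card ∧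
      (torusZeros f).card + l.length * (Fintype.card F - 1) ≤
        c * (Fintype.card F - 1) + (l.map fun e => (torusZeros e).card).sum := by
  induction f using UniqueFactorizationMonoid.induction_on_prime with
  | h₁ => exact absurd rfl hf
  | h₂ u hu =>
    refine ⟨0, [], by simp, by simp, ?_, ?_⟩
    · obtain ⟨v, hv⟩ := bsupp_nonempty hf
      rw [torusZeros_eq_empty_of_isUnit hu]
      exact Dec.zero ⟨v, mem_hullZ hv⟩
    · simp [torusZeros_eq_empty_of_isUnit hu]
  | h₃ a p ha hp ih =>
    have hIle : ∀ g, g ∣ p * a → (4 * intPts (hullZ (bsupp g)) + 3) ^ 2 ≤ Fintype.card F := by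
      intro g hg
      have := intPts_le_of_dvd hg hf
      exact (Nat.pow_le_pow_left (by omega) 2).trans hI
    have hpd : p ∣ p * a := dvd_mul_right _ _
    have had : a ∣ p * a := dvd_mul_left _ _
    obtain ⟨c, l, hl, hld, hdec, hcount⟩ := ih ha (latticePts_subset_box_of_dvd had hf hbox)
      (hIle a had) (fun n hn => hB n (hn.of_fitsIn (fitsIn_of_dvd had hf)))
    obtain ⟨c', hdec', hcases⟩ := dec_of_irreducible hp.irreducible
      (latticePts_subset_box_of_dvd hpd hf hbox) h49 (hIle p hpd)
      (fun n hn => hB n (hn.of_fitsIn (fitsIn_of_dvd hpd hf)))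
    have hN := card_torusZeros_mul_le p a
    have hD : Dec F (latticePts (hullZ (bsupp (p * a)))) (c' + c) (torusZeros (p * a)).card :=
      (hdec'.add (fun u hu v hv => add_mem_latticePts_mul hu hv) hdec).mono hN
    rcases hcases with h1 | ⟨rfl, hexc⟩
    · refine ⟨c' + c, l, hl, hld.trans had, hD, ?_⟩
      rw [add_mul]
      omega
    · refine ⟨1 + c, p :: l, ?_, ?_, hD, ?_⟩
      · intro e he
        rcases List.mem_cons.1 he with rfl | he
        · exact hexc
        · exact hl e he
      · rw [List.prod_cons]
        exact mul_dvd_mul_left p hld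
      · rw [List.length_cons, List.map_cons, List.sum_cons, add_mul, add_mul]
        omega

lemma numPts_prod_ge {F : Type} [Field F] {l : List (Biv F)} (hl : ∀ e ∈ l, IsExceptional e) :
    3 * l.length + 1 ≤ numPts (hullZ (bsupp l.prod)) := by
  classical
  induction l with
  | nil =>
    obtain ⟨u, hu⟩ := bsupp_nonempty (one_ne_zero (α := Biv F))
    simp only [List.length_nil, List.prod_nil, mul_zero, zero_add]
    exact (Set.ncard_pos (latticePts_hullZ_finite _)).2 ⟨u, mem_hullZ hu⟩
  | cons e l ih =>
    have ih := ih fun e he => hl e (List.mem_cons_of_mem _ he)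
    have he := (hl e List.mem_cons_self).numPts_eq
    have hadd : ((latticePts_hullZ_finite (bsupp e)).toFinset +
        (latticePts_hullZ_finite (bsupp l.prod)).toFinset) ⊆
        (latticePts_hullZ_finite (bsupp (e :: l).prod)).toFinset := by
      intro v hv
      obtain ⟨a, ha, b, hb, rfl⟩ := Finset.mem_add.1 hv
      rw [Set.Finite.mem_toFinset] at ha hb ⊢
      rw [List.prod_cons]
      exact add_mem_latticePts_mul ha hb
    have hcard := Finset.card_le_card hadd
    rw [numPts, Set.ncard_eq_toFinset_card _ (latticePts_hullZ_finite _)] at ih he ⊢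
    have hcd := cauchy_davenport_of_isAddTorsionFree
      (s := (latticePts_hullZ_finite (bsupp e)).toFinset)
      (t := (latticePts_hullZ_finite (bsupp l.prod)).toFinset)
      (Finset.card_pos.1 (by omega)) (Finset.card_pos.1 (by omega))
    rw [List.length_cons]
    omega

lemma intPts_prod_ge {F : Type} [Field F] {e : Biv F} {l : List (Biv F)}
    (hl : ∀ g ∈ e :: l, IsExceptional g) :
    3 * l.length + 1 ≤ intPts (hullZ (bsupp (e :: l).prod)) := by
  refine (numPts_prod_ge fun g hg => hl g (List.mem_cons_of_mem _ hg)).trans ?_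
  obtain ⟨u, hu⟩ := Set.nonempty_of_ncard_ne_zero
    (by rw [← intPts, (hl e List.mem_cons_self).intPts_eq]; exact one_ne_zero)
  refine Set.ncard_le_ncard_of_injOn (fun v => u + v) (fun v hv => ?_)
    (add_right_injective u).injOn (latticePts_interior_finite _)
  rw [List.prod_cons]
  exact add_mem_interior_mul hu hv

lemma sum_exceptional_le (h49 : 49 ≤ Fintype.card F) {f : Biv F} (hf : f ≠ 0)
    (hbox : latticePts (hullZ (bsupp f)) ⊆ box (Fintype.card F))
    (hI : (4 * intPts (hullZ (bsupp f)) + 3) ^ 2 ≤ Fintype.card F) {l : List (Biv F)}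
    (hl : ∀ e ∈ l, IsExceptional e) (hld : l.prod ∣ f) :
    (l.map fun e => (torusZeros e).card).sum ≤ (l.length + 1) * (Fintype.card F - 1) := by
  rcases l with _ | ⟨e, l⟩
  · simp
  have hint := (intPts_prod_ge hl).trans (intPts_le_of_dvd hld hf)
  rcases l with _ | ⟨e', l⟩
  · have he := hl e List.mem_cons_self
    have hed : e ∣ f := by simpa using hld
    have := card_torusZeros_le_of_irreducible he.irreducible he.natDegree_pos he.coeff_zero_ne
      (fun v hv => latticePts_subset_box_of_dvd hed hf hbox (mem_hullZ hv)) h49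
      (by rw [he.intPts_eq]; exact h49) le_rfl (by rw [he.numPts_eq]; norm_num)
    simpa using this
  · obtain ⟨m, hm⟩ : ∃ m, m = e :: e' :: l := ⟨_, rfl⟩
    have hlen : m.length = l.length + 2 := by rw [hm]; simp
    rw [← hm] at hl ⊢
    have hq : (12 * m.length - 5) ^ 2 ≤ Fintype.card F := by
      refine (Nat.pow_le_pow_left ?_ 2).trans hI
      rw [List.length_cons] at hint
      omega
    have h1 : ∀ g ∈ m, m.length * (torusZeros g).card ≤ (m.length + 1) * (Fintype.card F - 1) := by
      intro g hg
      have := hl g hg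
      exact card_torusZeros_le_of_exceptional this.irreducible this.natDegree_pos
        this.coeff_zero_ne this.intPts_eq.le this.numPts_eq.le (by omega) hq
    have h2 := List.sum_le_card_nsmul (m.map fun g => m.length * (torusZeros g).card)
      ((m.length + 1) * (Fintype.card F - 1)) (by
        intro x hx
        obtain ⟨g, hg, rfl⟩ := List.mem_map.1 hx
        exact h1 g hg)
    rw [List.sum_map_mul_left, List.length_map, smul_eq_mul] at h2
    exact Nat.le_of_mul_le_mul_left h2 (by omega)

end Factors

end

/-- Theorem 1.2 (main theorem): lower bound for the minimum distance of a toric surface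
code via a Minkowski sum decomposition with the maximal number of summands. -/
theorem main_theorem (q : ℕ) (F : Type) [Field F] [Fintype F] (hF : Fintype.card F = q)
    (P : Set (ℝ × ℝ)) (hP : IsIntPolygon P) (hbox : latticePts P ⊂ box q)
    (hint : 0 < intPts P) (hq : (4 * intPts P + 3) ^ 2 ≤ q)
    (ℓ : ℕ) (hℓpos : 0 < ℓ) (hℓ : HasDecomp P ℓ)
    (hℓmax : ∀ n, HasDecomp P n → n ≤ ℓ) :
    ∃ (Q : Fin ℓ → Set (ℝ × ℝ)) (v : Fin ℓ → ℤ × ℤ),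
      (∀ i, IsIntPolygon (Q i) ∧ (Q i).Nontrivial ∧ latticePts (Q i) ⊆ box q) ∧
      (∑ i, (fun x => x + toR2 (v i)) '' Q i) ⊆ P ∧
      (minDist F (toricCode F (latticePts P)) : ℤ) ≥
        (∑ i, (minDist F (toricCode F (latticePts (Q i))) : ℤ)) -
          ((ℓ : ℤ) - 1) * ((q : ℤ) - 1) ^ 2 := by
  subst hF
  obtain ⟨V, hV, rfl⟩ := hP
  change latticePts (hullZ V) ⊂ _ at hbox
  change 0 < intPts (hullZ V) at hint
  change (4 * intPts (hullZ V) + 3) ^ 2 ≤ _ at hq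
  change HasDecomp (hullZ V) ℓ at hℓ
  change ∀ n, HasDecomp (hullZ V) n → n ≤ ℓ at hℓmax
  have h49 : 49 ≤ Fintype.card F := by nlinarith
  obtain ⟨f, hf, hfV, hd⟩ := exists_minDist_eq hbox.subset
    (hV.elim fun v hv => ⟨v, mem_hullZ hv⟩)
  have hsub : hullZ (bsupp f) ⊆ hullZ V := hullZ_subset (hullZ_convex V) fun v hv => hfV hv
  have hpts : latticePts (hullZ (bsupp f)) ⊆ latticePts (hullZ V) := fun _ hv => hsub hv
  have hfits : FitsIn (latticePts (hullZ (bsupp f))) (latticePts (hullZ V)) :=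
    ⟨0, fun v hv => by rw [add_zero]; exact hpts hv⟩
  have hint_le : intPts (hullZ (bsupp f)) ≤ intPts (hullZ V) :=
    Set.ncard_le_ncard (fun _ hv => interior_mono hsub hv) (latticePts_interior_finite V)
  have hB : ∀ n, DecZ (latticePts (hullZ (bsupp f))) n → n ≤ ℓ := fun n hn => by
    rcases n.eq_zero_or_pos with rfl | hpos
    · exact Nat.zero_le _
    · exact hℓmax n ((hn.of_fitsIn hfits).hasDecomp (hullZ_convex V) hpos)
  have hI : (4 * intPts (hullZ (bsupp f)) + 3) ^ 2 ≤ Fintype.card F :=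
    (Nat.pow_le_pow_left (by omega) 2).trans hq
  have hfbox := hpts.trans hbox.subset
  obtain ⟨c, l, hl, hlf, hdec, hN⟩ := dec_of_factorization h49 f hf hfbox hI hB
  rcases (hB c hdec.decZ).eq_or_lt with rfl | hlt
  · exact (hdec.of_fitsIn hfits).exists_polygons (hullZ_convex V) hℓpos hd.ge
  · refine (hℓ.decZ.dec (hullZ_convex V) hbox.subset).exists_polygons (hullZ_convex V) hℓpos ?_
    have hsum := sum_exceptional_le h49 hf hfbox hI hl hlf
    have hmul := Nat.mul_le_mul_right (Fintype.card F - 1) (Nat.succ_le_of_lt hlt)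
    rw [Nat.succ_mul] at hmul
    rw [Nat.succ_mul] at hsum
    omega
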